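/- arXiv:2207.12860 — 8 statements merged into one kernel-verified Lean document; each statement's English description precedes it below -/
import Mathlib

section
/- Let F denote the Fibonacci sequence (F_0 = 0, F_1 = 1, F_{n+2} = F_{n+1} + F_n). If n, m, l, a are positive integers with n ≥ m ≥ l satisfying |F_n + F_m + F_l - 2^a| < 2^(a/2), then n ≤ 42 and a ≤ 28. -/
open Finset

open Polynomial in
theorem exists_int_add_mul_golden (P : ℤ[X]) :
    ∃ u v : ℤ, aeval Real.goldenRatio P = u + v * Real.goldenRatio ∧
      aeval Real.goldenConj P = u + v * Real.goldenConj := by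
  induction P using Polynomial.induction_on' with
  | add p q hp hq =>
    obtain ⟨u, v, h1, h2⟩ := hp
    obtain ⟨u', v', h3, h4⟩ := hq
    refine ⟨u + u', v + v', ?_, ?_⟩
    · rw [map_add, h1, h3]; push_cast; ring
    · rw [map_add, h2, h4]; push_cast; ring
  | monomial n c =>
    induction n with
    | zero => exact ⟨c, 0, by simp, by simp⟩
    | succ k ih =>
      obtain ⟨u, v, h1, h2⟩ := ih
      have e : monomial (k + 1) c = monomial k c * (X : ℤ[X]) := by
        rw [monomial_mul_X]
      refine ⟨v, u + v, ?_, ?_⟩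
      · rw [e, map_mul, h1, aeval_X]; push_cast
        linear_combination (v : ℝ) * Real.goldenRatio_sq
      · rw [e, map_mul, h2, aeval_X]; push_cast
        linear_combination (v : ℝ) * Real.goldenConj_sq

open Polynomial in
theorem one_le_abs_aeval_golden_mul (P : ℤ[X]) (hP : aeval Real.goldenRatio P ≠ 0) :
    1 ≤ |aeval Real.goldenRatio P| * |aeval Real.goldenConj P| := by
  obtain ⟨u, v, h1, h2⟩ := exists_int_add_mul_golden P
  have hprod : aeval Real.goldenRatio P * aeval Real.goldenConj P
      = ((u * u + u * v - v * v : ℤ) : ℝ) := by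
    rw [h1, h2]; push_cast
    linear_combination (u : ℝ) * v * Real.goldenRatio_add_goldenConj +
      (v : ℝ) * v * Real.goldenRatio_mul_goldenConj
  have h0 : aeval Real.goldenConj P ≠ 0 := by
    intro h0
    rw [h2] at h0
    rcases eq_or_ne v 0 with rfl | hv
    · apply hP
      rw [h1]
      simpa using h0
    · refine Real.goldenConj_irrational.ne_rat (-u / v) ?_
      have : (v : ℝ) ≠ 0 := by exact_mod_cast hv
      push_cast
      rw [eq_div_iff this]
      linarith
  have h3 : (u * u + u * v - v * v : ℤ) ≠ 0 := by
    intro h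
    rw [h] at hprod
    simp [hP, h0] at hprod
  rw [← abs_mul, hprod, ← Int.cast_abs]
  exact_mod_cast Int.one_le_abs h3

theorem abs_det_le_factorial_mul_prod {ι : Type*} [Fintype ι] [DecidableEq ι]
    (M : Matrix ι ι ℝ) (B C : ι → ℝ) (h : ∀ c t, |M c t| ≤ B c * C t) :
    |M.det| ≤ (Fintype.card ι).factorial * ((∏ c, B c) * ∏ t, C t) := by
  rw [Matrix.det_apply]
  refine (abs_sum_le_sum_abs _ _).trans ?_
  have : ∀ σ ∈ (univ : Finset (Equiv.Perm ι)),
      |Equiv.Perm.sign σ • ∏ i, M (σ i) i| ≤ (∏ c, B c) * ∏ t, C t := by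
    intro σ _
    have e : |Equiv.Perm.sign σ • ∏ i, M (σ i) i| = ∏ i, |M (σ i) i| := by
      rcases Int.units_eq_one_or (Equiv.Perm.sign σ) with h | h <;> simp [h, abs_prod]
    rw [e, ← Equiv.prod_comp σ B, ← prod_mul_distrib]
    exact prod_le_prod (fun i _ => abs_nonneg _) (fun i _ => h _ _)
  refine (sum_le_card_nsmul _ _ _ this).trans ?_
  rw [card_univ, Fintype.card_perm, nsmul_eq_mul]

theorem sum_ge_of_injOn_lt {ι : Type*} [Fintype ι] (e : ι → ℕ)
    (h : ∀ c c', e c = e c' → e c < Fintype.card ι → c = c') :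
    Fintype.card ι * (Fintype.card ι - 1) / 2 ≤ ∑ c, e c := by
  classical
  set N := Fintype.card ι
  have h1 : ∀ c, ∑ v ∈ range N, (if v < e c then 1 else 0) ≤ e c := by
    intro c
    rw [← card_filter]
    calc _ ≤ (range (e c)).card := card_le_card (by intro v; simp)
      _ = e c := card_range _
  have h2 : ∀ v ∈ range N, N - 1 - v ≤ ∑ c, (if v < e c then 1 else 0) := by
    intro v hv
    rw [mem_range] at hv
    rw [← card_filter]
    have h3 : (univ.filter fun c => ¬ v < e c).card ≤ v + 1 := by
      rw [← card_range (v + 1)]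
      refine card_le_card_of_injOn e ?_ ?_
      · intro c; simp
      · intro c hc c' _ hcc
        simp at hc
        exact h c c' hcc (by omega)
    have h4 := card_filter_add_card_filter_not (s := (univ : Finset ι)) (fun c => v < e c)
    rw [card_univ] at h4
    change _ = N at h4
    omega
  calc N * (N - 1) / 2 = ∑ v ∈ range N, (N - 1 - v) := by
        rw [sum_range_reflect (fun x => x) N, sum_range_id]
    _ ≤ ∑ v ∈ range N, ∑ c, (if v < e c then 1 else 0) := sum_le_sum h2
    _ = ∑ c, ∑ v ∈ range N, (if v < e c then 1 else 0) := sum_comm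
    _ ≤ _ := sum_le_sum fun c _ => h1 c

theorem pow_mul_abs_det_le {ι : Type*} [Fintype ι] [DecidableEq ι] {T : ℕ}
    (a : ι → Fin T → ℝ) (x : ι → ℝ) (g : ι → ι → ℝ) (δ : ι → ℝ) (X E : ℝ)
    (hE : 1 ≤ E) (hx : ∀ t, |x t| ≤ X) (hg : ∀ c t, |g c t| ≤ δ c) (hX : 0 ≤ X)
    (hδ : ∀ c, 0 ≤ δ c) :
    E ^ (Fintype.card ι * (Fintype.card ι - 1) / 2) *
      |(Matrix.of fun c t => ∑ m, a c m * x t ^ (m : ℕ) + g c t).det| ≤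
    (Fintype.card ι).factorial *
      ∏ c, (∑ m, |a c m| * (E * X) ^ (m : ℕ) + δ c * E ^ Fintype.card ι) := by
  set N := Fintype.card ι
  let s : ι → Option (Fin T) → ℝ := fun c o => o.elim 1 (fun m => a c m)
  let u : ι → Option (Fin T) → ι → ℝ := fun c o t => o.elim (g c t) (fun m => x t ^ (m : ℕ))
  let w : ι → Option (Fin T) → ℝ :=
    fun c o => o.elim (δ c * E ^ N) (fun m => |a c m| * (E * X) ^ (m : ℕ))
  have hdet : (Matrix.of fun c t => ∑ m, a c m * x t ^ (m : ℕ) + g c t).det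
      = ∑ r : ι → Option (Fin T), (Matrix.of fun c t => s c (r c) * u c (r c) t).det := by
    have := (Matrix.detRowAlternating (R := ℝ) (n := ι)).toMultilinearMap.map_sum
      (fun c (o : Option (Fin T)) => (fun t => s c o * u c o t : ι → ℝ))
    refine Eq.trans ?_ this
    change _ = Matrix.det _
    congr 1
    ext c t
    simp [s, u, Fintype.sum_option, add_comm]
  have hw : ∏ c, (∑ m, |a c m| * (E * X) ^ (m : ℕ) + δ c * E ^ N)
      = ∑ r : ι → Option (Fin T), ∏ c, w c (r c) := by
    rw [← Fintype.prod_sum]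
    refine prod_congr rfl fun c _ => ?_
    simp [w, Fintype.sum_option, add_comm]
  rw [hdet, hw, mul_sum]
  refine (mul_le_mul_of_nonneg_left (abs_sum_le_sum_abs _ _) (by positivity)).trans ?_
  rw [mul_sum]
  refine sum_le_sum fun r _ => ?_
  have hwnn : ∀ c o, 0 ≤ w c o := by
    intro c o
    have := hδ c
    cases o <;> simp [w] <;> positivity
  have hmul : (Matrix.of fun c t => s c (r c) * u c (r c) t).det =
      (∏ c, s c (r c)) * (Matrix.of fun c t => u c (r c) t).det :=
    Matrix.det_mul_column (fun c => s c (r c)) (Matrix.of fun c t => u c (r c) t)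
  rw [hmul]
  by_cases hinj : ∃ c c', c ≠ c' ∧ r c = r c' ∧ r c ≠ none
  · obtain ⟨c, c', hne, hrr, hsome⟩ := hinj
    have : (Matrix.of fun c t => u c (r c) t).det = 0 := by
      refine Matrix.det_zero_of_row_eq hne ?_
      ext t
      obtain ⟨m, hm⟩ := Option.ne_none_iff_exists'.1 hsome
      simp [u, ← hrr, hm]
    rw [this]
    simp only [mul_zero, abs_zero]
    exact mul_nonneg (by positivity) (prod_nonneg fun c _ => hwnn _ _)
  · push Not at hinj
    let e : ι → ℕ := fun c => (r c).elim N (fun m => (m : ℕ))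
    have he := sum_ge_of_injOn_lt e (by
      intro c c' hcc hlt
      by_contra hne
      rcases hrc : r c with _ | m
      · simp [e, hrc, N] at hlt
      · rcases hrc' : r c' with _ | m'
        · simp [e, hrc', hcc, N] at hlt
        · simp only [e, hrc, hrc', Option.elim_some] at hcc
          have := hinj c c' hne (by rw [hrc, hrc', Fin.ext hcc])
          simp [hrc] at this)
    have h1 := abs_det_le_factorial_mul_prod (Matrix.of fun c t => u c (r c) t)
      (fun c => (r c).elim (δ c) (fun m => X ^ (m : ℕ))) (fun _ => 1) (by
        intro c t
        rcases hrc : r c with _ | m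
        · simpa [u, hrc] using hg c t
        · simp only [u, hrc, Matrix.of_apply, Option.elim_some, mul_one, abs_pow]
          exact pow_le_pow_left₀ (abs_nonneg _) (hx t) _)
    rw [abs_mul, abs_prod]
    calc E ^ (N * (N - 1) / 2) *
          ((∏ c, |s c (r c)|) * |(Matrix.of fun c t => u c (r c) t).det|)
        ≤ E ^ (∑ c, e c) * ((∏ c, |s c (r c)|) * (N.factorial *
          ((∏ c, (r c).elim (δ c) (fun m => X ^ (m : ℕ))) * ∏ _t : ι, 1))) := by
          gcongr
      _ = N.factorial * ∏ c, (E ^ e c * |s c (r c)| *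
            (r c).elim (δ c) (fun m => X ^ (m : ℕ))) := by
          rw [← prod_pow_eq_pow_sum, prod_mul_distrib, prod_mul_distrib]; simp; ring
      _ ≤ _ := by
          refine le_of_eq ?_
          congr 1
          refine prod_congr rfl fun c _ => ?_
          rcases hrc : r c with _ | m
          · simp [e, s, w, hrc]; ring
          · simp [e, s, w, hrc, mul_pow]; ring

theorem exists_rows_det_ne_zero {τ κ : Type*} [Fintype κ] [DecidableEq κ] (f : τ → κ → ℝ)
    (h : ∀ p : κ → ℝ, (∀ t, ∑ c, p c * f t c = 0) → p = 0) :
    ∃ e : κ → τ, (Matrix.of fun c c' => f (e c) c').det ≠ 0 := by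
  have hspan : Submodule.span ℝ (Set.range f) = ⊤ := by
    by_contra hne
    obtain ⟨φ, hφ, hle⟩ := Submodule.exists_le_ker_of_lt_top _ (lt_top_iff_ne_top.2 hne)
    apply hφ
    have hp := h (fun c => φ (Pi.single c 1)) (by
      intro t
      have h1 : φ (f t) = 0 := hle (Submodule.subset_span ⟨t, rfl⟩)
      rw [← h1]
      conv_rhs => rw [← (Pi.basisFun ℝ κ).sum_repr (f t)]
      simp [map_sum, mul_comm])
    refine (Pi.basisFun ℝ κ).ext fun c => ?_
    simpa using congrFun hp c
  obtain ⟨b, hb, hbs, hli⟩ := exists_linearIndependent ℝ (Set.range f)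
  let B : Module.Basis b ℝ (κ → ℝ) := Module.Basis.mk hli (by
    rw [Subtype.range_coe, hbs, hspan])
  let σ : κ ≃ b := (Pi.basisFun ℝ κ).indexEquiv B
  choose e he using fun c : κ => hb (σ c).2
  refine ⟨e, ?_⟩
  have hrow : LinearIndependent ℝ (Matrix.of fun c c' => f (e c) c').row := by
    have := hli.comp σ σ.injective
    have h2 : (Matrix.of fun c c' => f (e c) c').row = Subtype.val ∘ σ := by
      ext c c'
      simp [he]
    rw [h2]
    exact this
  have := (Matrix.linearIndependent_rows_iff_isUnit).1 hrow
  exact ((Matrix.isUnit_iff_isUnit_det _).1 this).ne_zero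

open Polynomial in
theorem coeff_prod_sum_of_natDegree_le {ι R : Type*} [CommSemiring R] (s : Finset ι)
    (f : ι → R[X]) (d : ι → ℕ) (h : ∀ i ∈ s, (f i).natDegree ≤ d i) :
    (∏ i ∈ s, f i).coeff (∑ i ∈ s, d i) = ∏ i ∈ s, (f i).coeff (d i) := by
  classical
  induction s using Finset.induction_on with
  | empty => simp
  | insert a s ha ih =>
    have hs : ∀ i ∈ s, (f i).natDegree ≤ d i := fun i hi => h i (mem_insert_of_mem hi)
    rw [prod_insert ha, sum_insert ha, prod_insert ha, ← ih hs]
    exact coeff_mul_add_eq_of_natDegree_le (h a (mem_insert_self a s))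
      ((natDegree_prod_le _ _).trans (sum_le_sum hs))

open Polynomial in
theorem eq_zero_of_sum_eval_mul_pow_eq_zero {K L R S b : ℕ} {A η : ℝ} (hA : A ≠ 0) (hη : 0 < η)
    (hη1 : η ≠ 1) (hSb : S ≤ b) (hcard : L * (K - 1) < R * S) (P : Fin L → ℝ[X])
    (hdeg : ∀ ℓ, (P ℓ).natDegree ≤ K - 1)
    (h : ∀ i < R, ∀ j < S + L,
      ∑ ℓ, (P ℓ).eval ((i * b + j : ℕ) : ℝ) * (A ^ i * η ^ j) ^ (ℓ : ℕ) = 0) :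
    P = 0 := by
  classical
  by_contra hP
  let T : Finset (Fin L) := univ.filter fun ℓ => P ℓ ≠ 0
  obtain ⟨ℓ₀, hℓ₀⟩ := Function.ne_iff.1 hP
  have hTpos : 0 < T.card := card_pos.2 ⟨ℓ₀, by simpa [T] using hℓ₀⟩
  have hTL : T.card ≤ L := by simpa using T.card_le_univ
  let e := T.orderEmbOfFin rfl
  have he : ∀ k, P (e k) ≠ 0 := by
    intro k
    have := T.orderEmbOfFin_mem rfl k
    exact (mem_filter.1 this).2
  let M : Matrix (Fin T.card) (Fin T.card) ℝ[X] := Matrix.of fun j k =>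
    (P (e k)).comp (X + C (j : ℝ)) * C ((η ^ (e k : ℕ)) ^ (j : ℕ))
  let D := ∑ k, (P (e k)).natDegree
  have hMdeg : ∀ j k, (M j k).natDegree ≤ (P (e k)).natDegree := by
    intro j k
    refine (natDegree_mul_C_le ((P (e k)).comp (X + C (j : ℝ))) _).trans ?_
    rw [natDegree_comp, natDegree_X_add_C, mul_one]
  have hMco : ∀ j k, (M j k).coeff (P (e k)).natDegree
      = (P (e k)).leadingCoeff * (η ^ (e k : ℕ)) ^ (j : ℕ) := by
    intro j k
    simp only [M, Matrix.of_apply, coeff_mul_C]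
    congr 1
    have h1 : ((P (e k)).comp (X + C (j : ℝ))).natDegree = (P (e k)).natDegree := by
      rw [natDegree_comp, natDegree_X_add_C, mul_one]
    rw [← h1, coeff_natDegree, leadingCoeff_comp (by rw [natDegree_X_add_C]; simp),
      leadingCoeff_X_add_C, one_pow, mul_one]
  have hDle : M.det.natDegree ≤ D := by
    rw [Matrix.det_apply]
    refine natDegree_sum_le_of_forall_le _ _ fun σ _ => ?_
    refine (natDegree_smul_le _ _).trans ?_
    refine (natDegree_prod_le _ _).trans ?_
    exact sum_le_sum fun k _ => hMdeg _ _
  have hco : M.det.coeff D = (∏ k, (P (e k)).leadingCoeff) *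
      (Matrix.vandermonde fun k => η ^ (e k : ℕ)).det := by
    rw [← Matrix.det_transpose (Matrix.vandermonde _), Matrix.det_apply, Matrix.det_apply,
      finsetSum_coeff, mul_sum]
    refine sum_congr rfl fun σ _ => ?_
    rw [coeff_smul]
    have : (∏ i, M (σ i) i).coeff D = (∏ k, (P (e k)).leadingCoeff) *
        ∏ i, (Matrix.vandermonde fun k => η ^ (e k : ℕ)).transpose (σ i) i := by
      rw [coeff_prod_sum_of_natDegree_le _ _ _ (fun i _ => hMdeg (σ i) i), ← prod_mul_distrib]
      refine prod_congr rfl fun i _ => ?_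
      rw [hMco]; simp [Matrix.vandermonde]
    rw [this, mul_smul_comm]
  have hne : M.det ≠ 0 := by
    intro h0
    rw [h0, coeff_zero] at hco
    refine mul_ne_zero (prod_ne_zero_iff.2 fun k _ => leadingCoeff_ne_zero.2 (he k)) ?_ hco.symm
    rw [Matrix.det_vandermonde_ne_zero_iff]
    intro k k' hkk
    have := pow_right_injective₀ hη hη1 hkk
    exact e.injective (Fin.ext this)
  apply hne
  have hinj : Function.Injective (fun q : Fin R × Fin S => ((q.1 * b + q.2 : ℕ) : ℝ)) := by
    rintro ⟨i, j⟩ ⟨i', j'⟩ hq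
    have hq' : (i : ℕ) * b + j = i' * b + j' := by
      have : (((i : ℕ) * b + j : ℕ) : ℝ) = ((i' * b + j' : ℕ) : ℝ) := hq
      exact_mod_cast this
    have hj : (j : ℕ) < b := j.2.trans_le hSb
    have hj' : (j' : ℕ) < b := j'.2.trans_le hSb
    have h1 : (j : ℕ) = j' := by
      have := congrArg (· % b) hq'
      simpa [Nat.mul_add_mod', Nat.mod_eq_of_lt hj, Nat.mod_eq_of_lt hj'] using this
    have h2 : (i : ℕ) = i' := by
      rw [h1] at hq'
      exact Nat.eq_of_mul_eq_mul_right (by omega) (Nat.add_right_cancel hq')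
    exact Prod.ext (Fin.ext h2) (Fin.ext h1)
  refine eq_zero_of_natDegree_lt_card_of_eval_eq_zero M.det hinj ?_ ?_
  · rintro ⟨i, j⟩
    rw [← coe_evalRingHom, RingHom.map_det]
    refine Matrix.exists_mulVec_eq_zero_iff.1
      ⟨fun k => (A ^ (i : ℕ) * η ^ (j : ℕ)) ^ (e k : ℕ), ?_, ?_⟩
    · intro h0
      have := congrFun h0 ⟨0, hTpos⟩
      simp only [Pi.zero_apply] at this
      exact (pow_ne_zero _ (mul_ne_zero (pow_ne_zero _ hA) (pow_ne_zero _ hη.ne'))) this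
    · ext j'
      have h1 := h i i.2 (j + j') (by have := j.2; have := j'.2; omega)
      rw [Pi.zero_apply, ← h1, Matrix.mulVec, dotProduct]
      have h2 : ∑ ℓ, (P ℓ).eval (((i : ℕ) * b + ((j : ℕ) + j') : ℕ) : ℝ) *
            (A ^ (i : ℕ) * η ^ ((j : ℕ) + j')) ^ (ℓ : ℕ)
          = ∑ ℓ ∈ T, (P ℓ).eval (((i : ℕ) * b + ((j : ℕ) + j') : ℕ) : ℝ) *
            (A ^ (i : ℕ) * η ^ ((j : ℕ) + j')) ^ (ℓ : ℕ) := by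
        symm
        refine sum_subset (subset_univ _) fun ℓ _ hℓ => ?_
        have : P ℓ = 0 := by simpa [T] using hℓ
        simp [this]
      rw [h2]
      have h3 : T = univ.map e.toEmbedding := by
        exact (map_orderEmbOfFin_univ T rfl).symm
      refine Eq.trans ?_ (congrArg (fun U => ∑ ℓ ∈ U,
        (P ℓ).eval (((i : ℕ) * b + ((j : ℕ) + j') : ℕ) : ℝ) *
            (A ^ (i : ℕ) * η ^ ((j : ℕ) + j')) ^ (ℓ : ℕ)) h3.symm)
      rw [sum_map]
      refine sum_congr rfl fun k _ => ?_
      simp only [RingHom.mapMatrix_apply, Matrix.map_apply, M, Matrix.of_apply,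
        coe_evalRingHom, eval_mul, eval_comp, eval_add, eval_X, eval_C,
        RelEmbedding.coe_toEmbedding]
      push_cast
      rw [← add_assoc, mul_assoc]
      congr 1
      rw [pow_add, mul_pow, mul_pow, mul_pow, ← pow_mul, ← pow_mul, ← pow_mul, ← pow_mul]
      ring
  · rw [Fintype.card_prod, Fintype.card_fin, Fintype.card_fin]
    calc M.det.natDegree ≤ D := hDle
      _ ≤ ∑ _k : Fin T.card, (K - 1) := sum_le_sum fun k _ => hdeg _
      _ = T.card * (K - 1) := by simp
      _ ≤ L * (K - 1) := Nat.mul_le_mul_right _ hTL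
      _ < R * S := hcard

open Polynomial in
theorem abs_coeff_mul_le {p p' q q' : ℝ[X]} (h : ∀ m, |p.coeff m| ≤ q.coeff m)
    (h' : ∀ m, |p'.coeff m| ≤ q'.coeff m) (m : ℕ) : |(p * p').coeff m| ≤ (q * q').coeff m := by
  rw [coeff_mul, coeff_mul]
  refine (abs_sum_le_sum_abs _ _).trans (sum_le_sum fun z _ => ?_)
  rw [abs_mul]
  exact mul_le_mul (h _) (h' _) (abs_nonneg _) ((abs_nonneg _).trans (h _))

open Polynomial in
theorem abs_coeff_prod_X_sub_le (k m : ℕ) :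
    |(∏ i ∈ range k, (X - C (i : ℝ))).coeff m| ≤ (∏ i ∈ range k, (X + C (i : ℝ))).coeff m := by
  induction k generalizing m with
  | zero => simp only [range_zero, prod_empty, coeff_one]; split_ifs <;> simp
  | succ k ih =>
    rw [prod_range_succ, prod_range_succ]
    refine abs_coeff_mul_le ih (fun m => ?_) m
    rw [coeff_sub, coeff_add, coeff_X, coeff_C]
    refine (abs_sub _ _).trans ?_
    split_ifs <;> simp

open Polynomial in
/-- The Taylor polynomial of `exp (ω x)`. -/
noncomputable def expTaylor (ω : ℝ) (n : ℕ) : ℝ[X] :=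
  ∑ m ∈ range n, C (ω ^ m / m.factorial) * X ^ m

open Polynomial in
theorem eval_expTaylor (ω x : ℝ) (n : ℕ) :
    (expTaylor ω n).eval x = ∑ m ∈ range n, (ω * x) ^ m / m.factorial := by
  rw [expTaylor, eval_finsetSum]
  refine sum_congr rfl fun m _ => ?_
  simp [mul_pow]; ring

open Polynomial in
theorem abs_coeff_expTaylor_le (ω : ℝ) (n m : ℕ) :
    |(expTaylor ω n).coeff m| ≤ (expTaylor |ω| n).coeff m := by
  simp only [expTaylor, finsetSum_coeff, coeff_C_mul, coeff_X_pow, mul_ite, mul_one, mul_zero,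
    sum_ite_eq]
  split_ifs
  · rw [abs_div, abs_pow, Nat.abs_cast]
  · simp

open Polynomial in
theorem sum_abs_coeff_mul_pow_le {p q : ℝ[X]} {T : ℕ} {Y : ℝ} (hY : 0 ≤ Y)
    (h : ∀ m, |p.coeff m| ≤ q.coeff m) (hT : q.natDegree < T) :
    ∑ m : Fin T, |p.coeff m| * Y ^ (m : ℕ) ≤ q.eval Y := by
  rw [eval_eq_sum_range' hT, ← Fin.sum_univ_eq_sum_range (fun m => q.coeff m * Y ^ m)]
  exact sum_le_sum fun m _ => mul_le_mul_of_nonneg_right (h _) (by positivity)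

theorem exists_expTaylor_close {τ : Type*} [Finite τ] (ω x : τ → ℝ) {ε : ℝ} (hε : 0 < ε) :
    ∃ n, ∀ t, |Real.exp (ω t * x t) - (expTaylor (ω t) n).eval (x t)| ≤ ε := by
  have : ∀ t, ∀ᶠ n in Filter.atTop,
      |Real.exp (ω t * x t) - (expTaylor (ω t) n).eval (x t)| ≤ ε := by
    intro t
    have h := (NormedSpace.expSeries_div_hasSum_exp (𝔸 := ℝ) (ω t * x t)).tendsto_sum_nat
    rw [← Real.exp_eq_exp_ℝ] at h
    filter_upwards [h (Metric.closedBall_mem_nhds _ hε)] with n hn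
    rw [eval_expTaylor, abs_sub_comm]
    exact hn
  exact (Filter.eventually_all.2 this).exists

open Polynomial in
theorem pow_mul_abs_det_choose_mul_le {ι : Type*} [Fintype ι] [DecidableEq ι]
    (k ℓ x : ι → ℕ) (y : ι → ℝ) {K L : ℕ} {X' E ω μ : ℝ} (hE : 1 ≤ E)
    (hk : ∀ c, k c < K) (hℓ : ∀ c, ℓ c ≤ L) (hx : ∀ t, (x t : ℝ) ≤ X') (hμ : 0 < μ)
    (hy : ∀ c t, |y t ^ ℓ c - Real.exp (ℓ c * ω * x t)| ≤ Real.exp (ℓ c * ω * x t) * (2 * μ))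
    (hμE : 3 * μ * E ^ Fintype.card ι ≤ 1) :
    E ^ (Fintype.card ι * (Fintype.card ι - 1) / 2) *
      |(Matrix.of fun t c => ((x t).choose (k c) : ℝ) * y t ^ ℓ c).det| ≤
    (Fintype.card ι).factorial * ∏ c, (2 * ((E * X' + K) ^ k c / (k c).factorial) *
      Real.exp (L * (E * (|ω| * X')))) := by
  rcases isEmpty_or_nonempty ι with hemp | ⟨⟨t₀⟩⟩
  · simp
  have hX' : 0 ≤ X' := (Nat.cast_nonneg _).trans (hx t₀)
  have hEX : X' ≤ E * X' := by nlinarith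
  obtain ⟨n, hn⟩ := exists_expTaylor_close (fun t : ι × ι => ℓ t.1 * ω) (fun t => (x t.2 : ℝ)) hμ
  let p : ι → ℝ[X] := fun c =>
    C (1 / ((k c).factorial : ℝ)) * ((∏ i ∈ range (k c), (X - C (i : ℝ))) * expTaylor (ℓ c * ω) n)
  let q : ι → ℝ[X] := fun c =>
    C (1 / ((k c).factorial : ℝ)) * ((∏ i ∈ range (k c), (X + C (i : ℝ))) * expTaylor |ℓ c * ω| n)
  have hpq : ∀ c m, |(p c).coeff m| ≤ (q c).coeff m := by
    intro c m
    simp only [p, q]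
    rw [coeff_C_mul, coeff_C_mul, abs_mul,
      abs_of_nonneg (by positivity : (0:ℝ) ≤ 1 / ((k c).factorial : ℝ))]
    refine mul_le_mul_of_nonneg_left ?_ (by positivity)
    exact abs_coeff_mul_le (abs_coeff_prod_X_sub_le _) (abs_coeff_expTaylor_le _ _) m
  let T := univ.sup (fun c => (p c).natDegree) + univ.sup (fun c => (q c).natDegree) + 1
  have hTp : ∀ c, (p c).natDegree < T := fun c => by
    have := le_sup (f := fun c => (p c).natDegree) (mem_univ c)
    simp only [T]; omega
  have hTq : ∀ c, (q c).natDegree < T := fun c => by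
    have := le_sup (f := fun c => (q c).natDegree) (mem_univ c)
    simp only [T]; omega
  have hpe : ∀ c t, (p c).eval (x t : ℝ) =
      ((x t).choose (k c) : ℝ) * (expTaylor (ℓ c * ω) n).eval (x t : ℝ) := by
    intro c t
    simp only [p, eval_mul, eval_C, eval_prod, eval_sub, eval_X]
    have h1 : ∏ i ∈ range (k c), ((x t : ℝ) - i) = (k c).factorial * (x t).choose (k c) := by
      rw [← descPochhammer_eval_eq_prod_range, descPochhammer_eval_eq_descFactorial,
        Nat.descFactorial_eq_factorial_mul_choose]
      push_cast; rfl
    rw [h1]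
    have : ((k c).factorial : ℝ) ≠ 0 := by positivity
    field_simp
  let δ : ι → ℝ := fun c => X' ^ k c / (k c).factorial * (Real.exp (L * (E * (|ω| * X'))) * (3 * μ))
  have hexp : ∀ c t, Real.exp (ℓ c * ω * x t) ≤ Real.exp (L * (E * (|ω| * X'))) := by
    intro c t
    refine Real.exp_le_exp.2 ?_
    have h1 : (ℓ c : ℝ) ≤ L := by exact_mod_cast hℓ c
    calc (ℓ c : ℝ) * ω * x t ≤ ℓ c * |ω| * x t := by gcongr; exact le_abs_self _
      _ ≤ L * |ω| * X' := by gcongr; exact hx t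
      _ ≤ L * |ω| * (E * X') := by gcongr
      _ = _ := by ring
  have hchoose : ∀ c t, ((x t).choose (k c) : ℝ) ≤ X' ^ k c / (k c).factorial := by
    intro c t
    refine (Nat.choose_le_pow_div _ _).trans ?_
    gcongr
    exact hx t
  have hg : ∀ c t, |((x t).choose (k c) : ℝ) * y t ^ ℓ c - (p c).eval (x t : ℝ)| ≤ δ c := by
    intro c t
    rw [hpe, ← mul_sub, abs_mul, Nat.abs_cast]
    refine mul_le_mul (hchoose c t) ?_ (abs_nonneg _) (by positivity)
    have h1 := hy c t
    have h2 := hn (c, t)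
    simp only at h2
    have h3 := hexp c t
    have h4 : 1 ≤ Real.exp (L * (E * (|ω| * X'))) := Real.one_le_exp (by positivity)
    calc |y t ^ ℓ c - (expTaylor (ℓ c * ω) n).eval (x t : ℝ)|
        ≤ |y t ^ ℓ c - Real.exp (ℓ c * ω * x t)| +
          |Real.exp (ℓ c * ω * x t) - (expTaylor (ℓ c * ω) n).eval (x t : ℝ)| := abs_sub_le _ _ _
      _ ≤ Real.exp (ℓ c * ω * x t) * (2 * μ) + μ := add_le_add h1 h2
      _ ≤ Real.exp (L * (E * (|ω| * X'))) * (2 * μ) + Real.exp (L * (E * (|ω| * X'))) * μ := by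
          gcongr
          nlinarith
      _ = _ := by ring
  have main := pow_mul_abs_det_le (fun c (m : Fin T) => (p c).coeff m) (fun t => (x t : ℝ))
    (fun c t => ((x t).choose (k c) : ℝ) * y t ^ ℓ c - (p c).eval (x t : ℝ)) δ X' E hE
    (fun t => by rw [Nat.abs_cast]; exact hx t) hg hX' (fun c => by positivity)
  have hmat : (Matrix.of fun t c => ((x t).choose (k c) : ℝ) * y t ^ ℓ c).det =
      (Matrix.of fun c t => ∑ m : Fin T, (p c).coeff m * (x t : ℝ) ^ (m : ℕ) +
        (((x t).choose (k c) : ℝ) * y t ^ ℓ c - (p c).eval (x t : ℝ))).det := by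
    rw [← Matrix.det_transpose]
    congr 1
    ext c t
    simp only [Matrix.transpose_apply, Matrix.of_apply]
    rw [eval_eq_sum_range' (hTp c),
      ← Fin.sum_univ_eq_sum_range (fun m => (p c).coeff m * (x t : ℝ) ^ m)]
    ring
  rw [hmat]
  refine main.trans ?_
  refine mul_le_mul_of_nonneg_left (prod_le_prod (fun c _ => ?_) (fun c _ => ?_)) (by positivity)
  · exact add_nonneg (sum_nonneg fun m _ => by positivity) (by positivity)
  have hkK : (k c : ℝ) ≤ K := by exact_mod_cast (hk c).le
  have h1 : ∑ m : Fin T, |(p c).coeff m| * (E * X') ^ (m : ℕ) ≤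
      (E * X' + K) ^ k c / (k c).factorial * Real.exp (L * (E * (|ω| * X'))) := by
    refine (sum_abs_coeff_mul_pow_le (by positivity) (hpq c) (hTq c)).trans ?_
    simp only [q, eval_mul, eval_C, eval_prod, eval_add, eval_X, eval_expTaylor]
    rw [← mul_assoc]
    refine mul_le_mul ?_ ?_ (sum_nonneg fun _ _ => by positivity) (by positivity)
    · rw [div_mul_eq_mul_div, one_mul]
      gcongr
      calc ∏ i ∈ range (k c), (E * X' + i) ≤ ∏ _i ∈ range (k c), (E * X' + K) := by
            refine prod_le_prod (fun i _ => by positivity) fun i hi => ?_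
            have : (i : ℝ) ≤ K := by exact_mod_cast ((mem_range.1 hi).trans (hk c)).le
            linarith
        _ = _ := by simp
    · refine (Real.sum_le_exp_of_nonneg (by positivity) n).trans (Real.exp_le_exp.2 ?_)
      rw [abs_mul, Nat.abs_cast]
      have : (ℓ c : ℝ) ≤ L := by exact_mod_cast hℓ c
      calc (ℓ c : ℝ) * |ω| * (E * X') ≤ L * |ω| * (E * X') := by gcongr
        _ = _ := by ring
  have h2 : δ c * E ^ Fintype.card ι ≤
      (E * X' + K) ^ k c / (k c).factorial * Real.exp (L * (E * (|ω| * X'))) := by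
    have h3 : X' ^ k c / (k c).factorial ≤ (E * X' + K) ^ k c / (k c).factorial := by
      gcongr
      have : (0:ℝ) ≤ K := Nat.cast_nonneg _
      linarith
    calc δ c * E ^ Fintype.card ι = X' ^ k c / (k c).factorial *
          Real.exp (L * (E * (|ω| * X'))) * (3 * μ * E ^ Fintype.card ι) := by simp only [δ]; ring
      _ ≤ (E * X' + K) ^ k c / (k c).factorial * Real.exp (L * (E * (|ω| * X'))) * 1 := by
        gcongr
      _ = _ := by ring
  calc _ ≤ _ := add_le_add h1 h2
    _ = _ := by ring

open Polynomial in
theorem exists_rows_choose_mul_pow_det_ne_zero {K L R S b : ℕ} {A η : ℝ} (hA : A ≠ 0) (hη : 0 < η)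
    (hη1 : η ≠ 1) (hSb : S ≤ b) (hcard : L * (K - 1) < R * S) :
    ∃ e : Fin K × Fin L → Fin R × Fin (S + L),
      (Matrix.of fun t (c : Fin K × Fin L) => ((((e t).1 : ℕ) * b + (e t).2).choose c.1 : ℝ) *
        (A ^ ((e t).1 : ℕ) * η ^ ((e t).2 : ℕ)) ^ (c.2 : ℕ)).det ≠ 0 := by
  refine exists_rows_det_ne_zero (fun (t : Fin R × Fin (S + L)) (c : Fin K × Fin L) =>
    (((t.1 : ℕ) * b + t.2).choose c.1 : ℝ) * (A ^ (t.1 : ℕ) * η ^ (t.2 : ℕ)) ^ (c.2 : ℕ))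
    fun p hp => ?_
  let P : Fin L → ℝ[X] := fun ℓ =>
    ∑ k : Fin K, C (p (k, ℓ) / (k : ℕ).factorial) * descPochhammer ℝ k
  have heval : ∀ ℓ (x : ℕ), (P ℓ).eval (x : ℝ) = ∑ k : Fin K, p (k, ℓ) * (x.choose k : ℝ) := by
    intro ℓ x
    simp only [P, eval_finsetSum, eval_mul, eval_C, descPochhammer_eval_eq_descFactorial]
    refine sum_congr rfl fun k _ => ?_
    rw [Nat.descFactorial_eq_factorial_mul_choose]
    push_cast
    field_simp
  have hP : P = 0 := by
    refine eq_zero_of_sum_eval_mul_pow_eq_zero hA hη hη1 hSb hcard P (fun ℓ => ?_) ?_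
    · refine natDegree_sum_le_of_forall_le _ _ fun k _ => (natDegree_C_mul_le _ _).trans ?_
      rw [descPochhammer_natDegree]
      have := k.2
      omega
    · intro i hi j hj
      have := hp (⟨i, hi⟩, ⟨j, hj⟩)
      rw [Fintype.sum_prod_type_right] at this
      rw [← this]
      refine sum_congr rfl fun ℓ _ => ?_
      rw [heval, sum_mul]
      refine sum_congr rfl fun k _ => ?_
      push_cast
      ring
  have key : ∀ ℓ, ∀ n, ∀ hn : n < K, p (⟨n, hn⟩, ℓ) = 0 := by
    intro ℓ n
    induction n using Nat.strong_induction_on with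
    | _ n ih =>
      intro hn
      have h1 := heval ℓ n
      rw [hP, sum_eq_single ⟨n, hn⟩] at h1
      · simpa using h1.symm
      · intro k _ hk
        rcases lt_trichotomy (k : ℕ) n with h | h | h
        · rw [ih k h k.2, zero_mul]
        · exact absurd (Fin.ext h) hk
        · rw [Nat.choose_eq_zero_of_lt h]; simp
      · simp
  funext c
  exact key c.2 c.1 c.1.2

open Polynomial in
theorem one_le_prod_mul_abs_det_choose_mul {ι : Type*} [Fintype ι] [DecidableEq ι]
    {A₁ A₂ n₁ n₂ : ℤ[X]} {L I J : ℕ} {G h₁ h₂ : ℝ}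
    (hA₂ : 0 < aeval Real.goldenRatio A₂) (hn₂ : 0 < aeval Real.goldenRatio n₂)
    (hh₁ : 1 ≤ h₁) (hh₂ : 1 ≤ h₂)
    (hA₁h : aeval Real.goldenRatio A₂ * |aeval Real.goldenConj A₁| ≤ h₁)
    (hA₂h : aeval Real.goldenRatio A₂ * |aeval Real.goldenConj A₂| ≤ h₁)
    (hn₁h : aeval Real.goldenRatio n₂ * |aeval Real.goldenConj n₁| ≤ h₂)
    (hn₂h : aeval Real.goldenRatio n₂ * |aeval Real.goldenConj n₂| ≤ h₂)
    (k ℓ x i j : ι → ℕ) (hℓ : ∀ c, ℓ c < L) (hi : ∀ t, i t ≤ I) (hj : ∀ t, j t ≤ J)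
    (hG : ∀ c t, ((x t).choose (k c) : ℝ) ≤ G)
    (hdet : (Matrix.of fun t c => ((x t).choose (k c) : ℝ) *
      ((aeval Real.goldenRatio A₁ / aeval Real.goldenRatio A₂ : ℝ) ^ i t *
        (aeval Real.goldenRatio n₁ / aeval Real.goldenRatio n₂ : ℝ) ^ j t) ^ ℓ c).det ≠ 0) :
    1 ≤ |(Matrix.of fun t c => ((x t).choose (k c) : ℝ) *
      ((aeval Real.goldenRatio A₁ / aeval Real.goldenRatio A₂ : ℝ) ^ i t *
        (aeval Real.goldenRatio n₁ / aeval Real.goldenRatio n₂ : ℝ) ^ j t) ^ ℓ c).det| *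
      ((Fintype.card ι).factorial * (G * (h₁ ^ I * h₂ ^ J) ^ L) ^ Fintype.card ι) := by
  set D : ℝ := (Matrix.of fun t c => ((x t).choose (k c) : ℝ) *
      ((aeval Real.goldenRatio A₁ / aeval Real.goldenRatio A₂ : ℝ) ^ i t *
        (aeval Real.goldenRatio n₁ / aeval Real.goldenRatio n₂ : ℝ) ^ j t) ^ ℓ c).det with hD
  set M : Matrix ι ι ℤ[X] := Matrix.of fun t c => ((x t).choose (k c) : ℤ[X]) *
    ((A₁ ^ i t * n₁ ^ j t) ^ ℓ c * (A₂ ^ i t * n₂ ^ j t) ^ (L - 1 - ℓ c)) with hM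
  set a₂ := aeval Real.goldenRatio A₂
  set e₂ := aeval Real.goldenRatio n₂
  let V : ι → ℝ := fun t => (a₂ ^ i t * e₂ ^ j t) ^ (L - 1)
  have hV : ∀ t, 0 < V t := fun t => by positivity
  have hφ : aeval Real.goldenRatio M.det = (∏ t, V t) * D := by
    rw [← Matrix.det_mul_column, AlgHom.map_det]
    congr 1
    ext t c
    have h1 : ℓ c ≤ L - 1 := by have := hℓ c; omega
    simp only [hM, AlgHom.mapMatrix_apply, Matrix.map_apply, Matrix.of_apply, map_mul, map_pow,
      map_natCast, V]
    rw [← pow_mul_pow_sub (a₂ ^ i t * e₂ ^ j t) h1]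
    have : (a₂ ^ i t * e₂ ^ j t) ^ ℓ c * (((aeval Real.goldenRatio A₁ / a₂) ^ i t *
        (aeval Real.goldenRatio n₁ / e₂) ^ j t) ^ ℓ c) =
        ((aeval Real.goldenRatio A₁) ^ i t * (aeval Real.goldenRatio n₁) ^ j t) ^ ℓ c := by
      rw [← mul_pow, div_pow, div_pow]
      congr 1
      field_simp
    rw [← this]
    ring
  have hψ : |aeval Real.goldenConj M.det| ≤ (Fintype.card ι).factorial * ((∏ t : ι,
      ((max |aeval Real.goldenConj A₁| |aeval Real.goldenConj A₂|) ^ i t *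
        (max |aeval Real.goldenConj n₁| |aeval Real.goldenConj n₂|) ^ j t) ^ (L - 1)) *
      ∏ _c : ι, G) := by
    rw [AlgHom.map_det]
    refine abs_det_le_factorial_mul_prod _ _ _ fun t c => ?_
    have h1 : ℓ c ≤ L - 1 := by have := hℓ c; omega
    simp only [hM, AlgHom.mapMatrix_apply, Matrix.map_apply, Matrix.of_apply, map_mul, map_pow,
      map_natCast, abs_mul, abs_pow, Nat.abs_cast]
    rw [mul_comm, ← pow_mul_pow_sub (max _ _ ^ i t * _) h1]
    gcongr
    · exact le_max_left _ _
    · exact le_max_left _ _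
    · exact le_max_right _ _
    · exact le_max_right _ _
    · exact hG c t
  have hne : aeval Real.goldenRatio M.det ≠ 0 := by
    rw [hφ]
    exact mul_ne_zero (prod_ne_zero_iff.2 fun t _ => (hV t).ne') hdet
  have hmain := one_le_abs_aeval_golden_mul _ hne
  rcases isEmpty_or_nonempty ι with hemp | ⟨⟨t₀⟩⟩
  · simp [hD]
  have hG0 : 0 ≤ G := (Nat.cast_nonneg _).trans (hG t₀ t₀)
  have hm1 : a₂ * max |aeval Real.goldenConj A₁| |aeval Real.goldenConj A₂| ≤ h₁ := by
    rw [mul_max_of_nonneg _ _ hA₂.le]; exact max_le hA₁h hA₂h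
  have hm2 : e₂ * max |aeval Real.goldenConj n₁| |aeval Real.goldenConj n₂| ≤ h₂ := by
    rw [mul_max_of_nonneg _ _ hn₂.le]; exact max_le hn₁h hn₂h
  set m₁ := max |aeval Real.goldenConj A₁| |aeval Real.goldenConj A₂|
  set m₂ := max |aeval Real.goldenConj n₁| |aeval Real.goldenConj n₂|
  have hm₁ : 0 ≤ m₁ := (abs_nonneg _).trans (le_max_left _ _)
  have hm₂ : 0 ≤ m₂ := (abs_nonneg _).trans (le_max_left _ _)
  have hVt : ∀ t, V t * (m₁ ^ i t * m₂ ^ j t) ^ (L - 1) ≤ (h₁ ^ I * h₂ ^ J) ^ L := by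
    intro t
    calc V t * (m₁ ^ i t * m₂ ^ j t) ^ (L - 1)
        = ((a₂ * m₁) ^ i t * (e₂ * m₂) ^ j t) ^ (L - 1) := by
          simp only [V]; rw [← mul_pow]; ring
      _ ≤ (h₁ ^ i t * h₂ ^ j t) ^ (L - 1) := by gcongr
      _ ≤ (h₁ ^ I * h₂ ^ J) ^ (L - 1) := by
          gcongr
          · exact hi t
          · exact hj t
      _ ≤ _ := by
          refine pow_le_pow_right₀ ?_ (Nat.sub_le _ _)
          exact one_le_mul_of_one_le_of_one_le (one_le_pow₀ hh₁) (one_le_pow₀ hh₂)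
  calc (1:ℝ) ≤ _ := hmain
    _ ≤ ((∏ t, V t) * |D|) * ((Fintype.card ι).factorial * ((∏ t : ι,
          (m₁ ^ i t * m₂ ^ j t) ^ (L - 1)) * ∏ _c : ι, G)) := by
        rw [hφ, abs_mul, abs_of_pos (prod_pos fun t _ => hV t)]
        gcongr
    _ = |D| * ((Fintype.card ι).factorial * ((∏ t, V t * (m₁ ^ i t * m₂ ^ j t) ^ (L - 1)) *
          G ^ Fintype.card ι)) := by
        rw [prod_mul_distrib, prod_const, card_univ]; ring
    _ ≤ |D| * ((Fintype.card ι).factorial * ((∏ _t : ι, (h₁ ^ I * h₂ ^ J) ^ L) *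
          G ^ Fintype.card ι)) := by
        gcongr with t
        exact hVt t
    _ = _ := by rw [prod_const, card_univ, mul_pow]; ring

theorem abs_exp_add_sub_exp_le {u v μ : ℝ} (hv : |v| ≤ μ) (hμ : μ ≤ 1) :
    |Real.exp (u + v) - Real.exp u| ≤ Real.exp u * (2 * μ) := by
  rw [Real.exp_add, ← mul_sub_one, abs_mul, abs_of_pos (Real.exp_pos u)]
  have := Real.abs_exp_sub_one_le (hv.trans hμ)
  gcongr
  linarith

theorem pow_le_pow_of_pow_mul_le {N : ℕ} (hN : 0 < N) {G H : ℝ} (hG : 0 ≤ G) (hH : 0 ≤ H)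
    {D T : ℝ} (hT : 0 < T) (h1 : (4:ℝ) ^ (N * (N - 1) / 2) * D ≤ N.factorial * (2 * G * T) ^ N)
    (h2 : 1 ≤ D * (N.factorial * (G * H) ^ N)) :
    (2:ℝ) ^ N ≤ 4 * (N:ℝ) ^ 2 * H * G ^ 2 * T := by
  have hfac : (N.factorial : ℝ) ≤ (N:ℝ) ^ N := by exact_mod_cast Nat.factorial_le_pow N
  have h4 : (4:ℝ) ^ (N * (N - 1) / 2) * 2 ^ N = (2 ^ N) ^ N := by
    rw [show (4:ℝ) = 2 ^ 2 by norm_num, ← pow_mul,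
      Nat.mul_div_cancel' (Nat.even_mul_pred_self N).two_dvd,
      ← pow_add, ← pow_mul]
    congr 1
    obtain ⟨k, rfl⟩ : ∃ k, N = k + 1 := ⟨N - 1, by omega⟩
    simp; ring
  refine le_of_pow_le_pow_left₀ hN.ne' (by positivity) ?_
  calc ((2:ℝ) ^ N) ^ N = (4:ℝ) ^ (N * (N - 1) / 2) * 2 ^ N * 1 := by rw [h4, mul_one]
    _ ≤ (4:ℝ) ^ (N * (N - 1) / 2) * 2 ^ N * (D * (N.factorial * (G * H) ^ N)) := by gcongr
    _ = (4:ℝ) ^ (N * (N - 1) / 2) * D * (2 ^ N * (N.factorial * (G * H) ^ N)) := by ring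
    _ ≤ N.factorial * (2 * G * T) ^ N * (2 ^ N * (N.factorial * (G * H) ^ N)) := by gcongr
    _ ≤ (N:ℝ) ^ N * (2 * G * T) ^ N * (2 ^ N * ((N:ℝ) ^ N * (G * H) ^ N)) := by gcongr
    _ = _ := by
      simp only [← mul_pow]
      ring

open Polynomial in
theorem two_pow_le_of_abs_log_sub_le {K L R S b : ℕ} (hK : 0 < K) (hL : 0 < L) (hSL : S + L ≤ b)
    (hcard : L * (K - 1) < R * S) {A₁ A₂ n₁ n₂ : ℤ[X]} {G h₁ h₂ lam ω : ℝ}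
    (hA₁ : 0 < aeval Real.goldenRatio A₁) (hA₂ : 0 < aeval Real.goldenRatio A₂)
    (hn₁ : 0 < aeval Real.goldenRatio n₁) (hn₂ : 0 < aeval Real.goldenRatio n₂)
    (hh₁ : 1 ≤ h₁) (hh₂ : 1 ≤ h₂)
    (hA₁h : aeval Real.goldenRatio A₂ * |aeval Real.goldenConj A₁| ≤ h₁)
    (hA₂h : aeval Real.goldenRatio A₂ * |aeval Real.goldenConj A₂| ≤ h₁)
    (hn₁h : aeval Real.goldenRatio n₂ * |aeval Real.goldenConj n₁| ≤ h₂)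
    (hn₂h : aeval Real.goldenRatio n₂ * |aeval Real.goldenConj n₂| ≤ h₂)
    (hω : Real.log (aeval Real.goldenRatio n₁ / aeval Real.goldenRatio n₂) = ω) (hω0 : ω ≠ 0)
    (hlam : 0 < lam)
    (hlog : |Real.log (aeval Real.goldenRatio A₁ / aeval Real.goldenRatio A₂) - b * ω| ≤ lam)
    (hsmall : 3 * (L * R * lam) * 4 ^ (K * L) ≤ 1)
    (hG : ∀ k < K, (4 * (R * b : ℝ) + K) ^ k / k.factorial ≤ G) :
    (2:ℝ) ^ (K * L) ≤ 4 * ((K * L : ℕ) : ℝ) ^ 2 * (h₁ ^ R * h₂ ^ (S + L)) ^ L * G ^ 2 *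
      Real.exp (L * (4 * (|ω| * (R * b)))) := by
  set a : ℝ := aeval Real.goldenRatio A₁ / aeval Real.goldenRatio A₂ with ha
  set η : ℝ := aeval Real.goldenRatio n₁ / aeval Real.goldenRatio n₂ with hη
  have ha0 : 0 < a := div_pos hA₁ hA₂
  have hη0 : 0 < η := div_pos hn₁ hn₂
  have hη1 : η ≠ 1 := by
    intro h
    rw [h, Real.log_one] at hω
    exact hω0 hω.symm
  obtain ⟨e, he⟩ := exists_rows_choose_mul_pow_det_ne_zero (b := b) ha0.ne' hη0 hη1
    (show S ≤ b by omega) hcard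
  let x : Fin K × Fin L → ℕ := fun t => ((e t).1 : ℕ) * b + (e t).2
  let y : Fin K × Fin L → ℝ := fun t => a ^ ((e t).1 : ℕ) * η ^ ((e t).2 : ℕ)
  have hN : Fintype.card (Fin K × Fin L) = K * L := by simp
  have hR : 0 < R := by
    rcases Nat.eq_zero_or_pos R with h | h
    · subst h; simp at hcard
    · exact h
  have hxn : ∀ t, x t ≤ R * b := by
    intro t
    have h1 := (e t).1.2
    have h2 := (e t).2.2
    calc x t ≤ ((e t).1 : ℕ) * b + b := by simp only [x]; omega
      _ = ((e t).1 + 1 : ℕ) * b := by ring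
      _ ≤ R * b := Nat.mul_le_mul_right _ h1
  have hx : ∀ t, (x t : ℝ) ≤ R * b := fun t => by exact_mod_cast hxn t
  have h4 : (1:ℝ) ≤ 4 ^ (K * L) := one_le_pow₀ (by norm_num)
  have hμ0 : 0 < L * R * lam := by positivity
  have hμ1 : L * R * lam ≤ 1 := by nlinarith
  have hy : ∀ c t : Fin K × Fin L, |y t ^ (c.2 : ℕ) - Real.exp ((c.2 : ℕ) * ω * x t)| ≤
      Real.exp ((c.2 : ℕ) * ω * x t) * (2 * (L * R * lam)) := by
    intro c t
    have h1 : y t ^ (c.2 : ℕ) = Real.exp ((c.2 : ℕ) * ω * x t +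
        (c.2 : ℕ) * (e t).1 * (Real.log a - b * ω)) := by
      rw [← Real.exp_log (show 0 < y t ^ (c.2 : ℕ) by positivity)]
      congr 1
      simp only [y, x]
      rw [Real.log_pow, Real.log_mul (by positivity) (by positivity), Real.log_pow, Real.log_pow,
        hω]
      push_cast
      ring
    rw [h1]
    refine abs_exp_add_sub_exp_le ?_ hμ1
    rw [abs_mul, abs_mul, Nat.abs_cast, Nat.abs_cast]
    have h2 : ((c.2 : ℕ) : ℝ) ≤ L := by exact_mod_cast c.2.2.le
    have h3 : (((e t).1 : ℕ) : ℝ) ≤ R := by exact_mod_cast (e t).1.2.le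
    gcongr
  have hGT : ∀ c : Fin K × Fin L, (4 * (R * b : ℝ) + K) ^ (c.1 : ℕ) / (c.1 : ℕ).factorial ≤ G :=
    fun c => hG c.1 c.1.2
  have hG0 : 0 ≤ G := le_trans (by positivity) (hG 0 hK)
  have h1 := pow_mul_abs_det_choose_mul_le (fun c : Fin K × Fin L => (c.1 : ℕ)) (fun c => (c.2 : ℕ))
    x y (E := 4) (by norm_num) (fun c => c.1.2) (fun c => c.2.2.le) hx hμ0 hy
    (by rw [hN]; exact hsmall)
  have h2 := one_le_prod_mul_abs_det_choose_mul (A₁ := A₁) (I := R) (J := S + L) (G := G)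
    hA₂ hn₂ hh₁ hh₂ hA₁h hA₂h hn₁h hn₂h
    (fun c : Fin K × Fin L => (c.1 : ℕ)) (fun c => (c.2 : ℕ)) x (fun t => (e t).1)
    (fun t => (e t).2) (fun c => c.2.2) (fun t => (e t).1.2.le) (fun t => (e t).2.2.le)
    (fun c t => by
      refine (Nat.choose_le_pow_div _ _).trans (le_trans ?_ (hGT c))
      gcongr
      have : (0:ℝ) ≤ K := Nat.cast_nonneg _
      have := hx t
      have : (0:ℝ) ≤ R * b := by positivity
      linarith) he
  rw [hN] at h1 h2
  refine pow_le_pow_of_pow_mul_le (by positivity) hG0 (by positivity) (Real.exp_pos _)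
    (h1.trans ?_) h2
  gcongr
  rw [← hN, ← Finset.card_univ, ← Finset.prod_const]
  gcongr with c
  exact hGT c

theorem mul_sq_le_two_pow {w : ℕ} (hw : 27 ≤ w) : 384 * (w + 3) ^ 2 ≤ 2 ^ w := by
  induction w, hw using Nat.le_induction with
  | base => norm_num
  | succ k hk ih =>
    rw [pow_succ 2 k]
    have : (k + 1 + 3) ^ 2 ≤ 2 * (k + 3) ^ 2 := by nlinarith
    linarith

theorem pow_div_factorial_le_two_pow {K w k : ℕ} {Y : ℝ} (hY0 : 0 ≤ Y) (hY : Y ≤ K * 2 ^ w)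
    (hk : k ≤ K) : Y ^ k / k.factorial ≤ 2 ^ ((w + 3) * K) := by
  have he : Real.exp 1 ≤ 4 := by linarith [Real.exp_one_lt_d9]
  have h1 : (K:ℝ) ^ k / k.factorial ≤ Real.exp K :=
    Real.pow_div_factorial_le_exp _ (Nat.cast_nonneg _) k
  calc Y ^ k / k.factorial ≤ (K * 2 ^ w) ^ k / k.factorial := by gcongr
    _ = (2 ^ w) ^ k * ((K:ℝ) ^ k / k.factorial) := by rw [mul_pow]; ring
    _ ≤ (2 ^ w) ^ K * Real.exp K := by
        gcongr
        exact one_le_pow₀ (by norm_num)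
    _ = (2 ^ w * Real.exp 1) ^ K := by rw [mul_pow, Real.exp_one_pow]
    _ ≤ (2 ^ w * 8) ^ K := by gcongr; linarith
    _ = _ := by rw [pow_mul, pow_add]; norm_num

theorem four_mul_sq_mul_lt_two_pow {w L q M R S K : ℕ} {x : ℝ} (hL : L = 4 * (w + 3))
    (hq : 0 < q) (hM : 0 < M) (hR : R = 8 * L * q) (hS : S = 160 * L * M)
    (hK : K = 1280 * L * q * M) (hx : x ≤ 5 * M * R) :
    4 * ((K * L : ℕ) : ℝ) ^ 2 * ((2 ^ (7 * M)) ^ R * (2 ^ (2 * q)) ^ (S + L)) ^ L *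
      (2 ^ ((w + 3) * K)) ^ 2 * Real.exp (L * (4 * x)) < (2:ℝ) ^ (K * L) := by
  have hL0 : 0 < L := by omega
  set Z := L ^ 2 * q * M with hZ
  have hZ0 : 0 < Z := by positivity
  have he : Real.exp 20 ≤ 2 ^ 29 := by
    have h1 : Real.exp 20 = Real.exp 1 ^ 20 := by rw [← Real.exp_nat_mul]; norm_num
    rw [h1]
    calc Real.exp 1 ^ 20 ≤ 2.7182818286 ^ 20 := by
          gcongr; exact Real.exp_one_lt_d9.le
      _ ≤ _ := by norm_num
  have hexp : Real.exp (L * (4 * x)) ≤ 2 ^ (232 * Z) := by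
    have h2 : (L:ℝ) * (4 * x) ≤ (8 * Z : ℕ) * 20 := by
      have : (L:ℝ) * (4 * x) ≤ L * (4 * (5 * M * R)) := by gcongr
      refine this.trans (le_of_eq ?_)
      rw [hZ, hR]; push_cast; ring
    calc Real.exp (L * (4 * x)) ≤ Real.exp ((8 * Z : ℕ) * 20) := Real.exp_le_exp.2 h2
      _ = Real.exp 20 ^ (8 * Z) := Real.exp_nat_mul _ _
      _ ≤ (2 ^ 29) ^ (8 * Z) := by gcongr
      _ = _ := by rw [← pow_mul]; congr 1; ring
  have hh : ((2 ^ (7 * M)) ^ R * (2 ^ (2 * q)) ^ (S + L)) ^ L ≤ (2:ℝ) ^ (378 * Z) := by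
    rw [← pow_mul, ← pow_mul, ← pow_add, ← pow_mul]
    refine pow_le_pow_right₀ (by norm_num) ?_
    rw [hR, hS]
    have : L ≤ L * M := Nat.le_mul_of_pos_right _ hM
    calc (7 * M * (8 * L * q) + 2 * q * (160 * L * M + L)) * L
        ≤ (7 * M * (8 * L * q) + 2 * q * (160 * L * M + L * M)) * L := by gcongr
      _ = 378 * Z := by rw [hZ]; ring
  have hG : ((2:ℝ) ^ ((w + 3) * K)) ^ 2 = 2 ^ (640 * Z) := by
    rw [← pow_mul]; congr 1
    rw [hK, hZ]
    calc (w + 3) * (1280 * L * q * M) * 2 = 640 * (L * (4 * (w + 3)) * q * M) := by ring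
      _ = _ := by rw [← hL]; ring
  have hN : K * L = 1280 * Z := by rw [hK, hZ]; ring
  have hpoly : 4 * ((K * L : ℕ) : ℝ) ^ 2 < 2 ^ (30 * Z) := by
    rw [hN]
    have h1 : Z < 2 ^ Z := Nat.lt_two_pow_self
    have h2 : 4 * (1280 * Z) ^ 2 < 2 ^ (30 * Z) := by
      calc 4 * (1280 * Z) ^ 2 = 6553600 * Z ^ 2 := by ring
        _ < 2 ^ 28 * (2 ^ Z) ^ 2 := by nlinarith
        _ ≤ (2 ^ Z) ^ 28 * (2 ^ Z) ^ 2 := by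
            gcongr; exact (Nat.pow_le_pow_right (by norm_num) hZ0 : 2 ^ 1 ≤ 2 ^ Z)
        _ = _ := by rw [← pow_add, ← pow_mul, mul_comm]
    exact_mod_cast h2
  calc _ ≤ 4 * ((K * L : ℕ) : ℝ) ^ 2 * 2 ^ (378 * Z) * 2 ^ (640 * Z) * 2 ^ (232 * Z) := by
        rw [hG]; gcongr
    _ < 2 ^ (30 * Z) * 2 ^ (378 * Z) * 2 ^ (640 * Z) * 2 ^ (232 * Z) := by gcongr
    _ = _ := by rw [← pow_add, ← pow_add, ← pow_add, hN]; congr 1; ring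

theorem dirichlet_nat_parameters {w p q M E : ℕ} (hw : 27 ≤ w) (hp : 2 ^ (3 * w) ≤ p)
    (hq0 : 0 < q) (hqQ : q ≤ 2 ^ w) (hM : M = p / (q * 2 ^ w) + 1)
    (hE : 41000 * (w + 3) ^ 2 * p ≤ E * 2 ^ w) :
    2 ^ w ≤ M ∧ p < q * M * 2 ^ w ∧ 160 * (4 * (w + 3)) * M + 4 * (w + 3) ≤ p / q ∧
      24 * (4 * (w + 3)) ^ 2 * q * 4 ^ (1280 * (4 * (w + 3)) ^ 2 * q * M) ≤ 2 ^ E := by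
  have hQ := mul_sq_le_two_pow hw
  have hQ27 : 2 ^ 27 ≤ 2 ^ w := Nat.pow_le_pow_right (by norm_num) hw
  have hww : 2 ^ w * 2 ^ w = 2 ^ (2 * w) := by rw [← pow_add, two_mul]
  rw [mul_comm 3, pow_mul] at hp
  generalize 2 ^ w = Q at *
  have hQ0 : 0 < Q := by omega
  have hM1 : p < q * M * Q := by
    have := Nat.lt_mul_div_succ p (show 0 < q * Q by positivity)
    calc p < q * Q * (p / (q * Q) + 1) := this
      _ = _ := by rw [hM]; ring
  have hM2 : q * M * Q ≤ p + q * Q := by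
    have := Nat.mul_div_le p (q * Q)
    calc q * M * Q = q * Q * (p / (q * Q)) + q * Q := by rw [hM]; ring
      _ ≤ _ := by gcongr
  have hMQ : Q ≤ M := by
    have h1 : Q * Q ^ 2 < M * Q ^ 2 := by
      calc Q * Q ^ 2 = Q ^ 3 := by ring
        _ ≤ p := hp
        _ < q * M * Q := hM1
        _ ≤ Q * M * Q := by gcongr
        _ = _ := by ring
    exact (Nat.lt_of_mul_lt_mul_right h1).le
  have hpQ : Q * (q * Q) ≤ p := by
    calc Q * (q * Q) ≤ Q * (Q * Q) := by gcongr
      _ = Q ^ 3 := by ring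
      _ ≤ p := hp
  have hQp : q * Q ≤ p := (Nat.le_mul_of_pos_left _ hQ0).trans hpQ
  have hQp' : Q ≤ p := (Nat.le_mul_of_pos_left _ hq0).trans hQp
  have hwQ : 1288 * (w + 3) ≤ Q := by
    refine le_trans ?_ hQ
    nlinarith
  refine ⟨hMQ, hM1, ?_, ?_⟩
  · refine (Nat.le_div_iff_mul_le hq0).2 ?_
    have h1 : (160 * (4 * (w + 3)) * M + 4 * (w + 3)) * q * Q ≤ p * Q := by
      calc (160 * (4 * (w + 3)) * M + 4 * (w + 3)) * q * Q
          ≤ (160 * (4 * (w + 3)) * M + 4 * (w + 3) * M) * q * Q := by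
            have : 4 * (w + 3) ≤ 4 * (w + 3) * M := Nat.le_mul_of_pos_right _ (by omega)
            gcongr
        _ = 644 * (w + 3) * (q * M * Q) := by ring
        _ ≤ 644 * (w + 3) * (2 * p) := Nat.mul_le_mul_left _ (by linarith)
        _ = (1288 * (w + 3)) * p := by ring
        _ ≤ Q * p := by gcongr
        _ = _ := by ring
    exact Nat.le_of_mul_le_mul_right h1 hQ0
  · have hE2 : 2 * w + 2 * (1280 * (4 * (w + 3)) ^ 2 * q * M) ≤ E := by
      refine Nat.le_of_mul_le_mul_right (le_trans ?_ hE) hQ0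
      have h1 : Q * (q * M * Q) ≤ Q * p + p := by
        calc Q * (q * M * Q) ≤ Q * (p + q * Q) := by gcongr
          _ = Q * p + Q * (q * Q) := by ring
          _ ≤ _ := by gcongr
      have h2 : 40960 * (q * M * Q) ≤ 40999 * p := by
        have h5 : 40960 * p ≤ 39 * Q * p := by gcongr; omega
        have h3 : Q * (40960 * (q * M * Q)) ≤ Q * (40999 * p) := by
          calc Q * (40960 * (q * M * Q)) = 40960 * (Q * (q * M * Q)) := by ring
            _ ≤ 40960 * (Q * p + p) := by gcongr
            _ = 40960 * (Q * p) + 40960 * p := by ring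
            _ ≤ 40960 * (Q * p) + 39 * Q * p := by gcongr
            _ = _ := by ring
        exact Nat.le_of_mul_le_mul_left h3 hQ0
      have h4 : 2 * w * Q ≤ (w + 3) ^ 2 * p := by
        calc 2 * w * Q ≤ 2 * w * p := by gcongr
          _ ≤ _ := by gcongr; nlinarith
      calc (2 * w + 2 * (1280 * (4 * (w + 3)) ^ 2 * q * M)) * Q
          = 2 * w * Q + (w + 3) ^ 2 * (40960 * (q * M * Q)) := by ring
        _ ≤ (w + 3) ^ 2 * p + (w + 3) ^ 2 * (40999 * p) := by gcongr
        _ = _ := by ring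
    calc _ ≤ Q * Q * 4 ^ (1280 * (4 * (w + 3)) ^ 2 * q * M) := by
          gcongr
          calc 24 * (4 * (w + 3)) ^ 2 = 384 * (w + 3) ^ 2 := by ring
            _ ≤ Q := hQ
      _ = 2 ^ (2 * w + 2 * (1280 * (4 * (w + 3)) ^ 2 * q * M)) := by
          rw [pow_add, pow_mul 2 2 (1280 * (4 * (w + 3)) ^ 2 * q * M), hww]
          norm_num
      _ ≤ _ := Nat.pow_le_pow_right (by norm_num) hE2

theorem exists_dirichlet_parameters {w p a h E : ℕ} (hw : 27 ≤ w) (hp : 2 ^ (3 * w) ≤ p)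
    (hap : a ≤ p) (hh : h * 2 ^ (2 * w) ≤ p) (hE : 41000 * (w + 3) ^ 2 * p ≤ E * 2 ^ w) :
    ∃ q r b p₀ M : ℕ, ∃ a₀ : ℤ, 0 < q ∧ r ≤ q ∧ 4 ≤ M ∧ q ≤ M ∧ h ≤ M ∧ p₀ ≤ q ∧ |a₀| ≤ 2 * M ∧
      p = b * q + p₀ ∧ (a : ℤ) = b * r + a₀ ∧
      160 * (4 * (w + 3)) * M + 4 * (w + 3) ≤ b ∧ b * q ≤ q * M * 2 ^ w ∧
      24 * (4 * (w + 3)) ^ 2 * q * 4 ^ (1280 * (4 * (w + 3)) ^ 2 * q * M) ≤ 2 ^ E := by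
  have hQ0 : 0 < 2 ^ w := by positivity
  have hp0 : 0 < p := lt_of_lt_of_le (by positivity) hp
  obtain ⟨r, q, hq0, hqQ, hdir⟩ := Real.exists_int_int_abs_mul_sub_le ((a:ℝ) / p) hQ0
  lift q to ℕ using hq0.le
  have hq0 : 0 < q := by exact_mod_cast hq0
  have hqQ : q ≤ 2 ^ w := by exact_mod_cast hqQ
  obtain ⟨hMQ, hM1, hb, hEE⟩ := dirichlet_nat_parameters hw hp hq0 hqQ rfl hE
  set M := p / (q * 2 ^ w) + 1
  have hQ27 : 2 ^ 27 ≤ 2 ^ w := Nat.pow_le_pow_right (by norm_num) hw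
  rw [show 2 * w = w * 2 by ring, pow_mul] at hh
  have hpR : (0:ℝ) < p := by exact_mod_cast hp0
  have hqR : (0:ℝ) < q := by exact_mod_cast hq0
  have hap1 : (a:ℝ) / p ≤ 1 := by rw [div_le_one hpR]; exact_mod_cast hap
  have hap0 : (0:ℝ) ≤ q * ((a:ℝ) / p) := by positivity
  have hM1R : (p:ℝ) < q * M * 2 ^ w := by exact_mod_cast hM1
  have hdm : p = p / q * q + p % q := by rw [mul_comm]; exact (Nat.div_add_mod p q).symm
  have hmod : p % q ≤ q := (Nat.mod_lt _ hq0).le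
  have hfrac : (1:ℝ) / (2 ^ w + 1) < 1 := by
    rw [div_lt_one (by positivity)]
    have : (0:ℝ) < 2 ^ w := by positivity
    linarith
  have hfrac2 : (2:ℝ) ^ w * (1 / (2 ^ w + 1)) ≤ 1 := by
    rw [mul_one_div, div_le_one (by positivity)]
    linarith
  push_cast at hdir
  obtain ⟨hd1, hd2⟩ := abs_le.1 hdir
  have hr0 : 0 ≤ r := by
    have : (-1:ℝ) < r := by linarith
    have : -1 < r := by exact_mod_cast this
    omega
  lift r to ℕ using hr0
  push_cast at hdir hd1 hd2
  have hrq : r ≤ q := by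
    have : (r:ℝ) < q + 1 := by nlinarith
    have : r < q + 1 := by exact_mod_cast this
    omega
  have hhM : h ≤ M := by
    have h1 : h * (2 ^ w) ^ 2 < M * (2 ^ w) ^ 2 := by
      calc h * (2 ^ w) ^ 2 ≤ p := hh
        _ < q * M * 2 ^ w := hM1
        _ ≤ 2 ^ w * M * 2 ^ w := by gcongr
        _ = _ := by ring
    exact (Nat.lt_of_mul_lt_mul_right h1).le
  refine ⟨q, r, p / q, p % q, M, a - (p / q : ℕ) * r, hq0, hrq, by omega, by omega, hhM, hmod, ?_,
    hdm, by ring, hb, (Nat.div_mul_le_self p q).trans hM1.le, hEE⟩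
  have hb : ((p / q : ℕ) : ℝ) * q = p - (p % q : ℕ) := by
    have : (p:ℝ) = (p / q : ℕ) * q + (p % q : ℕ) := by exact_mod_cast hdm
    linarith
  have e1 : ((a:ℝ) - (p / q : ℕ) * r) * q = p * (q * (a / p) - r) + (p % q : ℕ) * r := by
    field_simp
    linear_combination -(r:ℝ) * hb
  have h2 : |(p:ℝ) * (q * (a / p) - r)| ≤ q * M := by
    rw [abs_mul, abs_of_pos hpR]
    calc (p:ℝ) * |(q:ℝ) * (a / p) - r| ≤ (q * M * 2 ^ w) * (1 / (2 ^ w + 1)) := by gcongr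
      _ = (q:ℝ) * M * (2 ^ w * (1 / (2 ^ w + 1))) := by ring
      _ ≤ q * M * 1 := by gcongr
      _ = _ := by ring
  have h3 : ((p % q : ℕ):ℝ) * r ≤ q * M := by
    have : p % q * r ≤ q * M := Nat.mul_le_mul hmod (by omega)
    exact_mod_cast this
  have h4 : (0:ℝ) ≤ ((p % q : ℕ):ℝ) * r := by positivity
  have h5 : |(a:ℝ) - (p / q : ℕ) * r| ≤ 2 * M := by
    rw [abs_le] at h2 ⊢
    constructor <;> nlinarith
  exact_mod_cast h5

theorem goldenRatio_pow_ne_two_pow {q : ℕ} (hq : 0 < q) (r : ℕ) : Real.goldenRatio ^ q ≠ 2 ^ r := by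
  obtain ⟨k, rfl⟩ : ∃ k, q = k + 1 := ⟨q - 1, by omega⟩
  intro h
  rw [← Real.goldenRatio_mul_fib_succ_add_fib] at h
  have hf : (Nat.fib (k + 1) : ℝ) ≠ 0 := by
    exact_mod_cast (Nat.fib_pos.2 (Nat.succ_pos k)).ne'
  refine Real.goldenRatio_irrational.ne_rat ((2 ^ r - Nat.fib k) / Nat.fib (k + 1)) ?_
  push_cast
  rw [eq_div_iff hf]
  linarith

set_option maxHeartbeats 1000000 in
open Polynomial in
theorem golden_log_form_lower_bound {w p a h E : ℕ} (hw : 27 ≤ w) (hp : 2 ^ (3 * w) ≤ p)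
    (hap : a ≤ p) (hh : h * 2 ^ (2 * w) ≤ p) (hE : 41000 * (w + 3) ^ 2 * p ≤ E * 2 ^ w)
    (g : ℤ[X]) (hg1 : 1 ≤ aeval Real.goldenRatio g)
    (hg2 : aeval Real.goldenRatio g ≤ 3 * Real.goldenRatio ^ h)
    (hg3 : |aeval Real.goldenConj g| ≤ 3) :
    (1 / 2 : ℝ) ^ E < |a * Real.log 2 + Real.log √5 - p * Real.log Real.goldenRatio -
      Real.log (aeval Real.goldenRatio g)| := by
  by_contra! hcon
  obtain ⟨q, r, b, p₀, M, a₀, hq, hrq, hM4, hqM, hhM, hp₀, ha₀, hpb, hab, hSL, hbM, hEE⟩ :=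
    exists_dirichlet_parameters hw hp hap hh hE
  set G := aeval Real.goldenRatio g
  set φ := Real.goldenRatio with hφ
  rw [abs_le] at ha₀
  obtain ⟨u, v, huv, huv2⟩ : ∃ u v : ℕ, a₀ = u - v ∧ u + v ≤ 2 * M :=
    ⟨a₀.toNat, (-a₀).toNat, by omega, by omega⟩
  have hφ1 : 1 < φ := Real.one_lt_goldenRatio
  have hφ2 : φ < 2 := Real.goldenRatio_lt_two
  have h5 : √5 = 2 * φ - 1 := by rw [hφ, Real.goldenRatio]; ring
  have h5' : -√5 = 2 * Real.goldenConj - 1 := by rw [Real.goldenConj]; ring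
  have h5b : √5 < 3 := by rw [h5]; linarith
  have h5a : 1 < √5 := by rw [h5]; linarith
  have hψ : |Real.goldenConj| ≤ 1 := by
    rw [abs_of_neg Real.goldenConj_neg]; linarith [Real.neg_one_lt_goldenConj]
  have aeval_two : ∀ z : ℝ, aeval z (2 : ℤ[X]) = 2 := fun z => map_ofNat _ 2
  set A₁ : ℤ[X] := 2 ^ u * (2 * X - 1) with hA₁
  set A₂ : ℤ[X] := 2 ^ v * (X ^ p₀ * g) with hA₂
  have eA₁ : aeval φ A₁ = 2 ^ u * √5 := by simp [hA₁, h5, aeval_two]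
  have eA₂ : aeval φ A₂ = 2 ^ v * (φ ^ p₀ * G) := by simp [hA₂, G, aeval_two, hφ]
  have en₁ : aeval φ (X ^ q : ℤ[X]) = φ ^ q := by simp
  have en₂ : aeval φ (2 ^ r : ℤ[X]) = 2 ^ r := by simp [aeval_two]
  have eA₁' : |aeval Real.goldenConj A₁| = 2 ^ u * √5 := by
    simp only [hA₁, map_mul, map_pow, map_sub, map_one, aeval_two, aeval_X, ← h5', abs_mul,
      abs_pow, Nat.abs_ofNat, abs_neg, abs_of_nonneg (Real.sqrt_nonneg 5)]
  have eA₂' : |aeval Real.goldenConj A₂| ≤ 2 ^ v * 3 := by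
    simp only [hA₂, map_mul, map_pow, aeval_two, aeval_X, abs_mul, abs_pow, Nat.abs_ofNat]
    gcongr
    calc |Real.goldenConj| ^ p₀ * |aeval Real.goldenConj g| ≤ 1 ^ p₀ * 3 := by gcongr
      _ = 3 := by simp
  have en₁' : |aeval Real.goldenConj (X ^ q : ℤ[X])| ≤ 1 := by
    simpa using pow_le_one₀ (abs_nonneg _) hψ
  have en₂' : |aeval Real.goldenConj (2 ^ r : ℤ[X])| = 2 ^ r := by simp [aeval_two]
  have hφp : φ ^ p₀ ≤ 2 ^ M := by
    calc φ ^ p₀ ≤ 2 ^ p₀ := by gcongr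
      _ ≤ 2 ^ M := pow_le_pow_right₀ (by norm_num) (by omega)
  have hGM : G ≤ 3 * 2 ^ M := by
    refine hg2.trans ?_
    gcongr
    calc φ ^ h ≤ 2 ^ h := by gcongr
      _ ≤ 2 ^ M := pow_le_pow_right₀ (by norm_num) (by omega)
  have two_pow : ∀ {i j : ℕ}, i ≤ j → (2:ℝ) ^ i ≤ 2 ^ j := fun h =>
    pow_le_pow_right₀ (by norm_num) h
  have hA₂M : aeval φ A₂ ≤ 2 ^ v * (2 ^ M * (3 * 2 ^ M)) := by
    rw [eA₂]; gcongr
  have hA₂1 : 1 ≤ aeval φ A₂ := by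
    rw [eA₂]
    exact one_le_mul_of_one_le_of_one_le (one_le_pow₀ (by norm_num))
      (one_le_mul_of_one_le_of_one_le (one_le_pow₀ hφ1.le) hg1)
  have hA₁1 : 1 ≤ aeval φ A₁ := by
    rw [eA₁]
    exact one_le_mul_of_one_le_of_one_le (one_le_pow₀ (by norm_num)) h5a.le
  have hlogeq : Real.log (aeval φ A₁ / aeval φ A₂) - b * Real.log (aeval φ (X ^ q : ℤ[X]) /
      aeval φ (2 ^ r : ℤ[X])) = a * Real.log 2 + Real.log √5 - p * Real.log φ - Real.log G := by
    rw [eA₁, eA₂, en₁, en₂, Real.log_div (by positivity) (by positivity),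
      Real.log_div (by positivity) (by positivity), Real.log_mul (by positivity) (by positivity),
      Real.log_mul (by positivity) (by positivity), Real.log_mul (by positivity) (by positivity)]
    simp only [Real.log_pow]
    have e1 : (a:ℝ) = b * r + (u - v) := by
      have : (a:ℤ) = b * r + (u - v) := by rw [hab, huv]
      exact_mod_cast this
    have e2 : (p:ℝ) = b * q + p₀ := by exact_mod_cast hpb
    rw [e1, e2]
    ring
  set ω := Real.log (aeval φ (X ^ q : ℤ[X]) / aeval φ (2 ^ r : ℤ[X])) with hω
  have hω0 : ω ≠ 0 := by
    rw [hω, en₁, en₂]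
    refine Real.log_ne_zero_of_pos_of_ne_one (by positivity) fun h => ?_
    rw [div_eq_one_iff_eq (by positivity)] at h
    exact goldenRatio_pow_ne_two_pow hq r h
  have hb0 : 0 < b := by omega
  have hlog2 : Real.log 2 ≤ 0.7 := by linarith [Real.log_two_lt_d9]
  have hlogA₁ : Real.log (aeval φ A₁) ≤ (2 * M + 2) * 0.7 := by
    calc Real.log (aeval φ A₁) ≤ Real.log (2 ^ (2 * M + 2)) := by
          refine Real.log_le_log (by linarith) ?_
          rw [eA₁, pow_add]
          exact mul_le_mul (two_pow (by omega)) (by linarith) (by positivity) (by positivity)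
      _ = (2 * M + 2) * Real.log 2 := by rw [Real.log_pow]; push_cast; ring
      _ ≤ _ := by gcongr
  have hlogA₂ : Real.log (aeval φ A₂) ≤ (4 * M + 2) * 0.7 := by
    calc Real.log (aeval φ A₂) ≤ Real.log (2 ^ (4 * M + 2)) := by
          refine Real.log_le_log (by linarith) (hA₂M.trans ?_)
          calc (2:ℝ) ^ v * (2 ^ M * (3 * 2 ^ M)) ≤ 2 ^ (2 * M) * (2 ^ M * (4 * 2 ^ M)) := by
                gcongr
                · norm_num
                · omega
                · norm_num
            _ = _ := by ring
      _ = (4 * M + 2) * Real.log 2 := by rw [Real.log_pow]; push_cast; ring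
      _ ≤ _ := by gcongr
  have hlogA₁0 := Real.log_nonneg hA₁1
  have hlogA₂0 := Real.log_nonneg hA₂1
  have hM4R : (4:ℝ) ≤ M := by exact_mod_cast hM4
  have hωb : |ω| * b ≤ 5 * M := by
    have h1 : (1 / 2 : ℝ) ^ E ≤ 1 := pow_le_one₀ (by norm_num) (by norm_num)
    have h2 := hcon.trans h1
    rw [← hlogeq, Real.log_div (by linarith) (by linarith)] at h2
    rw [← Nat.abs_cast b, ← abs_mul, abs_le]
    rw [abs_le] at h2
    constructor <;> linarith
  obtain ⟨L, hL⟩ : ∃ L, L = 4 * (w + 3) := ⟨_, rfl⟩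
  rw [← hL] at hSL hEE
  have hL0 : 0 < L := by omega
  obtain ⟨K, hK⟩ : ∃ K, K = 1280 * L * q * M := ⟨_, rfl⟩
  have hK0 : 0 < K := by rw [hK]; positivity
  have hcard : L * (K - 1) < 8 * L * q * (160 * L * M) := by
    calc L * (K - 1) < L * K := Nat.mul_lt_mul_of_pos_left (by omega) hL0
      _ = _ := by rw [hK]; ring
  have hfin : (2:ℝ) ^ 4 * 2 ^ (6 * M) ≤ 2 ^ (7 * M) := by
    rw [← pow_add]; exact two_pow (by omega)
  have hKR : (K:ℝ) = 1280 * L * q * M := by rw [hK]; push_cast; ring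
  have hmain := two_pow_le_of_abs_log_sub_le (K := K) (L := L) (R := 8 * L * q)
    (S := 160 * L * M) (b := b) (A₁ := A₁) (A₂ := A₂) (n₁ := X ^ q) (n₂ := 2 ^ r)
    (G := 2 ^ ((w + 3) * K)) (h₁ := 2 ^ (7 * M)) (h₂ := 2 ^ (2 * q)) (lam := (1 / 2) ^ E) (ω := ω)
    hK0 hL0 hSL hcard (by linarith) (by linarith) (by rw [en₁]; positivity)
    (by rw [en₂]; positivity) (one_le_pow₀ (by norm_num)) (one_le_pow₀ (by norm_num))
    (by
      rw [eA₁']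
      calc aeval φ A₂ * (2 ^ u * √5) ≤ 2 ^ v * (2 ^ M * (3 * 2 ^ M)) * (2 ^ u * 3) := by gcongr
        _ = 9 * (2 ^ (u + v) * 2 ^ (2 * M)) := by ring
        _ ≤ 2 ^ 4 * (2 ^ (4 * M) * 2 ^ (2 * M)) := by
            gcongr
            · norm_num
            · norm_num
            · omega
        _ = 2 ^ 4 * 2 ^ (6 * M) := by ring
        _ ≤ _ := hfin)
    (by
      calc aeval φ A₂ * |aeval Real.goldenConj A₂|
          ≤ 2 ^ v * (2 ^ M * (3 * 2 ^ M)) * (2 ^ v * 3) := by gcongr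
        _ = 9 * (2 ^ (2 * v) * 2 ^ (2 * M)) := by ring
        _ ≤ 2 ^ 4 * (2 ^ (4 * M) * 2 ^ (2 * M)) :=
            mul_le_mul (by norm_num) (mul_le_mul_of_nonneg_right (two_pow (by omega))
              (by positivity)) (by positivity) (by positivity)
        _ = 2 ^ 4 * 2 ^ (6 * M) := by ring
        _ ≤ _ := hfin)
    (by
      rw [en₂]
      calc (2:ℝ) ^ r * |aeval Real.goldenConj (X ^ q : ℤ[X])| ≤ 2 ^ r * 1 := by gcongr
        _ ≤ 2 ^ (2 * q) := by rw [mul_one]; exact two_pow (by omega))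
    (by rw [en₂, en₂', ← pow_add]; exact two_pow (by omega))
    rfl hω0 (by positivity) (by rw [hlogeq]; exact hcon)
    (by
      have h1 : (24 * L ^ 2 * q * 4 ^ (1280 * L ^ 2 * q * M) : ℝ) ≤ 2 ^ E := by exact_mod_cast hEE
      rw [one_div, inv_pow]
      have h2 : (3 * (L * (8 * L * q : ℕ) * ((2:ℝ) ^ E)⁻¹)) * 4 ^ (K * L) =
          (24 * L ^ 2 * q * 4 ^ (1280 * L ^ 2 * q * M)) / 2 ^ E := by
        rw [show K * L = 1280 * L ^ 2 * q * M by rw [hK]; ring]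
        push_cast
        ring
      rw [h2, div_le_one (by positivity)]
      exact h1)
    (fun k hk => by
      refine pow_div_factorial_le_two_pow (by positivity) ?_ hk.le
      have h1 : (b:ℝ) * q ≤ q * M * 2 ^ w := by exact_mod_cast hbM
      have h2 : (2:ℝ) ≤ 2 ^ w := by
        calc (2:ℝ) = 2 ^ 1 := by norm_num
          _ ≤ 2 ^ w := two_pow (by omega)
      have h3 : (0:ℝ) ≤ K := Nat.cast_nonneg _
      push_cast
      calc 4 * (8 * (L:ℝ) * q * b) + K = 32 * L * (b * q) + K := by ring
        _ ≤ 32 * L * (q * M * 2 ^ w) + K := by gcongr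
        _ = K * 2 ^ w / 40 + K := by rw [hKR]; ring
        _ ≤ K * 2 ^ w := by nlinarith)
  refine absurd hmain (not_le.2 (four_mul_sq_mul_lt_two_pow hL hq (by omega) rfl rfl hK ?_))
  calc |ω| * (((8 * L * q : ℕ) : ℝ) * b) = (|ω| * b) * (8 * L * q : ℕ) := by ring
    _ ≤ _ := by gcongr

theorem abs_log_sub_log_le {W S ε : ℝ} (hW : 0 < W) (hε : ε ≤ 1 / 2) (h : |W - S| ≤ ε * W) :
    |Real.log W - Real.log S| ≤ 2 * ε := by
  obtain ⟨h1, h2⟩ := abs_le.1 h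
  have hS : 0 < S := by nlinarith
  have e1 := Real.log_le_sub_one_of_pos (div_pos hW hS)
  have e2 := Real.log_le_sub_one_of_pos (div_pos hS hW)
  rw [Real.log_div hW.ne' hS.ne'] at e1
  rw [Real.log_div hS.ne' hW.ne'] at e2
  have e3 : W / S - 1 ≤ 2 * ε := by
    rw [div_sub_one hS.ne', div_le_iff₀ hS]
    have : 0 ≤ ε := by
      by_contra! h0
      nlinarith [abs_nonneg (W - S)]
    nlinarith
  have e4 : S / W - 1 ≤ 2 * ε := by
    rw [div_sub_one hW.ne', div_le_iff₀ hW]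
    have : 0 ≤ ε := by
      by_contra! h0
      nlinarith [abs_nonneg (W - S)]
    nlinarith
  rw [abs_le]
  constructor <;> linarith

theorem two_pow_le_goldenRatio_pow {e s : ℕ} (h : 13 * e ≤ 9 * s) :
    (2:ℝ) ^ e ≤ Real.goldenRatio ^ s := by
  have h13 : (2:ℝ) ^ 9 ≤ Real.goldenRatio ^ 13 := by
    have h1 : (1.618:ℝ) ≤ Real.goldenRatio := by
      rw [Real.goldenRatio]
      have : (2.236:ℝ) ≤ √5 := Real.le_sqrt_of_sq_le (by norm_num)
      linarith
    rw [← Real.goldenRatio_mul_fib_succ_add_fib 12]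
    norm_num [Nat.fib]
    linarith
  refine le_of_pow_le_pow_left₀ (n := 13) (by norm_num) (by positivity) ?_
  calc ((2:ℝ) ^ e) ^ 13 = 2 ^ (13 * e) := by rw [← pow_mul, mul_comm]
    _ ≤ 2 ^ (9 * s) := pow_le_pow_right₀ (by norm_num) h
    _ = (2 ^ 9) ^ s := pow_mul _ _ _
    _ ≤ (Real.goldenRatio ^ 13) ^ s := by gcongr
    _ = _ := by rw [← pow_mul, ← pow_mul, mul_comm]

theorem goldenRatio_pow_four_mul_le (n : ℕ) : Real.goldenRatio ^ (4 * n) ≤ 2 ^ (3 * n) := by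
  rw [pow_mul, pow_mul]
  gcongr
  have h1 : Real.goldenRatio ≤ 1.62 := by
    rw [Real.goldenRatio]
    have : √5 ≤ 2.24 := by rw [Real.sqrt_le_left (by norm_num)]; norm_num
    linarith
  rw [← Real.goldenRatio_mul_fib_succ_add_fib 3]
  norm_num [Nat.fib]
  linarith

/-- A sum of three Fibonacci numbers lies close to a power of two. -/
structure CloseToTwoPow (n m l a : ℕ) : Prop where
  pos : 0 < l
  le₁ : m ≤ n
  le₂ : l ≤ m
  close : |(Nat.fib n : ℝ) + Nat.fib m + Nat.fib l - 2 ^ a| < (2 : ℝ) ^ ((a : ℝ) / 2)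

namespace CloseToTwoPow

variable {n m l a : ℕ}

theorem abs_sub_le (H : CloseToTwoPow n m l a) :
    |√5 * 2 ^ a - (Real.goldenRatio ^ n + Real.goldenRatio ^ m + Real.goldenRatio ^ l)| ≤
      3 * (1 / 2) ^ (a / 2) * (√5 * 2 ^ a) := by
  have h5 : 0 < √5 := by positivity
  have h52 : (2:ℝ) ≤ √5 := Real.le_sqrt_of_sq_le (by norm_num)
  have hbin : ∀ k : ℕ, Real.goldenRatio ^ k = √5 * Nat.fib k + Real.goldenConj ^ k := by
    intro k
    rw [Real.coe_fib_eq]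
    field_simp
    ring
  have hψ : ∀ k : ℕ, |Real.goldenConj ^ k| ≤ 1 := by
    intro k
    rw [abs_pow]
    refine pow_le_one₀ (abs_nonneg _) ?_
    rw [abs_of_neg Real.goldenConj_neg]
    linarith [Real.neg_one_lt_goldenConj]
  have h2 : (2:ℝ) ^ ((a:ℝ) / 2) ≤ 2 ^ (a - a / 2) := by
    rw [← Real.rpow_natCast]
    refine Real.rpow_le_rpow_of_exponent_le (by norm_num) ?_
    have : a ≤ 2 * (a - a / 2) := by omega
    have : (a:ℝ) ≤ 2 * (a - a / 2 : ℕ) := by exact_mod_cast this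
    linarith
  have h3 : (1 / 2 : ℝ) ^ (a / 2) * 2 ^ a = 2 ^ (a - a / 2) := by
    rw [← pow_mul_pow_sub 2 (Nat.div_le_self a 2), ← mul_assoc, ← mul_pow]
    norm_num
  have h4 : (1:ℝ) ≤ 2 ^ (a - a / 2) := one_le_pow₀ (by norm_num)
  obtain ⟨c1, c2⟩ := abs_lt.1 H.close
  obtain ⟨n1, n2⟩ := abs_le.1 (hψ n)
  obtain ⟨m1, m2⟩ := abs_le.1 (hψ m)
  obtain ⟨l1, l2⟩ := abs_le.1 (hψ l)
  rw [hbin n, hbin m, hbin l, show 3 * (1 / 2) ^ (a / 2) * (√5 * 2 ^ a) =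
    3 * √5 * ((1 / 2) ^ (a / 2) * 2 ^ a) by ring, h3, abs_le]
  set T : ℝ := 2 ^ (a - a / 2)
  set D : ℝ := (Nat.fib n : ℝ) + Nat.fib m + Nat.fib l - 2 ^ a with hD
  have d1 : √5 * D ≤ √5 * T := by gcongr; linarith
  have d2 : √5 * (-D) ≤ √5 * T := by gcongr; linarith
  have d3 : 2 * 1 ≤ √5 * T := by gcongr
  have e : √5 * 2 ^ a - (√5 * Nat.fib n + Real.goldenConj ^ n +
      (√5 * Nat.fib m + Real.goldenConj ^ m) + (√5 * Nat.fib l + Real.goldenConj ^ l)) =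
      -(√5 * D) - (Real.goldenConj ^ n + Real.goldenConj ^ m + Real.goldenConj ^ l) := by
    rw [hD]; ring
  rw [e]
  constructor <;> linarith

theorem goldenRatio_pow_le (H : CloseToTwoPow n m l a) :
    Real.goldenRatio ^ n ≤ 12 * 2 ^ a := by
  have h := (abs_le.1 H.abs_sub_le).1
  have h5 : √5 ≤ 3 := by rw [Real.sqrt_le_left (by norm_num)]; norm_num
  have h1 : (1 / 2 : ℝ) ^ (a / 2) ≤ 1 := pow_le_one₀ (by norm_num) (by norm_num)
  have h2 : (0:ℝ) < Real.goldenRatio ^ m := by positivity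
  have h3 : (0:ℝ) < Real.goldenRatio ^ l := by positivity
  have h4 : 3 * (1 / 2) ^ (a / 2) * (√5 * 2 ^ a) ≤ 3 * 1 * (3 * (2:ℝ) ^ a) := by gcongr
  have h6 : √5 * 2 ^ a ≤ 3 * (2:ℝ) ^ a := by gcongr
  linarith

theorem nine_mul_lt (H : CloseToTwoPow n m l a) : 9 * n < 13 * (a + 5) := by
  by_contra! h
  have h1 := (two_pow_le_goldenRatio_pow (e := a + 5) (s := n) (by omega)).trans
    H.goldenRatio_pow_le
  rw [pow_add] at h1
  have : (0:ℝ) < 2 ^ a := by positivity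
  linarith

theorem half_pow_le (H : CloseToTwoPow n m l a) (hn : 100 ≤ n) :
    3 * (1 / 2 : ℝ) ^ (a / 2) ≤ 1 / 100 := by
  have h := H.nine_mul_lt
  calc 3 * (1 / 2 : ℝ) ^ (a / 2) ≤ 3 * (1 / 2) ^ 16 := by
        have : (1 / 2 : ℝ) ^ (a / 2) ≤ (1 / 2) ^ 16 :=
          pow_le_pow_of_le_one (by norm_num) (by norm_num) (by omega)
        linarith
    _ ≤ _ := by norm_num

theorem four_mul_le (H : CloseToTwoPow n m l a) (hn : 100 ≤ n) : 4 * a ≤ 3 * n + 8 := by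
  have h := (abs_le.1 H.abs_sub_le).2
  have hh := H.half_pow_le hn
  have h52 : (2:ℝ) ≤ √5 := Real.le_sqrt_of_sq_le (by norm_num)
  have hmn : Real.goldenRatio ^ m ≤ Real.goldenRatio ^ n :=
    pow_le_pow_right₀ Real.one_lt_goldenRatio.le H.le₁
  have hln : Real.goldenRatio ^ l ≤ Real.goldenRatio ^ n :=
    pow_le_pow_right₀ Real.one_lt_goldenRatio.le (H.le₂.trans H.le₁)
  have h1 : 3 * (1 / 2) ^ (a / 2) * (√5 * 2 ^ a) ≤ 1 / 100 * (√5 * 2 ^ a) := by gcongr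
  have h2 : 2 * (2:ℝ) ^ a ≤ √5 * 2 ^ a := by gcongr
  have h0 : 0 < Real.goldenRatio ^ n := by positivity
  have h3 : (2:ℝ) ^ a ≤ 4 * Real.goldenRatio ^ n := by linarith
  have h4 : (2:ℝ) ^ (4 * a) ≤ 2 ^ (3 * n + 8) := by
    calc (2:ℝ) ^ (4 * a) = (2 ^ a) ^ 4 := by rw [← pow_mul, mul_comm]
      _ ≤ (4 * Real.goldenRatio ^ n) ^ 4 := by gcongr
      _ = 2 ^ 8 * Real.goldenRatio ^ (4 * n) := by rw [mul_pow, ← pow_mul, mul_comm n]; norm_num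
      _ ≤ 2 ^ 8 * 2 ^ (3 * n) := by gcongr; exact goldenRatio_pow_four_mul_le n
      _ = _ := by rw [← pow_add, add_comm]
  exact (pow_le_pow_iff_right₀ (by norm_num)).1 h4

theorem half_pow_le_of_le {k c : ℕ} (h : k ≤ c) : (1 / 2 : ℝ) ^ c ≤ (1 / 2) ^ k :=
  pow_le_pow_of_le_one (by norm_num) (by norm_num) h

theorem log_form₃ (H : CloseToTwoPow n m l a) {k : ℕ} (hn : 100 ≤ n) (hk : k + 3 ≤ a / 2) :
    |a * Real.log 2 + Real.log √5 - Real.log (Real.goldenRatio ^ n + Real.goldenRatio ^ m +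
      Real.goldenRatio ^ l)| < (1 / 2) ^ k := by
  have h := abs_log_sub_log_le (by positivity) (by linarith [H.half_pow_le hn]) H.abs_sub_le
  rw [Real.log_mul (by positivity) (by positivity), Real.log_pow, add_comm] at h
  refine h.trans_lt ?_
  have h1 := half_pow_le_of_le hk
  rw [pow_add] at h1
  have : (0:ℝ) < (1 / 2) ^ k := by positivity
  linarith

theorem pow_le_pow_mul_half_pow {n m k : ℕ} (hmn : m ≤ n)
    (hs : (2:ℝ) ^ k ≤ Real.goldenRatio ^ (n - m)) :
    Real.goldenRatio ^ m ≤ Real.goldenRatio ^ n * (1 / 2) ^ k := by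
  rw [← pow_mul_pow_sub Real.goldenRatio hmn, mul_assoc]
  refine le_mul_of_one_le_right (by positivity) ?_
  calc (1:ℝ) = 2 ^ k * (1 / 2) ^ k := by rw [← mul_pow]; norm_num
    _ ≤ _ := by gcongr

theorem goldenRatio_pow_le' (H : CloseToTwoPow n m l a) (hn : 100 ≤ n) :
    Real.goldenRatio ^ n ≤ 3 / 2 * (√5 * 2 ^ a) := by
  have h := (abs_le.1 H.abs_sub_le).1
  have hh := H.half_pow_le hn
  have h1 : 3 * (1 / 2) ^ (a / 2) * (√5 * 2 ^ a) ≤ 1 / 100 * (√5 * 2 ^ a) := by gcongr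
  have h2 : (0:ℝ) < Real.goldenRatio ^ m := by positivity
  have h3 : (0:ℝ) < Real.goldenRatio ^ l := by positivity
  have : 0 < √5 * 2 ^ a := by positivity
  linarith

theorem log_form₂ (H : CloseToTwoPow n m l a) {k : ℕ} (hn : 100 ≤ n) (hk : k + 4 ≤ a / 2)
    (hs : 13 * (k + 4) ≤ 9 * (n - l)) :
    |a * Real.log 2 + Real.log √5 - Real.log (Real.goldenRatio ^ n + Real.goldenRatio ^ m)| <
      (1 / 2) ^ k := by
  have hl := pow_le_pow_mul_half_pow (H.le₂.trans H.le₁) (two_pow_le_goldenRatio_pow hs)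
  have hW := H.goldenRatio_pow_le' hn
  have hD := H.abs_sub_le
  have hk' := half_pow_le_of_le hk
  have hWpos : 0 < √5 * 2 ^ a := by positivity
  set W := √5 * 2 ^ a with hWd
  set κ : ℝ := (1 / 2) ^ (k + 4) with hκ
  have hκ0 : 0 < κ := by positivity
  have hκk : κ = (1 / 2) ^ k * (1 / 16) := by rw [hκ, pow_add]; norm_num
  have hκ1 : κ ≤ 1 / 16 := by
    rw [hκk]
    have : (1 / 2 : ℝ) ^ k ≤ 1 := pow_le_one₀ (by norm_num) (by norm_num)
    linarith
  have h1 : 3 * (1 / 2) ^ (a / 2) * W ≤ 3 * κ * W := by gcongr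
  have h2 : Real.goldenRatio ^ l ≤ 3 / 2 * W * κ := hl.trans (by gcongr)
  have hl0 : 0 < Real.goldenRatio ^ l := by positivity
  have h := abs_log_sub_log_le (W := W) (S := Real.goldenRatio ^ n + Real.goldenRatio ^ m)
    (ε := 9 / 2 * κ) hWpos (by linarith) (by
      rw [abs_le] at hD ⊢
      constructor <;> nlinarith)
  rw [hWd, Real.log_mul (by positivity) (by positivity), Real.log_pow, add_comm] at h
  refine h.trans_lt ?_
  have : (0:ℝ) < (1 / 2) ^ k := by positivity
  rw [hκk]
  linarith

theorem log_form₁ (H : CloseToTwoPow n m l a) {k : ℕ} (hn : 100 ≤ n) (hk : k + 4 ≤ a / 2)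
    (hs : 13 * (k + 4) ≤ 9 * (n - m)) :
    |a * Real.log 2 + Real.log √5 - n * Real.log Real.goldenRatio| < (1 / 2) ^ k := by
  have hm := pow_le_pow_mul_half_pow H.le₁ (two_pow_le_goldenRatio_pow hs)
  have hlm : Real.goldenRatio ^ l ≤ Real.goldenRatio ^ m :=
    pow_le_pow_right₀ Real.one_lt_goldenRatio.le H.le₂
  have hW := H.goldenRatio_pow_le' hn
  have hD := H.abs_sub_le
  have hk' := half_pow_le_of_le hk
  have hWpos : 0 < √5 * 2 ^ a := by positivity
  set W := √5 * 2 ^ a with hWd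
  set κ : ℝ := (1 / 2) ^ (k + 4) with hκ
  have hκ0 : 0 < κ := by positivity
  have hκk : κ = (1 / 2) ^ k * (1 / 16) := by rw [hκ, pow_add]; norm_num
  have hκ1 : κ ≤ 1 / 16 := by
    rw [hκk]
    have : (1 / 2 : ℝ) ^ k ≤ 1 := pow_le_one₀ (by norm_num) (by norm_num)
    linarith
  have h1 : 3 * (1 / 2) ^ (a / 2) * W ≤ 3 * κ * W := by gcongr
  have h2 : Real.goldenRatio ^ m ≤ 3 / 2 * W * κ := hm.trans (by gcongr)
  have hl0 : 0 < Real.goldenRatio ^ l := by positivity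
  have hm0 : 0 < Real.goldenRatio ^ m := by positivity
  have h := abs_log_sub_log_le (W := W) (S := Real.goldenRatio ^ n)
    (ε := 6 * κ) hWpos (by linarith) (by
      rw [abs_le] at hD ⊢
      constructor <;> nlinarith)
  rw [hWd, Real.log_mul (by positivity) (by positivity), Real.log_pow, Real.log_pow,
    add_comm] at h
  refine h.trans_lt ?_
  have : (0:ℝ) < (1 / 2) ^ k := by positivity
  rw [hκk]
  linarith

end CloseToTwoPow

namespace CloseToTwoPow

open Polynomial

variable {n m l a : ℕ}

theorem l_lt_or_lt (H : CloseToTwoPow n m l a) (hn : 100 ≤ n) :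
    l < 2 ^ 81 ∨ l < (n - l) * 2 ^ 54 := by
  by_contra! hc
  obtain ⟨hl, ht⟩ := hc
  have h9 := H.nine_mul_lt
  have h4 := H.four_mul_le hn
  have h1 := H.le₁
  have h2 := H.le₂
  have hk : l * 276 / 1000 + 1 + 3 ≤ a / 2 := by omega
  have hup := H.log_form₃ hn hk
  have e1 : Real.goldenRatio ^ (m - l) ≤ Real.goldenRatio ^ (n - l) :=
    pow_le_pow_right₀ Real.one_lt_goldenRatio.le (by omega)
  have e2 : 1 ≤ Real.goldenRatio ^ (m - l) := one_le_pow₀ Real.one_lt_goldenRatio.le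
  have hψ : ∀ k : ℕ, |Real.goldenConj ^ k| ≤ 1 := by
    intro k
    rw [abs_pow]
    refine pow_le_one₀ (abs_nonneg _) ?_
    rw [abs_of_neg Real.goldenConj_neg]
    linarith [Real.neg_one_lt_goldenConj]
  have ev : ∀ x : ℝ, aeval x (1 + X ^ (m - l) + X ^ (n - l) : ℤ[X]) =
      1 + x ^ (m - l) + x ^ (n - l) := by simp
  have hlow := golden_log_form_lower_bound (w := 27) (p := l) (a := a) (h := n - l)
    (E := l * 276 / 1000 + 1) le_rfl hl (by omega) ht (by omega) (1 + X ^ (m - l) + X ^ (n - l))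
    (by rw [ev]; linarith) (by rw [ev]; linarith) (by
      rw [ev]
      obtain ⟨a1, a2⟩ := abs_le.1 (hψ (m - l))
      obtain ⟨b1, b2⟩ := abs_le.1 (hψ (n - l))
      rw [abs_le]
      constructor <;> linarith)
  rw [ev] at hlow
  have e3 : Real.goldenRatio ^ n + Real.goldenRatio ^ m + Real.goldenRatio ^ l =
      Real.goldenRatio ^ l * (1 + Real.goldenRatio ^ (m - l) + Real.goldenRatio ^ (n - l)) := by
    rw [mul_add, mul_add, pow_mul_pow_sub _ h2, pow_mul_pow_sub _ (h2.trans h1)]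
    ring
  rw [e3, Real.log_mul (by positivity) (by positivity), Real.log_pow, ← sub_sub] at hup
  exact lt_asymm hup hlow

theorem m_lt_or_lt (H : CloseToTwoPow n m l a) (hn : 100 ≤ n) :
    m < 2 ^ 249 ∨ m < (n - m) * 2 ^ 166 := by
  by_contra! hc
  obtain ⟨hm, hs⟩ := hc
  have h9 := H.nine_mul_lt
  have h4 := H.four_mul_le hn
  have h1 := H.le₁
  have h2 := H.le₂
  have h3 := H.l_lt_or_lt hn
  have hk : m * 303236000 / 2 ^ 83 + 1 + 4 ≤ a / 2 := by omega
  have ht : 13 * (m * 303236000 / 2 ^ 83 + 1 + 4) ≤ 9 * (n - l) := by omega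
  have hup := H.log_form₂ hn hk ht
  have e2 : 1 ≤ Real.goldenRatio ^ (n - m) := one_le_pow₀ Real.one_lt_goldenRatio.le
  have ev : ∀ x : ℝ, aeval x (1 + X ^ (n - m) : ℤ[X]) = 1 + x ^ (n - m) := by simp
  have hlow := golden_log_form_lower_bound (w := 83) (p := m) (a := a) (h := n - m)
    (E := m * 303236000 / 2 ^ 83 + 1) (by norm_num) hm (by omega) hs (by omega)
    (1 + X ^ (n - m))
    (by rw [ev]; linarith) (by rw [ev]; linarith) (by
      rw [ev]
      have hψ : |Real.goldenConj ^ (n - m)| ≤ 1 := by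
        rw [abs_pow]
        refine pow_le_one₀ (abs_nonneg _) ?_
        rw [abs_of_neg Real.goldenConj_neg]
        linarith [Real.neg_one_lt_goldenConj]
      obtain ⟨a1, a2⟩ := abs_le.1 hψ
      rw [abs_le]
      constructor <;> linarith)
  rw [ev] at hlow
  have e3 : Real.goldenRatio ^ n + Real.goldenRatio ^ m =
      Real.goldenRatio ^ m * (1 + Real.goldenRatio ^ (n - m)) := by
    rw [mul_add, pow_mul_pow_sub _ h1]
    ring
  rw [e3, Real.log_mul (by positivity) (by positivity), Real.log_pow, ← sub_sub] at hup
  exact lt_asymm hup hlow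

theorem n_lt (H : CloseToTwoPow n m l a) (hn : 100 ≤ n) : n < 2 ^ 594 := by
  by_contra! hc
  have h9 := H.nine_mul_lt
  have h4 := H.four_mul_le hn
  have h1 := H.le₁
  have h3 := H.m_lt_or_lt hn
  have hk : n * 1656441000 / 2 ^ 198 + 1 + 4 ≤ a / 2 := by omega
  have hs : 13 * (n * 1656441000 / 2 ^ 198 + 1 + 4) ≤ 9 * (n - m) := by omega
  have hup := H.log_form₁ hn hk hs
  have hlow := golden_log_form_lower_bound (w := 198) (p := n) (a := a) (h := 0)
    (E := n * 1656441000 / 2 ^ 198 + 1) (by norm_num) hc (by omega) (by omega) (by omega)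
    1 (by simp) (by simp) (by simp)
  rw [map_one, Real.log_one, sub_zero] at hlow
  exact lt_asymm hup hlow

end CloseToTwoPow

/-- Application of `f` to `n`, arranged so that the kernel evaluates `n` to a numeral first. -/
def withNat {α : Type} (n : ℕ) (f : ℕ → α) : α :=
  match n with
  | 0 => f 0
  | k + 1 => f (k + 1)

/-- Fixed-point partial sum of the series `∑ ρ ^ (2 k + 1) / (2 k + 1)`. -/
def artanhAux (b R : ℕ) : ℕ → ℕ → ℕ → ℕ
  | 0, _, _ => 0
  | fuel + 1, k, P =>
    match P with
    | 0 => 0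
    | P' + 1 => withNat ((P' + 1) * R / b) fun P₂ => withNat (k + 1) fun k₂ =>
        (P' + 1) / (2 * k + 1) + artanhAux b R fuel k₂ P₂

/-- Fixed-point approximation of the logarithm: `Z / b ↦ log (Z / b)`. -/
def logFix (b fuel Z : ℕ) : ℕ :=
  withNat (b * (Z - b) / (Z + b)) fun R => withNat (R * R / b) fun R₂ => 2 * artanhAux b R₂ fuel 0 R

/-- `fuel` Newton steps for the integer square root of `v`, starting at `x`. -/
def sqrtNewton : ℕ → ℕ → ℕ → ℕ
  | 0, _, x => x
  | fuel + 1, v, x => withNat ((x + v / x) / 2) fun y => sqrtNewton fuel v y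

/-- Calls `f` with `b = 2 ^ B` and fixed-point approximations, in units of `1 / b`, of `log 2`,
`log φ`, `log √5` and `φ⁻¹`, where `φ` is the golden ratio. -/
def withConstants (B : ℕ) (f : ℕ → ℕ → ℕ → ℕ → ℕ → Bool) : Bool :=
  withNat (2 ^ B) fun b => withNat (sqrtNewton 15 (5 * b * b) (3 * b) - 1) fun D =>
  withNat ((b + D) / 2) fun T => withNat (B / 2 + 1) fun K =>
  withNat (logFix b K (2 * b)) fun X => withNat (logFix b K T) fun Y =>
  withNat (logFix b K D) fun L => withNat (T - b) fun G =>
  decide (D * D ≤ 5 * b * b) && decide (5 * b * b ≤ (D + 2) * (D + 2)) && f b X Y L G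

/-- Calls `cont` with the continued fraction convergents of `u / v` whose denominator lies in
`[lo, hi)`; consecutive convergents are `p₀ / q₀` and `p₁ / q₁`, and `acc` accumulates the
result. -/
def withConvergents (lo hi : ℕ) (cont : List (ℕ × ℕ) → Bool) :
    ℕ → ℕ → ℕ → ℕ → ℕ → ℕ → ℕ → List (ℕ × ℕ) → Bool
  | 0, _, _, _, _, _, _, acc => cont acc
  | fuel + 1, u, v, p₀, q₀, p₁, q₁, acc =>
    withNat (u / v) fun a => withNat (a * p₁ + p₀) fun p₂ => withNat (a * q₁ + q₀) fun q₂ =>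
    withNat (u - a * v) fun w =>
    bif Nat.ble hi q₂ then cont acc else
    bif Nat.ble lo q₂ then
      withConvergents lo hi cont fuel v w p₁ q₁ p₂ q₂ ((p₂, q₂) :: acc)
    else withConvergents lo hi cont fuel v w p₁ q₁ p₂ q₂ acc

/-- Certificate, given a convergent `c` of `X / Y`, that `a x - n y + z` is at least `W` in absolute
value for integers `|a|, |n| ≤ N` and reals `x`, `y`, `z` with `|x - X| ≤ e`, `|y - Y| ≤ e` and
`|z - Z| ≤ 3 e`. -/
def apart (W e N X Y Z : ℕ) (c : ℕ × ℕ) : Bool :=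
  withNat (c.2 * Z % Y) fun r =>
  withNat (W * c.2 + N * ((c.2 * X - c.1 * Y) + (c.1 * Y - c.2 * X)) + c.2 * (e * (2 * N + 3)))
    fun E => Nat.ble 1 c.2 && Nat.ble E r && Nat.ble (E + r) Y

/-- Certificate, given a convergent `c` of `X / Y`, that `a x - n y` is at least `W` in absolute
value for integers `0 < a ≤ N`, `|n| ≤ N` and reals `x`, `y` with `|x - X| ≤ e`, `|y - Y| ≤ e`. -/
def apart₀ (W e N X Y : ℕ) (c : ℕ × ℕ) : Bool :=
  Nat.ble (N + 1) c.2 && Nat.beq (Nat.gcd c.1 c.2) 1 &&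
  Nat.ble (W * c.2 + N * ((c.2 * X - c.1 * Y) + (c.1 * Y - c.2 * X)) + c.2 * (e * (2 * N))) Y

/-- Checks `f` at `fuel` consecutive exponents from `s` on, along with the fixed-point
approximations of the powers of `G / b`, the first of them being `U`. -/
def allPowers (b G : ℕ) (f : ℕ → ℕ → Bool) : ℕ → ℕ → ℕ → Bool
  | 0, _, _ => true
  | fuel + 1, s, U => f s U && withNat (s + 1) fun s₂ => withNat (U * G / b) fun U₂ =>
      allPowers b G f fuel s₂ U₂

/-- The exponents `s` for which `√5 / (1 + φ⁻¹ ^ s)` is a power of `φ` times a power of `2`. -/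
def isHomogeneous₂ (s : ℕ) : Bool := Nat.beq s 2 || Nat.beq s 6

/-- The exponents `s`, `t` for which `√5 / (1 + φ⁻¹ ^ s + φ⁻¹ ^ t)` is a power of `φ` times a power
of `2`. -/
def isHomogeneous₃ (s t : ℕ) : Bool :=
  match s with
  | 0 => Nat.beq t 3
  | 1 => Nat.beq t 1 || Nat.beq t 5
  | 3 => Nat.beq t 4
  | 7 => Nat.beq t 8
  | _ => false

/-- Reduction with one leading term: `a log 2 - n log φ + log √5` is not small for `a, n ≤ N`. -/
def round₁ (B N k : ℕ) : Bool :=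
  withConstants B fun _ X Y L _ =>
  withConvergents N (N * 2 ^ 20) (fun cs =>
    cs.any (apart (2 ^ (B - k)) (4 * B + 40) N X Y L)) B X Y 0 1 1 0 []

/-- Runs `apart` on the shift `log (√5 / (Z / b))`, replaced by `log (2 √5 / (Z / b))` to be
nonnegative. -/
def logApart (K W e N b X Y L Z : ℕ) (cs : List (ℕ × ℕ)) : Bool :=
  withNat (logFix b K Z) fun g => Nat.ble g (L + X) && withNat (L + X - g) fun μ =>
    cs.any (apart W e N X Y μ)

/-- Reduction with two leading terms, whose exponents differ by less than `S`. -/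
def round₂ (B N k S : ℕ) : Bool :=
  withConstants B fun b X Y L G =>
  withConvergents N (N * 2 ^ 20) (fun cs =>
    withNat (2 ^ (B - k)) fun W => withNat (4 * B + 40) fun e => withNat (B / 2 + 1) fun K =>
    cs.any (apart₀ W e N X Y) && allPowers b G (fun s U => isHomogeneous₂ s ||
      withNat (b + U) fun Z => logApart K W e N b X Y L Z cs) S 0 b) B X Y 0 1 1 0 []

/-- Reduction with three leading terms, whose exponents differ from the largest one by less than `S`
and `T`. -/
def round₃ (B N k S T : ℕ) : Bool :=
  withConstants B fun b X Y L G =>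
  withConvergents N (N * 2 ^ 20) (fun cs =>
    withNat (2 ^ (B - k)) fun W => withNat (4 * B + 40) fun e => withNat (B / 2 + 1) fun K =>
    cs.any (apart₀ W e N X Y) && allPowers b G (fun s U => allPowers b G (fun t V =>
      isHomogeneous₃ s t || withNat (b + U + V) fun Z => logApart K W e N b X Y L Z cs)
        (T - s) s U) S 0 b) B X Y 0 1 1 0 []

@[simp] theorem withNat_eq {α : Type} (n : ℕ) (f : ℕ → α) : withNat n f = f n := by
  cases n <;> rfl

theorem cast_div_approx (n : ℕ) {d : ℕ} (hd : 0 < d) :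
    ((n / d : ℕ) : ℝ) ≤ n / d ∧ (n : ℝ) / d ≤ (n / d : ℕ) + 1 := by
  refine ⟨Nat.cast_div_le, ?_⟩
  rw [div_le_iff₀ (by positivity)]
  rw [mul_comm]
  exact_mod_cast (Nat.lt_mul_div_succ n hd).le

theorem artanhAux_approx {b R : ℕ} {ρ : ℝ} (hb : 0 < b) (h0 : 0 ≤ ρ) (h1 : ρ ≤ 1 / 2)
    (hR : (R : ℝ) ≤ b * ρ ^ 2) (hR' : b * ρ ^ 2 ≤ R + 2) (fuel k P : ℕ)
    (hP : (P : ℝ) ≤ b * ρ ^ (2 * k + 1)) (hP' : b * ρ ^ (2 * k + 1) ≤ P + 3) :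
    (artanhAux b R fuel k P : ℝ) ≤
        ∑ i ∈ range fuel, b * ρ ^ (2 * (k + i) + 1) / (2 * (k + i : ℕ) + 1) ∧
      ∑ i ∈ range fuel, b * ρ ^ (2 * (k + i) + 1) / (2 * (k + i : ℕ) + 1) ≤
        artanhAux b R fuel k P + 4 * fuel := by
  induction fuel generalizing k P with
  | zero => simp [artanhAux]
  | succ fuel ih =>
    have hρ2 : ρ ^ 2 ≤ 1 / 4 := by nlinarith
    cases P with
    | zero =>
      simp only [artanhAux, Nat.cast_zero, zero_add] at hP' ⊢
      constructor
      · positivity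
      · calc _ ≤ ∑ i ∈ range (fuel + 1), (4:ℝ) := by
              refine sum_le_sum fun i _ => ?_
              refine (div_le_self (by positivity)
                (by linarith [Nat.cast_nonneg (α := ℝ) (k + i)])).trans ?_
              have : ρ ^ (2 * (k + i) + 1) ≤ ρ ^ (2 * k + 1) :=
                pow_le_pow_of_le_one h0 (by linarith) (by omega)
              have : b * ρ ^ (2 * (k + i) + 1) ≤ b * ρ ^ (2 * k + 1) := by gcongr
              linarith
          _ = _ := by simp [mul_comm]
    | succ P =>
      simp only [artanhAux, withNat_eq]
      set Q := (P + 1) * R / b with hQ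
      have hb' : (0:ℝ) < b := by exact_mod_cast hb
      obtain ⟨q1, q2⟩ := cast_div_approx ((P + 1) * R) hb
      rw [← hQ] at q1 q2
      have hx : b * ρ ^ (2 * (k + 1) + 1) = (b * ρ ^ (2 * k + 1)) * (b * ρ ^ 2) / b := by
        field_simp
        ring
      have hPb : (P + 1 : ℝ) ≤ b / 2 := by
        push_cast at hP
        refine hP.trans ?_
        have : ρ ^ (2 * k + 1) ≤ ρ ^ 1 := pow_le_pow_of_le_one h0 (by linarith) (by omega)
        nlinarith
      push_cast at q1 q2 hP hP'
      have i1 : (Q : ℝ) ≤ b * ρ ^ (2 * (k + 1) + 1) := by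
        rw [hx]
        refine q1.trans ?_
        gcongr
      have i2 : b * ρ ^ (2 * (k + 1) + 1) ≤ Q + 3 := by
        have : b * ρ ^ (2 * (k + 1) + 1) ≤ ((P + 1 : ℝ) * R) / b + 2 := by
          rw [hx, div_add' _ _ _ hb'.ne']
          refine div_le_div_of_nonneg_right ?_ hb'.le
          calc b * ρ ^ (2 * k + 1) * (b * ρ ^ 2) ≤ ((P : ℝ) + 1 + 3) * (b * ρ ^ 2) := by gcongr
            _ ≤ ((P : ℝ) + 1) * R + 2 * b := by nlinarith
        linarith
      obtain ⟨j1, j2⟩ := ih (k + 1) Q i1 i2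
      obtain ⟨d1, d2⟩ := cast_div_approx (P + 1) (d := 2 * k + 1) (by omega)
      have d3 : ((P + 1 : ℕ) : ℝ) / (2 * k + 1 : ℕ) ≤ b * ρ ^ (2 * k + 1) / (2 * k + 1) := by
        push_cast
        gcongr
      have d4 : b * ρ ^ (2 * k + 1) / (2 * k + 1) ≤ ((P + 1 : ℕ) : ℝ) / (2 * k + 1 : ℕ) + 3 := by
        push_cast
        calc b * ρ ^ (2 * k + 1) / (2 * k + 1) ≤ (P + 1 + 3) / (2 * k + 1) := by gcongr
          _ = ((P : ℝ) + 1) / (2 * k + 1) + 3 / (2 * k + 1) := add_div _ _ _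
          _ ≤ _ := by
            gcongr
            exact div_le_self (by norm_num) (by linarith [Nat.cast_nonneg (α := ℝ) k])
      have hs : ∑ i ∈ range fuel, b * ρ ^ (2 * (k + (i + 1)) + 1) / (2 * (k + (i + 1) : ℕ) + 1) =
          ∑ i ∈ range fuel, b * ρ ^ (2 * (k + 1 + i) + 1) / (2 * (k + 1 + i : ℕ) + 1) :=
        sum_congr rfl fun i _ => by rw [show k + (i + 1) = k + 1 + i by ring]
      rw [sum_range_succ', hs, add_zero]
      push_cast at *
      constructor <;> linarith

theorem logFix_approx {b fuel Z : ℕ} (hb : 0 < b) (hfuel : b ≤ 4 ^ fuel) (h1 : b ≤ Z)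
    (h2 : Z ≤ 3 * b) :
    |b * Real.log (Z / b) - logFix b fuel Z| ≤ 8 * fuel + 2 := by
  have hb' : (0:ℝ) < b := by exact_mod_cast hb
  have h1' : (b:ℝ) ≤ Z := by exact_mod_cast h1
  have h2' : (Z:ℝ) ≤ 3 * b := by exact_mod_cast h2
  have hZb : (0:ℝ) < Z + b := by linarith
  set ρ : ℝ := (Z - b) / (Z + b) with hρ
  have r0 : 0 ≤ ρ := div_nonneg (by linarith) hZb.le
  have r1 : ρ ≤ 1 / 2 := by rw [hρ, div_le_iff₀ hZb]; linarith
  simp only [logFix, withNat_eq]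
  set R := b * (Z - b) / (Z + b) with hR
  obtain ⟨a1, a2⟩ := cast_div_approx (b * (Z - b)) (d := Z + b) (by omega)
  obtain ⟨c1, c2⟩ := cast_div_approx (R * R) hb
  rw [← hR] at a1 a2
  push_cast [Nat.cast_sub h1] at a1 a2 c1 c2
  rw [mul_div_assoc, ← hρ] at a1 a2
  have hsq : b * ρ ^ 2 = (b * ρ) * (b * ρ) / b := by field_simp
  have e1 : ((R * R / b : ℕ) : ℝ) ≤ b * ρ ^ 2 := by
    rw [hsq]
    refine c1.trans ?_
    gcongr
  have e2 : b * ρ ^ 2 ≤ (R * R / b : ℕ) + 2 := by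
    have : b * ρ ^ 2 ≤ (R : ℝ) * R / b + 1 := by
      rw [hsq, div_add' _ _ _ hb'.ne']
      refine div_le_div_of_nonneg_right ?_ hb'.le
      have : b * ρ ≤ b * (1 / 2) := by gcongr
      have : (0:ℝ) ≤ b * ρ := by positivity
      nlinarith [Nat.cast_nonneg (α := ℝ) R]
    linarith
  obtain ⟨s1, s2⟩ := artanhAux_approx hb r0 r1 e1 e2 fuel 0 R (by simpa using a1)
    (by simp; linarith)
  simp only [zero_add] at s1 s2
  have t1 := Real.sum_range_le_log_div r0 (by linarith) fuel
  have t2 := Real.log_div_le_sum_range_add r0 (by linarith) fuel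
  have hzb : (1 + ρ) / (1 - ρ) = Z / b := by
    rw [div_eq_div_iff (by linarith) hb'.ne', hρ]
    field_simp
    ring
  rw [hzb] at t1 t2
  have hsum : ∑ i ∈ range fuel, b * ρ ^ (2 * i + 1) / (2 * (i : ℝ) + 1) =
      b * ∑ i ∈ range fuel, ρ ^ (2 * i + 1) / (2 * i + 1) := by
    rw [mul_sum]
    exact sum_congr rfl fun i _ => mul_div_assoc _ _ _
  rw [hsum] at s1 s2
  have tail : b * (ρ ^ (2 * fuel + 1) / (1 - ρ ^ 2)) ≤ 1 := by
    have : ρ ^ 2 ≤ 1 / 4 := by nlinarith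
    have k1 : (b:ℝ) * ρ ^ (2 * fuel) ≤ 1 := by
      calc (b:ℝ) * ρ ^ (2 * fuel) ≤ 4 ^ fuel * (1 / 4) ^ fuel := by
            rw [pow_mul]
            gcongr
            exact_mod_cast hfuel
        _ = 1 := by rw [← mul_pow]; norm_num
    rw [← mul_div_assoc, div_le_one (by linarith), pow_succ, ← mul_assoc]
    have : (0:ℝ) ≤ b * ρ ^ (2 * fuel) := by positivity
    nlinarith
  have u1 := mul_le_mul_of_nonneg_left t1 hb'.le
  have u2 := mul_le_mul_of_nonneg_left t2 hb'.le
  rw [mul_add] at u2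
  push_cast
  rw [abs_le]
  constructor <;> linarith

theorem logFix_approx' {b fuel Z : ℕ} {z δ : ℝ} (hb : 0 < b) (hfuel : b ≤ 4 ^ fuel) (h1 : b ≤ Z)
    (h2 : Z ≤ 3 * b) (hz : 1 ≤ z) (hzZ : |Z - b * z| ≤ δ) :
    |b * Real.log z - logFix b fuel Z| ≤ 8 * fuel + 2 + δ := by
  have hb' : (0:ℝ) < b := by exact_mod_cast hb
  have hZ1 : (1:ℝ) ≤ Z / b := by rw [le_div_iff₀ hb']; simpa using h1
  have key : ∀ u v : ℝ, 1 ≤ u → 1 ≤ v → Real.log u - Real.log v ≤ |u - v| := by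
    intro u v hu hv
    rw [← Real.log_div (by linarith) (by linarith)]
    refine (Real.log_le_sub_one_of_pos (div_pos (by linarith) (by linarith))).trans ?_
    rw [div_sub_one (by linarith), div_le_iff₀ (by linarith)]
    exact (le_abs_self _).trans (le_mul_of_one_le_right (abs_nonneg _) hv)
  have hd : b * |Z / b - z| ≤ δ := by
    rw [← abs_of_pos hb', ← abs_mul, abs_of_pos hb', mul_sub, mul_div_cancel₀ _ hb'.ne']
    exact hzZ
  have k1 := mul_le_mul_of_nonneg_left (key _ _ hZ1 hz) hb'.le
  have k2 := mul_le_mul_of_nonneg_left (key _ _ hz hZ1) hb'.le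
  rw [abs_sub_comm z] at k2
  have := abs_le.1 (logFix_approx hb hfuel h1 h2)
  rw [abs_le]
  constructor <;> linarith

/-- Accuracy of the approximations supplied by `withConstants`. -/
structure FixedConstants (B b X Y L G : ℕ) : Prop where
  b_eq : b = 2 ^ B
  two : |b * Real.log 2 - X| ≤ 4 * B + 40
  phi : |b * Real.log Real.goldenRatio - Y| ≤ 4 * B + 40
  sqrt : |b * Real.log √5 - L| ≤ 4 * B + 40
  G_le : G ≤ b
  inv : |G - b * Real.goldenRatio⁻¹| ≤ 2

theorem two_pow_le_four_pow (B : ℕ) : 2 ^ B ≤ 4 ^ (B / 2 + 1) := by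
  rw [show (4:ℕ) = 2 ^ 2 by rfl, ← pow_mul]
  exact Nat.pow_le_pow_right (by norm_num) (by omega)

theorem fuel_bound (B : ℕ) : 8 * ((B / 2 + 1 : ℕ) : ℝ) ≤ 4 * B + 8 := by
  have : 8 * (B / 2 + 1) ≤ 4 * B + 8 := by omega
  exact_mod_cast this

theorem withConstants_spec {B : ℕ} (hB : 1 ≤ B) {f : ℕ → ℕ → ℕ → ℕ → ℕ → Bool}
    (h : withConstants B f = true) :
    ∃ b X Y L G, FixedConstants B b X Y L G ∧ f b X Y L G = true := by
  simp only [withConstants, withNat_eq, Bool.and_eq_true, decide_eq_true_eq] at h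
  generalize sqrtNewton 15 (5 * 2 ^ B * 2 ^ B) (3 * 2 ^ B) - 1 = D at h
  obtain ⟨⟨h1, h2⟩, hf⟩ := h
  refine ⟨_, _, _, _, _, ?_, hf⟩
  have hK := two_pow_le_four_pow B
  have hKf := fuel_bound B
  set b := 2 ^ B with hb
  have hb2 : 2 ≤ b := by
    calc 2 = 2 ^ 1 := rfl
      _ ≤ 2 ^ B := Nat.pow_le_pow_right (by norm_num) hB
  have hD3 : D ≤ 3 * b := by nlinarith
  have hDb : b ≤ D := by nlinarith
  have h5 : 0 ≤ √5 := Real.sqrt_nonneg 5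
  have hs5 : √5 * √5 = 5 := Real.mul_self_sqrt (by norm_num)
  have h51 : (1:ℝ) ≤ √5 := Real.le_sqrt_of_sq_le (by norm_num)
  have h1' : (D:ℝ) * D ≤ 5 * b * b := by exact_mod_cast h1
  have h2' : 5 * (b:ℝ) * b ≤ (D + 2) * (D + 2) := by exact_mod_cast h2
  have e1 : (D:ℝ) ≤ b * √5 := by
    refine (mul_self_le_mul_self_iff (by positivity) (by positivity)).2 ?_
    calc (D:ℝ) * D ≤ 5 * b * b := h1'
      _ = (√5 * √5) * b * b := by rw [hs5]
      _ = _ := by ring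
  have e2 : b * √5 ≤ D + 2 := by
    refine (mul_self_le_mul_self_iff (by positivity) (by positivity)).2 ?_
    calc b * √5 * (b * √5) = (√5 * √5) * b * b := by ring
      _ = 5 * b * b := by rw [hs5]
      _ ≤ _ := h2'
  have hT : 2 * ((b + D) / 2) ≤ b + D ∧ b + D ≤ 2 * ((b + D) / 2) + 1 := by omega
  set T := (b + D) / 2 with hTd
  obtain ⟨t1, t2⟩ := hT
  have t1' : 2 * (T:ℝ) ≤ b + D := by exact_mod_cast t1
  have t2' : (b:ℝ) + D ≤ 2 * T + 1 := by exact_mod_cast t2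
  have hTb : b ≤ T := by omega
  have hT2 : T ≤ 2 * b := by omega
  have hφ : b * Real.goldenRatio = (b + b * √5) / 2 := by rw [Real.goldenRatio]; ring
  refine ⟨rfl, ?_, ?_, ?_, by omega, ?_⟩
  · refine (logFix_approx' (by omega) hK (by omega) (by omega) (by norm_num)
      (δ := 0) ?_).trans (by linarith)
    push_cast
    rw [mul_comm, sub_self, abs_zero]
  · refine (logFix_approx' (by omega) hK hTb (by omega) Real.one_lt_goldenRatio.le
      (δ := 2) ?_).trans (by linarith)
    rw [hφ, abs_le]
    constructor <;> linarith
  · refine (logFix_approx' (by omega) hK hDb (by omega) h51 (δ := 2) ?_).trans (by linarith)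
    rw [abs_le]
    constructor <;> linarith
  · rw [Real.inv_goldenRatio, Nat.cast_sub hTb, show Real.goldenConj = 1 - Real.goldenRatio by
      linarith [Real.goldenRatio_add_goldenConj], mul_neg, mul_sub, hφ, abs_le]
    constructor <;> linarith

theorem withConvergents_spec {lo hi : ℕ} {cont : List (ℕ × ℕ) → Bool} {fuel u v p₀ q₀ p₁ q₁ : ℕ}
    {acc : List (ℕ × ℕ)} (h : withConvergents lo hi cont fuel u v p₀ q₀ p₁ q₁ acc = true) :
    ∃ l, cont l = true := by
  induction fuel generalizing u v p₀ q₀ p₁ q₁ acc with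
  | zero => exact ⟨_, h⟩
  | succ fuel ih =>
    simp only [withConvergents, withNat_eq, Bool.cond_eq_ite] at h
    split_ifs at h
    · exact ⟨_, h⟩
    · exact ih h
    · exact ih h

theorem abs_natSub_add_natSub (u v : ℕ) : (((u - v) + (v - u) : ℕ) : ℝ) = |(u:ℝ) - v| := by
  rcases le_total u v with h | h
  · rw [Nat.sub_eq_zero_of_le h, zero_add, Nat.cast_sub h, abs_sub_comm,
      abs_of_nonneg (sub_nonneg.2 (by exact_mod_cast h))]
  · rw [Nat.sub_eq_zero_of_le h, add_zero, Nat.cast_sub h,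
      abs_of_nonneg (sub_nonneg.2 (by exact_mod_cast h))]

theorem apart_spec {W e N X Y Z : ℕ} {c : ℕ × ℕ} (h : apart W e N X Y Z c = true) {b x y μ : ℝ}
    (hx : |b * x - X| ≤ e) (hy : |b * y - Y| ≤ e) (hμ : |b * μ - Z| ≤ 3 * e) (hb : 0 < b)
    {a n : ℤ} (ha : |(a:ℝ)| ≤ N) (hn : |(n:ℝ)| ≤ N) : W ≤ b * |a * x + μ - n * y| := by
  obtain ⟨p, q⟩ := c
  simp only [apart, withNat_eq, Bool.and_eq_true, Nat.ble_eq] at h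
  obtain ⟨⟨hq, h1⟩, h2⟩ := h
  have hq' : (0:ℝ) < q := by exact_mod_cast hq
  have hdm := Nat.div_add_mod (q * Z) Y
  set r := q * Z % Y
  set d := q * Z / Y
  have h1' : (W:ℝ) * q + N * |(q:ℝ) * X - p * Y| + q * (e * (2 * N + 3)) ≤ r := by
    have := (Nat.cast_le (α := ℝ)).2 h1
    push_cast [-Nat.cast_sub] at this
    rw [← Nat.cast_add, abs_natSub_add_natSub] at this
    push_cast at this
    exact this
  have h2' : (W:ℝ) * q + N * |(q:ℝ) * X - p * Y| + q * (e * (2 * N + 3)) + r ≤ Y := by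
    have := (Nat.cast_le (α := ℝ)).2 h2
    push_cast [-Nat.cast_sub] at this
    rw [← Nat.cast_add (q * X - p * Y), abs_natSub_add_natSub] at this
    push_cast at this
    exact this
  have hdm' : (Y:ℝ) * d + r = q * Z := by exact_mod_cast hdm
  set w : ℤ := a * p - n * q + d with hw
  have hkey : (W:ℝ) * q + N * |(q:ℝ) * X - p * Y| + q * (e * (2 * N + 3)) ≤ |(w:ℝ) * Y + r| := by
    rcases le_or_gt 0 w with h0 | h0
    · have : (0:ℝ) ≤ w := by exact_mod_cast h0
      have : (0:ℝ) ≤ w * Y := by positivity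
      exact h1'.trans ((by linarith : (r:ℝ) ≤ w * Y + r).trans (le_abs_self _))
    · have : (w:ℝ) ≤ -1 := by exact_mod_cast Int.le_sub_one_of_lt h0
      have : (w:ℝ) * Y ≤ -1 * Y := by gcongr
      refine le_trans ?_ (neg_le_abs _)
      linarith
  have hid : (w:ℝ) * Y + r = q * (b * (a * x + μ - n * y)) - a * (q * X - p * Y) -
      q * (a * (b * x - X) - n * (b * y - Y) + (b * μ - Z)) := by
    rw [hw]
    push_cast
    linear_combination hdm'
  have hE : |a * (b * x - X) - n * (b * y - Y) + (b * μ - Z)| ≤ e * (2 * N + 3) := by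
    calc _ ≤ |a * (b * x - X)| + |n * (b * y - Y)| + |b * μ - Z| :=
          (abs_add_le _ _).trans (by gcongr; exact abs_sub _ _)
      _ ≤ N * e + N * e + 3 * e := by
          rw [abs_mul, abs_mul]
          gcongr
      _ = _ := by ring
  have : q * (W:ℝ) ≤ q * (b * |a * x + μ - n * y|) := by
    have h3 : |(w:ℝ) * Y + r| ≤ q * (b * |a * x + μ - n * y|) + N * |(q:ℝ) * X - p * Y| +
        q * (e * (2 * N + 3)) := by
      rw [hid]
      calc _ ≤ |q * (b * (a * x + μ - n * y))| + |(a:ℝ) * (q * X - p * Y)| +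
            |q * (a * (b * x - X) - n * (b * y - Y) + (b * μ - Z))| :=
            (abs_sub _ _).trans (by gcongr; exact abs_sub _ _)
        _ ≤ _ := by
          rw [abs_mul, abs_mul, abs_mul (a:ℝ), abs_mul (q:ℝ), abs_of_pos hq', abs_of_pos hb]
          gcongr
    linarith
  exact le_of_mul_le_mul_left this hq'

theorem apart₀_spec {W e N X Y : ℕ} {c : ℕ × ℕ} (h : apart₀ W e N X Y c = true) {b x y : ℝ}
    (hx : |b * x - X| ≤ e) (hy : |b * y - Y| ≤ e) (hb : 0 < b)
    {a n : ℤ} (ha₀ : 0 < a) (ha : a ≤ N) (hn : |(n:ℝ)| ≤ N) : W ≤ b * |a * x - n * y| := by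
  obtain ⟨p, q⟩ := c
  simp only [apart₀, Bool.and_eq_true, Nat.ble_eq, Nat.beq_eq] at h
  obtain ⟨⟨hq, hg⟩, h1⟩ := h
  have hq' : (0:ℝ) < q := by exact_mod_cast (by omega : 0 < q)
  have ha' : |(a:ℝ)| ≤ N := by
    rw [abs_of_pos (by exact_mod_cast ha₀)]
    exact_mod_cast ha
  have h1' : (W:ℝ) * q + N * |(q:ℝ) * X - p * Y| + q * (e * (2 * N)) ≤ Y := by
    have := (Nat.cast_le (α := ℝ)).2 h1
    push_cast [-Nat.cast_sub] at this
    rw [← Nat.cast_add, abs_natSub_add_natSub] at this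
    push_cast at this
    exact this
  set w : ℤ := a * p - n * q with hw
  have hw0 : w ≠ 0 := by
    intro h0
    have hd : (q:ℤ) ∣ a * p := ⟨n, by linarith⟩
    have hc : IsCoprime (q:ℤ) p := by
      rw [Nat.isCoprime_iff_coprime, Nat.coprime_comm]
      exact hg
    have := Int.le_of_dvd ha₀ (hc.dvd_of_dvd_mul_right hd)
    omega
  have hkey : (Y:ℝ) ≤ |(w:ℝ) * Y| := by
    rw [abs_mul, abs_of_nonneg (show (0:ℝ) ≤ Y from Nat.cast_nonneg Y)]
    refine le_mul_of_one_le_left (Nat.cast_nonneg Y) ?_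
    exact_mod_cast Int.one_le_abs hw0
  have hid : (w:ℝ) * Y = q * (b * (a * x - n * y)) - a * (q * X - p * Y) -
      q * (a * (b * x - X) - n * (b * y - Y)) := by
    rw [hw]
    push_cast
    ring
  have hE : |a * (b * x - X) - n * (b * y - Y)| ≤ e * (2 * N) := by
    calc _ ≤ |a * (b * x - X)| + |n * (b * y - Y)| := abs_sub _ _
      _ ≤ N * e + N * e := by
          rw [abs_mul, abs_mul]
          gcongr
      _ = _ := by ring
  have : q * (W:ℝ) ≤ q * (b * |a * x - n * y|) := by
    have h3 : |(w:ℝ) * Y| ≤ q * (b * |a * x - n * y|) + N * |(q:ℝ) * X - p * Y| +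
        q * (e * (2 * N)) := by
      rw [hid]
      calc _ ≤ |q * (b * (a * x - n * y))| + |(a:ℝ) * (q * X - p * Y)| +
            |q * (a * (b * x - X) - n * (b * y - Y))| :=
            (abs_sub _ _).trans (by gcongr; exact abs_sub _ _)
        _ ≤ _ := by
          rw [abs_mul, abs_mul, abs_mul (a:ℝ), abs_mul (q:ℝ), abs_of_pos hq', abs_of_pos hb]
          gcongr
    linarith
  exact le_of_mul_le_mul_left this hq'

theorem allPowers_spec {b G : ℕ} {f : ℕ → ℕ → Bool} (hb : 0 < b) (hG : G ≤ b)
    (hG' : |G - b * Real.goldenRatio⁻¹| ≤ 2) {fuel s U : ℕ}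
    (h : allPowers b G f fuel s U = true) (hU : U ≤ b)
    (hU' : |U - b * Real.goldenRatio⁻¹ ^ s| ≤ 8) {j : ℕ} (hj : s ≤ j) (hj' : j < s + fuel) :
    ∃ V : ℕ, V ≤ b ∧ |V - b * Real.goldenRatio⁻¹ ^ j| ≤ 8 ∧ f j V = true := by
  induction fuel generalizing s U with
  | zero => omega
  | succ fuel ih =>
    simp only [allPowers, withNat_eq, Bool.and_eq_true] at h
    rcases hj.eq_or_lt with rfl | hlt
    · exact ⟨U, hU, hU', h.1⟩
    · have hb' : (0:ℝ) < b := by exact_mod_cast hb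
      have hφ : Real.goldenRatio⁻¹ ≤ 5 / 8 := by
        rw [Real.inv_goldenRatio, Real.goldenConj]
        have : √5 ≤ 9 / 4 := by rw [Real.sqrt_le_left (by norm_num)]; norm_num
        linarith
      have hφ0 : 0 < Real.goldenRatio⁻¹ := by positivity
      refine ih h.2 ?_ ?_ hlt (by omega)
      · exact Nat.div_le_of_le_mul ((Nat.mul_comm _ _).trans_le (Nat.mul_le_mul hG hU))
      · obtain ⟨d1, d2⟩ := cast_div_approx (U * G) hb
        have hU1 : (U:ℝ) / b ≤ 1 := by rw [div_le_one hb']; exact_mod_cast hU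
        have hid : ((U * G : ℕ) : ℝ) / b - b * Real.goldenRatio⁻¹ ^ (s + 1) =
            (U - b * Real.goldenRatio⁻¹ ^ s) * Real.goldenRatio⁻¹ +
            U / b * (G - b * Real.goldenRatio⁻¹) := by
          push_cast
          generalize Real.goldenRatio⁻¹ = ψ
          field_simp
          ring
        have hE : |((U * G : ℕ) : ℝ) / b - b * Real.goldenRatio⁻¹ ^ (s + 1)| ≤ 7 := by
          rw [hid]
          calc _ ≤ |(U - b * Real.goldenRatio⁻¹ ^ s) * Real.goldenRatio⁻¹| +
                |U / b * (G - b * Real.goldenRatio⁻¹)| := abs_add_le _ _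
            _ ≤ 8 * (5 / 8) + 1 * 2 := by
              rw [abs_mul, abs_mul, abs_of_pos hφ0,
                abs_of_nonneg (show (0:ℝ) ≤ U / b by positivity)]
              gcongr
            _ = 7 := by norm_num
        obtain ⟨e1, e2⟩ := abs_le.1 hE
        rw [abs_le]
        constructor <;> linarith

theorem isHomogeneous₂_spec {s : ℕ} (h : isHomogeneous₂ s = true) :
    ∃ i j : ℕ, i ≤ 1 ∧ j ≤ 3 ∧
      √5 * 2 ^ i = Real.goldenRatio ^ j * (1 + Real.goldenRatio⁻¹ ^ s) := by
  have h5 : √5 = 1 + 2 * Real.goldenRatio⁻¹ := by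
    rw [Real.inv_goldenRatio, Real.goldenConj]; ring
  have hφ : Real.goldenRatio = 1 + Real.goldenRatio⁻¹ := by
    rw [Real.inv_goldenRatio]; linarith [Real.goldenRatio_add_goldenConj]
  have hψ : Real.goldenRatio⁻¹ ^ 2 = 1 - Real.goldenRatio⁻¹ := by
    rw [Real.inv_goldenRatio]; linarith [Real.goldenConj_sq]
  simp only [isHomogeneous₂, Bool.or_eq_true, Nat.beq_eq] at h
  suffices ∃ i j : ℕ, i ≤ 1 ∧ j ≤ 3 ∧ (1 + 2 * Real.goldenRatio⁻¹) * 2 ^ i =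
      (1 + Real.goldenRatio⁻¹) ^ j * (1 + Real.goldenRatio⁻¹ ^ s) by
    rwa [← h5, ← hφ] at this
  clear h5 hφ
  generalize Real.goldenRatio⁻¹ = ψ at hψ
  rcases h with rfl | rfl
  · exact ⟨0, 1, by grind⟩
  · exact ⟨1, 3, by grind⟩

theorem isHomogeneous₃_spec {s t : ℕ} (h : isHomogeneous₃ s t = true) :
    ∃ i j : ℕ, i ≤ 1 ∧ j ≤ 3 ∧ √5 * 2 ^ i =
      Real.goldenRatio ^ j * (1 + Real.goldenRatio⁻¹ ^ s + Real.goldenRatio⁻¹ ^ t) := by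
  have h5 : √5 = 1 + 2 * Real.goldenRatio⁻¹ := by
    rw [Real.inv_goldenRatio, Real.goldenConj]; ring
  have hφ : Real.goldenRatio = 1 + Real.goldenRatio⁻¹ := by
    rw [Real.inv_goldenRatio]; linarith [Real.goldenRatio_add_goldenConj]
  have hψ : Real.goldenRatio⁻¹ ^ 2 = 1 - Real.goldenRatio⁻¹ := by
    rw [Real.inv_goldenRatio]; linarith [Real.goldenConj_sq]
  suffices ∃ i j : ℕ, i ≤ 1 ∧ j ≤ 3 ∧ (1 + 2 * Real.goldenRatio⁻¹) * 2 ^ i =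
      (1 + Real.goldenRatio⁻¹) ^ j * (1 + Real.goldenRatio⁻¹ ^ s + Real.goldenRatio⁻¹ ^ t) by
    rwa [← h5, ← hφ] at this
  clear h5 hφ
  generalize Real.goldenRatio⁻¹ = ψ at hψ
  unfold isHomogeneous₃ at h
  split at h <;> simp only [Bool.or_eq_true, Nat.beq_eq, Bool.false_eq_true] at h
  · subst h
    exact ⟨0, 0, by grind⟩
  · rcases h with rfl | rfl
    · exact ⟨0, 0, by grind⟩
    · exact ⟨1, 2, by grind⟩
  · subst h
    exact ⟨0, 1, by grind⟩
  · subst h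
    exact ⟨1, 3, by grind⟩

theorem half_pow_le_of_two_pow_le {B k : ℕ} {x : ℝ} (hk : k ≤ B)
    (h : ((2 ^ (B - k) : ℕ) : ℝ) ≤ ((2 ^ B : ℕ) : ℝ) * x) : (1 / 2 : ℝ) ^ k ≤ x := by
  push_cast at h
  rw [← pow_mul_pow_sub (2:ℝ) hk] at h
  rw [one_div_pow, div_le_iff₀ (by positivity)]
  exact le_of_mul_le_mul_left (by linarith) (by positivity : (0:ℝ) < 2 ^ (B - k))

namespace FixedConstants

variable {B b X Y L G : ℕ}

theorem pos (H : FixedConstants B b X Y L G) : 0 < b := H.b_eq ▸ Nat.two_pow_pos B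

theorem half_pow_le_of_apart (H : FixedConstants B b X Y L G) {k N a n : ℕ} (hk : k ≤ B)
    (ha : a ≤ N) (hn : n ≤ N) {cs : List (ℕ × ℕ)}
    (h : cs.any (apart (2 ^ (B - k)) (4 * B + 40) N X Y L) = true) :
    (1 / 2 : ℝ) ^ k ≤ |a * Real.log 2 + Real.log √5 - n * Real.log Real.goldenRatio| := by
  obtain ⟨c, -, hc⟩ := List.any_eq_true.1 h
  refine half_pow_le_of_two_pow_le hk ?_
  have hL := H.sqrt
  have := apart_spec (a := a) (n := n) hc (b := b) (x := Real.log 2)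
    (y := Real.log Real.goldenRatio) (μ := Real.log √5) (by simpa using H.two)
    (by simpa using H.phi) (by push_cast; exact hL.trans (by linarith [Nat.cast_nonneg (α := ℝ) B]))
    (by exact_mod_cast H.pos) (by simpa using ha) (by simpa using hn)
  rw [← H.b_eq]
  simpa using this

theorem half_pow_le_of_logApart (H : FixedConstants B b X Y L G) {k N a n Z : ℕ} (hk : k ≤ B)
    (ha₀ : 1 ≤ a) (ha : a ≤ N) (hn : n ≤ N) {cs : List (ℕ × ℕ)} {z : ℝ}
    (hZ : b ≤ Z) (hZ' : Z ≤ 3 * b) (hz : 1 ≤ z) (hzZ : |Z - b * z| ≤ 16)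
    (h : logApart (B / 2 + 1) (2 ^ (B - k)) (4 * B + 40) N b X Y L Z cs = true) :
    (1 / 2 : ℝ) ^ k ≤ |a * Real.log 2 + Real.log √5 -
      (n * Real.log Real.goldenRatio + Real.log z)| := by
  simp only [logApart, withNat_eq, Bool.and_eq_true, Nat.ble_eq] at h
  obtain ⟨hle, h⟩ := h
  obtain ⟨c, -, hc⟩ := List.any_eq_true.1 h
  refine half_pow_le_of_two_pow_le hk ?_
  have hg := logFix_approx' H.pos (H.b_eq ▸ two_pow_le_four_pow B) hZ hZ' hz hzZ
  have hf := fuel_bound B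
  have := apart_spec (a := a - 1) (n := n) hc (b := b) (x := Real.log 2)
    (y := Real.log Real.goldenRatio) (μ := Real.log √5 + Real.log 2 - Real.log z)
    (by simpa using H.two) (by simpa using H.phi) (by
      obtain ⟨a1, a2⟩ := abs_le.1 H.two
      obtain ⟨b1, b2⟩ := abs_le.1 H.sqrt
      obtain ⟨c1, c2⟩ := abs_le.1 hg
      rw [Nat.cast_sub hle, abs_le]
      push_cast at *
      constructor <;> linarith)
    (by exact_mod_cast H.pos) (by
      have h1 : (1:ℝ) ≤ a := by exact_mod_cast ha₀
      have h2 : (a:ℝ) ≤ N := by exact_mod_cast ha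
      push_cast
      rw [abs_of_nonneg (by linarith)]
      linarith) (by simpa using hn)
  rw [← H.b_eq]
  refine this.trans_eq ?_
  push_cast
  congr 2
  ring

theorem half_pow_le_of_homogeneous (H : FixedConstants B b X Y L G) {k N a n i j : ℕ}
    (hk : k ≤ B) (hN : 3 ≤ N) (ha₀ : 2 ≤ a) (ha : a ≤ N) (hn : n ≤ N) {cs : List (ℕ × ℕ)} {z : ℝ}
    (hz : 0 < z) (hi : i ≤ 1) (hj : j ≤ 3) (hij : √5 * 2 ^ i = Real.goldenRatio ^ j * z)
    (h : cs.any (apart₀ (2 ^ (B - k)) (4 * B + 40) N X Y) = true) :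
    (1 / 2 : ℝ) ^ k ≤ |a * Real.log 2 + Real.log √5 -
      (n * Real.log Real.goldenRatio + Real.log z)| := by
  obtain ⟨c, -, hc⟩ := List.any_eq_true.1 h
  refine half_pow_le_of_two_pow_le hk ?_
  have hlog := congrArg Real.log hij
  rw [Real.log_mul (by positivity) (by positivity), Real.log_mul (by positivity) hz.ne',
    Real.log_pow, Real.log_pow] at hlog
  have := apart₀_spec (a := (a:ℤ) - i) (n := (n:ℤ) - j) hc (b := b) (x := Real.log 2)
    (y := Real.log Real.goldenRatio) (by simpa using H.two) (by simpa using H.phi)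
    (by exact_mod_cast H.pos) (by omega) (by omega) (by
      have : |(n:ℤ) - j| ≤ N := by rw [abs_le]; omega
      exact_mod_cast this)
  rw [← H.b_eq]
  refine this.trans_eq ?_
  push_cast
  congr 2
  linarith

end FixedConstants

theorem round₁_spec {B N k : ℕ} (hk : k ≤ B) (hk₁ : 1 ≤ k) (h : round₁ B N k = true) {a n : ℕ}
    (ha : a ≤ N) (hn : n ≤ N) :
    (1 / 2 : ℝ) ^ k ≤ |a * Real.log 2 + Real.log √5 - n * Real.log Real.goldenRatio| := by
  obtain ⟨b, X, Y, L, G, H, h⟩ := withConstants_spec (by omega) h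
  obtain ⟨cs, h⟩ := withConvergents_spec h
  exact H.half_pow_le_of_apart hk ha hn h

theorem round₂_spec {B N k S : ℕ} (hk : k ≤ B) (hk₁ : 1 ≤ k) (hN : 3 ≤ N)
    (h : round₂ B N k S = true) {a n s : ℕ} (ha₀ : 2 ≤ a) (ha : a ≤ N) (hn : n ≤ N) (hs : s < S) :
    (1 / 2 : ℝ) ^ k ≤ |a * Real.log 2 + Real.log √5 -
      (n * Real.log Real.goldenRatio + Real.log (1 + Real.goldenRatio⁻¹ ^ s))| := by
  obtain ⟨b, X, Y, L, G, H, h⟩ := withConstants_spec (by omega) h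
  obtain ⟨cs, h⟩ := withConvergents_spec h
  simp only [withNat_eq, Bool.and_eq_true] at h
  obtain ⟨U, hU, hU', h'⟩ := allPowers_spec H.pos H.G_le H.inv h.2 le_rfl (by simp)
    (Nat.zero_le s) (by omega)
  have hp : 0 < Real.goldenRatio⁻¹ ^ s := by positivity
  simp only [Bool.or_eq_true] at h'
  rcases h' with h' | h'
  · obtain ⟨i, j, hi, hj, hij⟩ := isHomogeneous₂_spec h'
    exact H.half_pow_le_of_homogeneous hk hN ha₀ ha hn (by positivity) hi hj hij h.1
  · refine H.half_pow_le_of_logApart hk (by omega) ha hn (by omega) (by omega) (by linarith) ?_ h'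
    obtain ⟨u1, u2⟩ := abs_le.1 hU'
    push_cast
    rw [mul_add, abs_le]
    constructor <;> linarith

theorem round₃_spec {B N k S T : ℕ} (hk : k ≤ B) (hk₁ : 1 ≤ k) (hN : 3 ≤ N)
    (h : round₃ B N k S T = true) {a n s t : ℕ} (ha₀ : 2 ≤ a) (ha : a ≤ N) (hn : n ≤ N)
    (hs : s < S) (hst : s ≤ t) (ht : t < T) :
    (1 / 2 : ℝ) ^ k ≤ |a * Real.log 2 + Real.log √5 - (n * Real.log Real.goldenRatio +
      Real.log (1 + Real.goldenRatio⁻¹ ^ s + Real.goldenRatio⁻¹ ^ t))| := by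
  obtain ⟨b, X, Y, L, G, H, h⟩ := withConstants_spec (by omega) h
  obtain ⟨cs, h⟩ := withConvergents_spec h
  simp only [withNat_eq, Bool.and_eq_true] at h
  obtain ⟨U, hU, hU', h'⟩ := allPowers_spec H.pos H.G_le H.inv h.2 le_rfl (by simp)
    (Nat.zero_le s) (by omega)
  obtain ⟨V, hV, hV', h'⟩ := allPowers_spec H.pos H.G_le H.inv h' hU hU' hst (by omega)
  have hp : 0 < Real.goldenRatio⁻¹ ^ s := by positivity
  have hq : 0 < Real.goldenRatio⁻¹ ^ t := by positivity
  simp only [Bool.or_eq_true] at h'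
  rcases h' with h' | h'
  · obtain ⟨i, j, hi, hj, hij⟩ := isHomogeneous₃_spec h'
    exact H.half_pow_le_of_homogeneous hk hN ha₀ ha hn (by positivity) hi hj hij h.1
  · refine H.half_pow_le_of_logApart hk (by omega) ha hn (by omega) (by omega) (by linarith) ?_ h'
    obtain ⟨u1, u2⟩ := abs_le.1 hU'
    obtain ⟨v1, v2⟩ := abs_le.1 hV'
    push_cast
    rw [mul_add, mul_add, abs_le]
    constructor <;> linarith

namespace CloseToTwoPow

variable {n m l a : ℕ}

theorem goldenRatio_pow_mul_inv_pow {n m : ℕ} (h : m ≤ n) :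
    Real.goldenRatio ^ n * Real.goldenRatio⁻¹ ^ (n - m) = Real.goldenRatio ^ m := by
  rw [← pow_mul_pow_sub Real.goldenRatio h, mul_assoc, ← mul_pow,
    mul_inv_cancel₀ Real.goldenRatio_ne_zero, one_pow, mul_one]

theorem lt_or_nine_mul_sub_lt₁ (H : CloseToTwoPow n m l a) (hn : 100 ≤ n) {B N k : ℕ}
    (hnN : n ≤ N) (hk : k ≤ B) (hk₁ : 1 ≤ k) (h : round₁ B N k = true) :
    a < 2 * (k + 4) ∨ 9 * (n - m) < 13 * (k + 4) := by
  by_contra! hc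
  have h4 := H.four_mul_le hn
  exact ((round₁_spec hk hk₁ h (a := a) (by omega) hnN).trans_lt
    (H.log_form₁ hn (by omega) hc.2)).false

theorem lt_or_nine_mul_sub_lt₂ (H : CloseToTwoPow n m l a) (hn : 100 ≤ n) {B N k S : ℕ}
    (hnN : n ≤ N) (hk : k ≤ B) (hk₁ : 1 ≤ k) (h : round₂ B N k S = true) (hs : n - m < S) :
    a < 2 * (k + 4) ∨ 9 * (n - l) < 13 * (k + 4) := by
  by_contra! hc
  have h4 := H.four_mul_le hn
  have h9 := H.nine_mul_lt
  have h1 := H.log_form₂ hn (by omega) hc.2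
  have h2 := round₂_spec hk hk₁ (by omega) h (a := a) (by omega) (by omega) hnN hs
  rw [← goldenRatio_pow_mul_inv_pow H.le₁, ← mul_one_add,
    Real.log_mul (by positivity) (by positivity), Real.log_pow] at h1
  exact (h2.trans_lt h1).false

theorem lt_of_round₃ (H : CloseToTwoPow n m l a) (hn : 100 ≤ n) {B N k S T : ℕ}
    (hnN : n ≤ N) (hk : k ≤ B) (hk₁ : 1 ≤ k) (h : round₃ B N k S T = true) (hs : n - m < S)
    (ht : n - l < T) : a < 2 * (k + 3) := by
  by_contra! hc
  have h4 := H.four_mul_le hn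
  have h9 := H.nine_mul_lt
  have hle := H.le₂
  have h1 := H.log_form₃ hn (k := k) (by omega)
  have h2 := round₃_spec hk hk₁ (by omega) h (a := a) (by omega) (by omega) hnN hs (by omega) ht
  rw [← goldenRatio_pow_mul_inv_pow H.le₁, ← goldenRatio_pow_mul_inv_pow (hle.trans H.le₁),
    ← mul_one_add, ← mul_add, Real.log_mul (by positivity) (by positivity), Real.log_pow] at h1
  exact (h2.trans_lt h1).false

set_option exponentiation.threshold 600 in
theorem n_lt_two_pow_250 (H : CloseToTwoPow n m l a) (hn : 100 ≤ n) : n < 2 ^ 250 := by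
  have h0 := H.n_lt hn
  have h1 := H.lt_or_nine_mul_sub_lt₁ hn (B := 1250) (N := 2 ^ 594) (k := 603) h0.le
    (by norm_num) (by norm_num) (by decide +kernel)
  have h2 := H.m_lt_or_lt hn
  have h9 := H.nine_mul_lt
  have hle := H.le₁
  omega

theorem n_lt_two_pow_82 (H : CloseToTwoPow n m l a) (hn : 100 ≤ n) : n < 2 ^ 82 := by
  have h0 := H.n_lt_two_pow_250 hn
  have h9 := H.nine_mul_lt
  have h1 := H.lt_or_nine_mul_sub_lt₁ hn (B := 560) (N := 2 ^ 250) (k := 260) h0.le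
    (by norm_num) (by norm_num) (by decide +kernel)
  by_contra! hc
  have h2 := H.lt_or_nine_mul_sub_lt₂ hn (B := 560) (N := 2 ^ 250) (k := 265) (S := 382) h0.le
    (by norm_num) (by norm_num) (by decide +kernel) (by omega)
  have h3 := H.l_lt_or_lt hn
  have hle := H.le₁
  have hle' := H.le₂
  omega

theorem n_lt_330 (H : CloseToTwoPow n m l a) (hn : 100 ≤ n) : n < 330 := by
  have h0 := H.n_lt_two_pow_82 hn
  have h9 := H.nine_mul_lt
  by_contra! hc
  have h1 := H.lt_or_nine_mul_sub_lt₁ hn (B := 230) (N := 2 ^ 82) (k := 89) h0.le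
    (by norm_num) (by norm_num) (by decide +kernel)
  have h2 := H.lt_or_nine_mul_sub_lt₂ hn (B := 230) (N := 2 ^ 82) (k := 94) (S := 135) h0.le
    (by norm_num) (by norm_num) (by decide +kernel) (by omega)
  have h3 := H.lt_of_round₃ hn (B := 230) (N := 2 ^ 82) (k := 102) (S := 135) (T := 142) h0.le
    (by norm_num) (by norm_num) (by decide +kernel) (by omega) (by omega)
  omega

theorem n_lt_100 (H : CloseToTwoPow n m l a) : n < 100 := by
  by_contra! hn
  have h0 := H.n_lt_330 hn
  have h9 := H.nine_mul_lt
  have h1 := H.lt_or_nine_mul_sub_lt₁ hn (B := 64) (N := 330) (k := 13) h0.le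
    (by norm_num) (by norm_num) (by decide +kernel)
  have h2 := H.lt_or_nine_mul_sub_lt₂ hn (B := 64) (N := 330) (k := 16) (S := 25) h0.le
    (by norm_num) (by norm_num) (by decide +kernel) (by omega)
  have h3 := H.lt_of_round₃ hn (B := 64) (N := 330) (k := 25) (S := 25) (T := 29) h0.le
    (by norm_num) (by norm_num) (by decide +kernel) (by omega) (by omega)
  omega

end CloseToTwoPow

/-- Checks `f` at `fuel` consecutive indices from `i` on, along with the Fibonacci numbers at these
indices; `u` and `v` are the first two of them. -/
def allFib (f : ℕ → ℕ → Bool) : ℕ → ℕ → ℕ → ℕ → Bool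
  | 0, _, _, _ => true
  | fuel + 1, i, u, v => f i u && withNat (i + 1) fun i₂ => withNat (u + v) fun w =>
      allFib f fuel i₂ v w

theorem allFib_spec {f : ℕ → ℕ → Bool} {fuel i j : ℕ}
    (h : allFib f fuel i (Nat.fib i) (Nat.fib (i + 1)) = true) (hj : i ≤ j) (hj' : j < i + fuel) :
    f j (Nat.fib j) = true := by
  induction fuel generalizing i with
  | zero => omega
  | succ fuel ih =>
    simp only [allFib, withNat_eq, Bool.and_eq_true, ← Nat.fib_add_two] at h
    rcases hj.eq_or_lt with rfl | hlt
    · exact h.1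
    · exact ih h.2 hlt (by omega)

/-- Every sum of three Fibonacci numbers of index below `100` that is close to `2 ^ a` has largest
index at most `42` and `a ≤ 28`. -/
def smallSolutionsBounded (a : ℕ) : Bool :=
  withNat (2 ^ a) fun A => withNat (2 ^ ((a + 1) / 2)) fun T =>
  allFib (fun n x => Nat.ble (A + T) x || Nat.ble (3 * x + T) A ||
    allFib (fun _ y => Nat.ble (A + T) (x + y) || Nat.ble (x + 2 * y + T) A ||
      allFib (fun _ z => (Nat.ble n 42 && Nat.ble a 28) || withNat (x + y + z) fun S =>
        Nat.ble A (((S - A) + (A - S)) ^ 2)) 100 0 0 1) 100 0 0 1) 100 0 0 1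

theorem bounded_of_smallSolutionsBounded {n m l a : ℕ} (h : smallSolutionsBounded a = true)
    (hn : n < 100) (hmn : m ≤ n) (hlm : l ≤ m)
    (hd : ((Nat.fib n + Nat.fib m + Nat.fib l - 2 ^ a) +
      (2 ^ a - (Nat.fib n + Nat.fib m + Nat.fib l))) ^ 2 < 2 ^ a) : n ≤ 42 ∧ a ≤ 28 := by
  have hT : (Nat.fib n + Nat.fib m + Nat.fib l - 2 ^ a) +
      (2 ^ a - (Nat.fib n + Nat.fib m + Nat.fib l)) < 2 ^ ((a + 1) / 2) := by
    refine lt_of_pow_lt_pow_left₀ 2 (by positivity) (hd.trans_le ?_)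
    rw [← pow_mul]
    exact Nat.pow_le_pow_right (by norm_num) (by omega)
  have f1 := Nat.fib_mono hmn
  have f2 := Nat.fib_mono hlm
  simp only [smallSolutionsBounded, withNat_eq] at h
  have h1 := allFib_spec h (Nat.zero_le n) (by omega)
  simp only [Bool.or_eq_true, Nat.ble_eq] at h1
  rcases h1 with (h1 | h1) | h1
  · omega
  · omega
  have h2 := allFib_spec h1 (Nat.zero_le m) (by omega)
  simp only [Bool.or_eq_true, Nat.ble_eq] at h2
  rcases h2 with (h2 | h2) | h2
  · omega
  · omega
  have h3 := allFib_spec h2 (Nat.zero_le l) (by omega)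
  simp only [Bool.or_eq_true, Bool.and_eq_true, Nat.ble_eq] at h3
  exact h3.resolve_right (by omega)

theorem sums_of_three_fib_close_to_pow_two
    (n m l a : ℕ) (hn : 0 < n) (hm : 0 < m) (hl : 0 < l) (ha : 0 < a)
    (hnm : m ≤ n) (hml : l ≤ m)
    (h : |(Nat.fib n : ℝ) + Nat.fib m + Nat.fib l - 2 ^ a| < (2 : ℝ) ^ ((a : ℝ) / 2)) :
    n ≤ 42 ∧ a ≤ 28 := by
  have hn100 := (CloseToTwoPow.mk hl hnm hml h).n_lt_100
  have hd : ((Nat.fib n + Nat.fib m + Nat.fib l - 2 ^ a) +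
      (2 ^ a - (Nat.fib n + Nat.fib m + Nat.fib l))) ^ 2 < 2 ^ a := by
    have h2 : ((2:ℝ) ^ ((a:ℝ) / 2)) ^ 2 = 2 ^ a := by
      rw [← Real.rpow_natCast, ← Real.rpow_mul (by norm_num), ← Real.rpow_natCast]
      congr 1
      push_cast
      ring
    have h3 := pow_lt_pow_left₀ h (abs_nonneg _) two_ne_zero
    rw [h2] at h3
    have h4 := abs_natSub_add_natSub (Nat.fib n + Nat.fib m + Nat.fib l) (2 ^ a)
    push_cast [-Nat.cast_sub] at h4
    rw [← h4] at h3
    exact_mod_cast h3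
  have ha75 : a < 75 := by
    by_contra! hc
    have hF : Nat.fib n ≤ Nat.fib 100 := Nat.fib_mono hn100.le
    have f1 := Nat.fib_mono hnm
    have f2 := Nat.fib_mono hml
    have h100 : Nat.fib 100 < 2 ^ 70 := by norm_num
    have hA : 2 ^ 75 ≤ 2 ^ a := Nat.pow_le_pow_right (by norm_num) hc
    generalize 2 ^ a = A at *
    have : A ≤ 2 * ((Nat.fib n + Nat.fib m + Nat.fib l - A) +
      (A - (Nat.fib n + Nat.fib m + Nat.fib l))) := by omega
    nlinarith
  have hall : (List.range 75).all smallSolutionsBounded = true := by decide +kernel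
  exact bounded_of_smallSolutionsBounded (List.all_eq_true.1 hall a (List.mem_range.2 ha75))
    hn100 hnm hml hd
end

section
/- If n, m, l, a are positive integers with n ≥ m ≥ l and n ≤ 550 satisfying |F_n + F_m + F_l - 2^a| < 2^(a/2), then n ≤ 42 and a ≤ 28. -/
/-- `f n`, written as a case split so that the kernel evaluates `n` to a numeral first. -/
def forceNat (n : ℕ) (f : ℕ → Bool) : Bool :=
  match n with
  | 0 => f 0
  | k + 1 => f (k + 1)

theorem forceNat_eq (n : ℕ) (f : ℕ → Bool) : forceNat n f = f n := by
  cases n <;> rfl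

/-- With `x = fib i` and `y = fib (i - 1)`, search downwards for an index `1 ≤ j ≤ i` such that
`fib j ≤ hi` and `g j (fib j) (fib (j - 1)) (lo - fib j) (hi - fib j)` holds, stopping as soon as
`(k + 1) * fib j < lo`. -/
def fibDescent (k : ℕ) (g : ℕ → ℕ → ℕ → ℕ → ℕ → Bool) : ℕ → ℕ → ℕ → ℕ → ℕ → Bool
  | 0, _, _, _, _ => false
  | i + 1, x, y, lo, hi =>
    Nat.ble lo ((k + 1) * x) &&
      ((Nat.ble x hi && g (i + 1) x y (lo - x) (hi - x)) ||
        forceNat (x - y) fun z => fibDescent k g i y z lo hi)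

theorem fibDescent_eq_true {k : ℕ} {g : ℕ → ℕ → ℕ → ℕ → ℕ → Bool} {lo hi s j : ℕ} (hj : 0 < j)
    (hs : s ≤ k * Nat.fib j) (hlo : lo ≤ Nat.fib j + s) (hhi : Nat.fib j ≤ hi)
    (hg : g j (Nat.fib j) (Nat.fib (j - 1)) (lo - Nat.fib j) (hi - Nat.fib j) = true)
    {i : ℕ} (hji : j ≤ i) :
    fibDescent k g i (Nat.fib i) (Nat.fib (i - 1)) lo hi = true := by
  induction i with
  | zero => omega
  | succ i ih =>
    have hprune : lo ≤ (k + 1) * Nat.fib (i + 1) := by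
      have := Nat.mul_le_mul_left (k + 1) (Nat.fib_mono hji)
      linarith [add_mul k 1 (Nat.fib j)]
    rw [fibDescent, forceNat_eq, Bool.and_eq_true, Bool.or_eq_true, Bool.and_eq_true]
    refine ⟨Nat.ble_eq_true_of_le hprune, ?_⟩
    rcases hji.eq_or_lt with rfl | hlt
    · exact .inl ⟨Nat.ble_eq_true_of_le hhi, hg⟩
    · have hsub : Nat.fib (i + 1) - Nat.fib i = Nat.fib (i - 1) := by
        obtain ⟨t, rfl⟩ : ∃ t, i = t + 1 := ⟨i - 1, by omega⟩
        rw [Nat.fib_add_two]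
        simp
      right
      simpa [hsub] using ih (by omega)

/-- Search for a sum of three positive-index Fibonacci numbers between `lo` and `hi`, the largest
index being at most `i`, where `x = fib i` and `y = fib (i - 1)`. -/
def fibSumThreeSearch : ℕ → ℕ → ℕ → ℕ → ℕ → Bool :=
  fibDescent 2 (fibDescent 1 (fibDescent 0 fun _ _ _ lo _ => Nat.beq lo 0))

theorem fibSumThreeSearch_eq_true {i n m l lo hi : ℕ} (hl : 0 < l) (hml : l ≤ m) (hnm : m ≤ n)
    (hni : n ≤ i) (hlo : lo ≤ Nat.fib n + Nat.fib m + Nat.fib l)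
    (hhi : Nat.fib n + Nat.fib m + Nat.fib l ≤ hi) :
    fibSumThreeSearch i (Nat.fib i) (Nat.fib (i - 1)) lo hi = true := by
  have hfml := Nat.fib_mono hml
  have hfnm := Nat.fib_mono hnm
  refine fibDescent_eq_true (s := Nat.fib m + Nat.fib l) (by omega) (by omega) (by omega)
    (by omega) ?_ hni
  refine fibDescent_eq_true (s := Nat.fib l) (by omega) (by omega) (by omega) (by omega) ?_ hnm
  refine fibDescent_eq_true (s := 0) hl (by omega) (by omega) (by omega) ?_ hml
  exact Nat.beq_eq ▸ (by omega)

theorem fib_550_and_549 :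
    Nat.fib 550 =
      3923892811677015020359893809756397635478575034984185810645229419917883032980568363855269097880889736899565213021775 ∧
    Nat.fib 549 =
      2425099125827785565352530979017842728315720351477448650144765807862542296838080812347151296511676978020230832740674 := by
  norm_num

theorem fibSumThreeSearch_eq_false : ∀ b < 355,
    fibSumThreeSearch 550
      3923892811677015020359893809756397635478575034984185810645229419917883032980568363855269097880889736899565213021775
      2425099125827785565352530979017842728315720351477448650144765807862542296838080812347151296511676978020230832740674
      (2 ^ (b + 29) - 2 ^ ((b + 30) / 2)) (2 ^ (b + 29) + 2 ^ ((b + 30) / 2)) = false := by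
  decide +kernel

theorem near_two_pow_of_abs_sub_lt {s a : ℕ}
    (h : |(s : ℝ) - 2 ^ a| < (2 : ℝ) ^ ((a : ℝ) / 2)) :
    2 ^ a ≤ s + 2 ^ ((a + 1) / 2) ∧ s ≤ 2 ^ a + 2 ^ ((a + 1) / 2) := by
  have hexp : (a : ℝ) / 2 ≤ ((a + 1) / 2 : ℕ) := by
    have : (a : ℝ) ≤ (2 * ((a + 1) / 2) : ℕ) := by exact_mod_cast (by omega)
    push_cast at this ⊢
    linarith
  have hle : (2 : ℝ) ^ ((a : ℝ) / 2) ≤ (2 : ℝ) ^ ((a + 1) / 2) := by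
    rw [← Real.rpow_natCast]
    exact Real.rpow_le_rpow_of_exponent_le one_le_two hexp
  obtain ⟨h₁, h₂⟩ := abs_lt.1 (h.trans_le hle)
  constructor
  · have : (2 : ℝ) ^ a ≤ s + 2 ^ ((a + 1) / 2) := by linarith
    exact_mod_cast this
  · have : (s : ℝ) ≤ 2 ^ a + 2 ^ ((a + 1) / 2) := by linarith
    exact_mod_cast this

set_option exponentiation.threshold 400 in
theorem small_solutions_bound
    (n m l a : ℕ) (hn : 0 < n) (hm : 0 < m) (hl : 0 < l) (ha : 0 < a)
    (hnm : m ≤ n) (hml : l ≤ m) (hn550 : n ≤ 550)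
    (h : |(Nat.fib n : ℝ) + Nat.fib m + Nat.fib l - 2 ^ a| < (2 : ℝ) ^ ((a : ℝ) / 2)) :
    n ≤ 42 ∧ a ≤ 28 := by
  obtain ⟨hlo, hhi⟩ := near_two_pow_of_abs_sub_lt
    (s := Nat.fib n + Nat.fib m + Nat.fib l) (by exact_mod_cast h)
  have ha28 : a ≤ 28 := by
    by_contra! hlt
    obtain ⟨b, rfl⟩ : ∃ b, a = b + 29 := ⟨a - 29, by omega⟩
    by_cases hb : b < 355
    · have hsearch := fibSumThreeSearch_eq_true (i := 550) hl hml hnm hn550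
        (Nat.sub_le_of_le_add hlo) hhi
      rw [fib_550_and_549.1, fib_550_and_549.2, fibSumThreeSearch_eq_false b hb] at hsearch
      exact Bool.false_ne_true hsearch
    · have hn' := Nat.fib_mono hn550
      have hm' := Nat.fib_mono (hnm.trans hn550)
      have hl' := Nat.fib_mono ((hml.trans hnm).trans hn550)
      have hfib : 3 * Nat.fib 550 < 2 ^ 383 := by norm_num
      have hhalf : 2 ^ ((b + 29 + 1) / 2) ≤ 2 ^ (b + 28) :=
        Nat.pow_le_pow_right two_pos (by omega)
      have hbig : 2 ^ 383 ≤ 2 ^ (b + 28) := Nat.pow_le_pow_right two_pos (by omega)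
      have hsplit : 2 ^ (b + 29) = 2 * 2 ^ (b + 28) := by ring
      omega
  refine ⟨?_, ha28⟩
  by_contra! hlt
  have hn' := Nat.fib_mono (show 43 ≤ n from hlt)
  have hfib : Nat.fib 43 = 433494437 := by norm_num
  have hpow : 2 ^ a ≤ 2 ^ 28 := Nat.pow_le_pow_right two_pos ha28
  have hhalf : 2 ^ ((a + 1) / 2) ≤ 2 ^ 14 := Nat.pow_le_pow_right two_pos (by omega)
  omega
end

section
/- For all integers n > m > l > 1, we have 0.38·α^n < F_n + F_m + F_l < 0.97·α^n, where α = (1+√5)/2 is the golden ratio. -/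
/-- Fibonacci numbers from index `4` on are within explicit constant factors of the powers of
the golden ratio. -/
theorem fib_add_four_bounds (k : ℕ) :
    0.38 * ((1 + Real.sqrt 5) / 2) ^ (k + 4) < (Nat.fib (k + 4) : ℝ) ∧
    2 * (Nat.fib (k + 4) : ℝ) < 0.97 * ((1 + Real.sqrt 5) / 2) ^ (k + 4) := by
  have h5 : Real.sqrt 5 ^ 2 = 5 := Real.sq_sqrt (by norm_num)
  have hlo : 2.236 < Real.sqrt 5 := Real.lt_sqrt_of_sq_lt (by norm_num)
  have hhi : Real.sqrt 5 < 2.237 := (Real.sqrt_lt' (by norm_num)).2 (by norm_num)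
  set α := (1 + Real.sqrt 5) / 2 with hα
  have hsq : α ^ 2 = α + 1 := by rw [hα]; linarith
  have h4 : α ^ 4 = 3 * α + 2 := by linear_combination (α ^ 2 + α + 2) * hsq
  have h5' : α ^ 5 = 5 * α + 3 := by linear_combination α * h4 + 3 * hsq
  induction k using Nat.twoStepInduction with
  | zero =>
    have hf : Nat.fib 4 = 3 := rfl
    rw [Nat.zero_add, h4, hf]
    constructor <;> norm_num <;> linarith
  | one =>
    have hf : Nat.fib 5 = 5 := rfl
    rw [show 1 + 4 = 5 from rfl, h5', hf]
    constructor <;> norm_num <;> linarith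
  | more k ih₀ ih₁ =>
    have hf : (Nat.fib (k + 2 + 4) : ℝ) = Nat.fib (k + 4) + Nat.fib (k + 1 + 4) := by
      exact_mod_cast (Nat.fib_add_two (n := k + 4))
    have hp : α ^ (k + 2 + 4) = α ^ (k + 4) + α ^ (k + 1 + 4) := by
      linear_combination α ^ (k + 4) * hsq
    rw [hf, hp]
    constructor <;> linarith [ih₀.1, ih₀.2, ih₁.1, ih₁.2]

theorem sum_three_fib_bounds (n m l : ℕ) (hnm : m < n) (hml : l < m) (hl : 1 < l) :
    0.38 * ((1 + Real.sqrt 5) / 2) ^ n < (Nat.fib n : ℝ) + Nat.fib m + Nat.fib l ∧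
    (Nat.fib n : ℝ) + Nat.fib m + Nat.fib l < 0.97 * ((1 + Real.sqrt 5) / 2) ^ n := by
  obtain ⟨k, rfl⟩ : ∃ k, n = k + 4 := ⟨n - 4, by omega⟩
  have hm : Nat.fib m ≤ Nat.fib (k + 3) := Nat.fib_mono (by omega)
  have hl' : Nat.fib l ≤ Nat.fib (k + 2) := Nat.fib_mono (by omega)
  have hf : Nat.fib (k + 4) = Nat.fib (k + 2) + Nat.fib (k + 3) := Nat.fib_add_two
  have hsum : (Nat.fib m : ℝ) + Nat.fib l ≤ Nat.fib (k + 4) := by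
    exact_mod_cast (by omega : Nat.fib m + Nat.fib l ≤ Nat.fib (k + 4))
  have hm0 : (0 : ℝ) ≤ Nat.fib m := Nat.cast_nonneg _
  have hl0 : (0 : ℝ) ≤ Nat.fib l := Nat.cast_nonneg _
  obtain ⟨hlow, hupp⟩ := fib_add_four_bounds k
  constructor <;> linarith
end

section
/- Let n, m, l, a be positive integers with n > m > l > 1 and a ≥ 2 satisfying |F_n + F_m + F_l - 2^a| < 2^(a/2). Then n·(log α / log 2) + (log 0.38 / log 2) - 1 < a < n·(log α / log 2) + 1, where α = (1+√5)/2; in particular a < n. -/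
open Real in
lemma goldenRatio_pow_le_fib_add_two (k : ℕ) : goldenRatio ^ k ≤ (Nat.fib (k + 2) : ℝ) := by
  induction k using Nat.twoStepInduction with
  | zero => norm_num
  | one => norm_num [Nat.fib_add_two, goldenRatio_lt_two.le]
  | more k h₀ h₁ =>
    have e : goldenRatio ^ (k + 2) = goldenRatio ^ k + goldenRatio ^ (k + 1) := by
      rw [pow_add, goldenRatio_sq]; ring
    rw [Nat.fib_add_two, e]
    push_cast
    linarith

open Real in
lemma two_mul_fib_add_two_le_goldenRatio_pow (k : ℕ) :
    2 * (Nat.fib (k + 2) : ℝ) ≤ goldenRatio ^ (k + 2) := by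
  have hφ : (3 / 2 : ℝ) < goldenRatio := by
    have : (2 : ℝ) < √5 := by rw [Real.lt_sqrt] <;> norm_num
    rw [goldenRatio]
    linarith
  have hsq := goldenRatio_sq
  induction k using Nat.twoStepInduction with
  | zero => norm_num; linarith
  | one =>
    have hcube : goldenRatio ^ (1 + 2) = 2 * goldenRatio + 1 := by
      linear_combination (goldenRatio + 1) * hsq
    norm_num [Nat.fib_add_two] at hcube ⊢
    linarith
  | more k h₀ h₁ =>
    have e : goldenRatio ^ (k + 2 + 2) = goldenRatio ^ (k + 2) + goldenRatio ^ (k + 1 + 2) := by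
      rw [pow_add _ (k + 2) 2, hsq]; ring
    rw [Nat.fib_add_two (n := k + 2), e]
    push_cast
    linarith

theorem a_n_relation
    (n m l a : ℕ) (hnm : m < n) (hml : l < m) (hl : 1 < l) (ha : 2 ≤ a)
    (h : |(Nat.fib n : ℝ) + Nat.fib m + Nat.fib l - 2 ^ a| < (2 : ℝ) ^ ((a : ℝ) / 2)) :
    (n : ℝ) * (Real.log ((1 + Real.sqrt 5) / 2) / Real.log 2) +
      Real.log 0.38 / Real.log 2 - 1 < (a : ℝ) ∧
    (a : ℝ) < (n : ℝ) * (Real.log ((1 + Real.sqrt 5) / 2) / Real.log 2) + 1 ∧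
    a < n := by
  change (n : ℝ) * (Real.log Real.goldenRatio / Real.log 2) +
      Real.log 0.38 / Real.log 2 - 1 < (a : ℝ) ∧
    (a : ℝ) < (n : ℝ) * (Real.log Real.goldenRatio / Real.log 2) + 1 ∧ a < n
  have hφ0 := Real.goldenRatio_pos
  have hφ : Real.goldenRatio < 1.62 := by
    have : √5 < (2.24 : ℝ) := by rw [Real.sqrt_lt'] <;> norm_num
    rw [Real.goldenRatio]
    linarith
  have hsq := Real.goldenRatio_sq
  have hn : (4 : ℝ) ≤ n := by exact_mod_cast (by omega : 4 ≤ n)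
  obtain ⟨k, rfl⟩ : ∃ k, n = k + 2 := ⟨n - 2, by omega⟩
  have hlow : 0.38 * Real.goldenRatio ^ (k + 2) < (Nat.fib (k + 2) : ℝ) := by
    refine lt_of_lt_of_le ?_ (goldenRatio_pow_le_fib_add_two k)
    have hk : 0 < Real.goldenRatio ^ k := by positivity
    rw [pow_add, hsq]
    nlinarith
  have hupp := two_mul_fib_add_two_le_goldenRatio_pow k
  have hsum : (Nat.fib m : ℝ) + Nat.fib l ≤ Nat.fib (k + 2) := by
    have h₁ : Nat.fib m ≤ Nat.fib (k + 1) := Nat.fib_mono (by omega)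
    have h₂ : Nat.fib l ≤ Nat.fib k := Nat.fib_mono (by omega)
    have h₃ := Nat.fib_add_two (n := k)
    exact_mod_cast (by omega : Nat.fib m + Nat.fib l ≤ Nat.fib (k + 2))
  have hhalf : 2 * (2 : ℝ) ^ ((a : ℝ) / 2) ≤ 2 ^ a := by
    have ha' : (2 : ℝ) ≤ a := by exact_mod_cast ha
    rw [← Real.rpow_natCast 2 a, ← Real.rpow_one_add' (by norm_num) (by positivity)]
    exact Real.rpow_le_rpow_of_exponent_le (by norm_num) (by linarith)
  obtain ⟨hl', hu'⟩ := abs_lt.mp h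
  have hm0 : (0 : ℝ) ≤ Nat.fib m := by positivity
  have hl0 : (0 : ℝ) ≤ Nat.fib l := by positivity
  have h2a : (0 : ℝ) < 2 ^ a := by positivity
  have hlog2 : 0 < Real.log 2 := Real.log_pos (by norm_num)
  have hA : Real.log (0.38 * Real.goldenRatio ^ (k + 2)) < Real.log (2 * 2 ^ a) :=
    Real.log_lt_log (by positivity) (by linarith)
  have hB : Real.log (2 ^ a) < Real.log (2 * Real.goldenRatio ^ (k + 2)) :=
    Real.log_lt_log (by positivity) (by linarith)
  rw [Real.log_mul (by norm_num) (by positivity), Real.log_mul (by norm_num) (by positivity),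
    Real.log_pow, Real.log_pow] at hA
  rw [Real.log_mul (by norm_num) (by positivity), Real.log_pow, Real.log_pow] at hB
  have hupper : (a : ℝ) < ((k + 2 : ℕ) : ℝ) * (Real.log Real.goldenRatio / Real.log 2) + 1 := by
    rw [← mul_lt_mul_iff_left₀ hlog2]
    field_simp
    linarith
  refine ⟨?_, hupper, ?_⟩
  · rw [← mul_lt_mul_iff_left₀ hlog2]
    field_simp
    linarith
  · have hratio : Real.log Real.goldenRatio / Real.log 2 ≤ 3 / 4 := by
      have hpow : Real.goldenRatio ^ 4 ≤ 2 ^ 3 := by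
        have : Real.goldenRatio ^ 4 = 3 * Real.goldenRatio + 2 := by
          linear_combination (Real.goldenRatio ^ 2 + Real.goldenRatio + 2) * hsq
        linarith
      have hlog := Real.log_le_log (by positivity) hpow
      rw [Real.log_pow, Real.log_pow] at hlog
      push_cast at hlog
      rw [div_le_iff₀ hlog2]
      linarith
    have : (a : ℝ) < ((k + 2 : ℕ) : ℝ) := by nlinarith
    exact_mod_cast this
end

section
/- Let n, m, l, a be positive integers with n ≥ 4, m ≥ 2, l ≥ 2, n > m, n > l satisfying |F_n + F_m + F_l - 2^a| < 2^(a/2). Then |α^n·(1 + α^(m-n) + α^(l-n))/(2^a·√5) - 1| < 2^(1 - a/2), where α = (1+√5)/2. -/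
open Real in
theorem goldenRatio_pow_eq_sqrt_five_mul_fib_add_goldenConj_pow (k : ℕ) :
    goldenRatio ^ k = √5 * Nat.fib k + goldenConj ^ k := by
  rw [coe_fib_eq]
  field_simp
  ring

open Real in
theorem abs_goldenConj_pow_le_half {k : ℕ} (hk : 2 ≤ k) : |goldenConj ^ k| ≤ 1 / 2 := by
  have hneg := goldenConj_neg
  have hgt := neg_one_lt_goldenConj
  have hsq := goldenConj_sq
  have habs : |goldenConj| ≤ 1 := abs_le.2 ⟨hgt.le, by linarith⟩
  calc |goldenConj ^ k| = |goldenConj| ^ k := abs_pow _ _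
    _ ≤ |goldenConj| ^ 2 := pow_le_pow_of_le_one (abs_nonneg _) habs hk
    _ = goldenConj ^ 2 := sq_abs _
    _ ≤ 1 / 2 := by nlinarith

theorem first_linear_form_bound
    (n m l a : ℕ) (hn : 4 ≤ n) (hm : 2 ≤ m) (hl : 2 ≤ l) (ha : 0 < a)
    (hnm : m < n) (hnl : l < n)
    (h : |(Nat.fib n : ℝ) + Nat.fib m + Nat.fib l - 2 ^ a| < (2 : ℝ) ^ ((a : ℝ) / 2)) :
    |((1 + Real.sqrt 5) / 2) ^ n *
        (1 + ((1 + Real.sqrt 5) / 2) ^ ((m : ℤ) - n) +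
          ((1 + Real.sqrt 5) / 2) ^ ((l : ℤ) - n)) / (2 ^ a * Real.sqrt 5) - 1| <
      (2 : ℝ) ^ (1 - (a : ℝ) / 2) := by
  change |Real.goldenRatio ^ n * (1 + Real.goldenRatio ^ ((m : ℤ) - n) +
    Real.goldenRatio ^ ((l : ℤ) - n)) / (2 ^ a * Real.sqrt 5) - 1| < _
  have hx : (1 : ℝ) ≤ (2 : ℝ) ^ ((a : ℝ) / 2) :=
    Real.one_le_rpow one_le_two (by positivity)
  have hxsq : (2 : ℝ) ^ a = (2 : ℝ) ^ ((a : ℝ) / 2) * (2 : ℝ) ^ ((a : ℝ) / 2) := by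
    rw [← Real.rpow_add two_pos, add_halves, Real.rpow_natCast]
  rw [Real.rpow_sub two_pos, Real.rpow_one, hxsq]
  rw [hxsq] at h
  generalize (2 : ℝ) ^ ((a : ℝ) / 2) = x at *
  have hx0 : 0 < x := by linarith
  have h5 : (3 : ℝ) / 2 ≤ √5 := Real.le_sqrt_of_sq_le (by norm_num)
  have h50 : 0 < √5 := by linarith
  have hconj : |(Real.goldenConj ^ n + Real.goldenConj ^ m + Real.goldenConj ^ l) / √5| ≤ 1 := by
    rw [abs_div, abs_of_pos h50, div_le_one h50]
    have h3 := abs_add_three (Real.goldenConj ^ n) (Real.goldenConj ^ m) (Real.goldenConj ^ l)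
    linarith [abs_goldenConj_pow_le_half (show 2 ≤ n by omega), abs_goldenConj_pow_le_half hm,
      abs_goldenConj_pow_le_half hl]
  have hform : Real.goldenRatio ^ n * (1 + Real.goldenRatio ^ ((m : ℤ) - n) +
      Real.goldenRatio ^ ((l : ℤ) - n)) / (x * x * √5) - 1 =
      ((Nat.fib n + Nat.fib m + Nat.fib l - x * x) +
        (Real.goldenConj ^ n + Real.goldenConj ^ m + Real.goldenConj ^ l) / √5) / (x * x) := by
    have hshift (k : ℕ) :
        Real.goldenRatio ^ n * Real.goldenRatio ^ ((k : ℤ) - n) = Real.goldenRatio ^ k := by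
      rw [← zpow_natCast, ← zpow_add₀ Real.goldenRatio_ne_zero, add_sub_cancel, zpow_natCast]
    rw [mul_add, mul_add, mul_one, hshift, hshift]
    simp only [goldenRatio_pow_eq_sqrt_five_mul_fib_add_goldenConj_pow]
    field_simp
    ring
  rw [hform, abs_div, abs_of_pos (mul_pos hx0 hx0), div_lt_div_iff₀ (mul_pos hx0 hx0) hx0]
  have hsum : |(Nat.fib n + Nat.fib m + Nat.fib l - x * x) +
      (Real.goldenConj ^ n + Real.goldenConj ^ m + Real.goldenConj ^ l) / √5| < 2 * x :=
    (abs_add_le _ _).trans_lt (by linarith)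
  nlinarith
end

section
/- Let n, m, l, a be positive integers with n > m > l > 1 satisfying |F_n + F_m + F_l - 2^a| < 2^(a/2), and assume a < n. Then |1 - 2^a · α^(-n) · √5| < 2√5 · max{α^(m-n), α^(l-n), α^(a-n)}, where α = (1+√5)/2. -/
open Real in
theorem fib_succ_add_one_le_goldenRatio_pow (m : ℕ) :
    (Nat.fib (m + 4) : ℝ) + 1 ≤ goldenRatio ^ (m + 3) := by
  have hsq := goldenRatio_sq
  have hlow : (3 / 2 : ℝ) ≤ goldenRatio := by
    nlinarith [goldenRatio_pos]
  induction m using Nat.twoStepInduction with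
  | zero =>
    have h3 : goldenRatio ^ 3 = 2 * goldenRatio + 1 := by linear_combination (goldenRatio + 1) * hsq
    norm_num [Nat.fib_add_two, h3]
    linarith
  | one =>
    have h4 : goldenRatio ^ 4 = 3 * goldenRatio + 2 := by
      linear_combination (goldenRatio ^ 2 + goldenRatio + 2) * hsq
    norm_num [Nat.fib_add_two, h4]
    linarith
  | more k h₀ h₁ =>
    have hfib : (Nat.fib (k + 2 + 4) : ℝ) = Nat.fib (k + 4) + Nat.fib (k + 1 + 4) := by
      exact_mod_cast Nat.fib_add_two (n := k + 4)
    have hpow : goldenRatio ^ (k + 2 + 3) = goldenRatio ^ (k + 3) + goldenRatio ^ (k + 1 + 3) := by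
      linear_combination goldenRatio ^ (k + 3) * hsq
    linarith

open Real in
theorem abs_goldenRatio_pow_div_sqrt_five_sub_fib_lt_one (n : ℕ) :
    |goldenRatio ^ n / √5 - Nat.fib n| < 1 := by
  have h5 : (1 : ℝ) < √5 := by rw [Real.lt_sqrt] <;> norm_num
  have hψ : |goldenConj| ≤ 1 :=
    abs_le.2 ⟨neg_one_lt_goldenConj.le, goldenConj_neg.le.trans zero_le_one⟩
  rw [coe_fib_eq, ← sub_div, sub_sub_cancel, abs_div, abs_pow, abs_of_pos (by linarith : 0 < √5),
    div_lt_one (by linarith)]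
  exact (pow_le_one₀ (abs_nonneg _) hψ).trans_lt h5

open Real in
theorem two_rpow_half_lt_goldenRatio_pow {a : ℕ} (ha : 0 < a) :
    (2 : ℝ) ^ ((a : ℝ) / 2) < goldenRatio ^ a := by
  rw [div_eq_inv_mul, rpow_mul_natCast (by norm_num)]
  refine pow_lt_pow_left₀ ?_ (by positivity) ha.ne'
  rw [← one_div, ← sqrt_eq_rpow, sqrt_lt' goldenRatio_pos, goldenRatio_sq]
  linarith [one_lt_goldenRatio]

theorem second_linear_form_bound
    (n m l a : ℕ) (hnm : m < n) (hml : l < m) (hl : 1 < l) (ha : 0 < a) (han : a < n)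
    (h : |(Nat.fib n : ℝ) + Nat.fib m + Nat.fib l - 2 ^ a| < (2 : ℝ) ^ ((a : ℝ) / 2)) :
    |1 - 2 ^ a * ((1 + Real.sqrt 5) / 2) ^ (-(n : ℤ)) * Real.sqrt 5| <
      2 * Real.sqrt 5 *
        max (((1 + Real.sqrt 5) / 2) ^ ((m : ℤ) - n))
          (max (((1 + Real.sqrt 5) / 2) ^ ((l : ℤ) - n))
            (((1 + Real.sqrt 5) / 2) ^ ((a : ℤ) - n))) := by
  change |1 - 2 ^ a * Real.goldenRatio ^ (-(n : ℤ)) * √5| < 2 * √5 *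
    max (Real.goldenRatio ^ ((m : ℤ) - n))
      (max (Real.goldenRatio ^ ((l : ℤ) - n)) (Real.goldenRatio ^ ((a : ℤ) - n)))
  have hφ := Real.goldenRatio_pos
  have h5 : 0 < √(5 : ℝ) := by positivity
  set M := max (Real.goldenRatio ^ ((m : ℤ) - n))
    (max (Real.goldenRatio ^ ((l : ℤ) - n)) (Real.goldenRatio ^ ((a : ℤ) - n))) with hM
  have hpow (k : ℕ) (hk : Real.goldenRatio ^ ((k : ℤ) - n) ≤ M) :
      Real.goldenRatio ^ k ≤ M * Real.goldenRatio ^ n := by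
    rwa [zpow_sub₀ hφ.ne', zpow_natCast, zpow_natCast, div_le_iff₀ (by positivity)] at hk
  have hMm := hpow m (le_max_left _ _)
  have hMa := hpow a ((le_max_right _ _).trans (le_max_right _ _))
  have hrpow := two_rpow_half_lt_goldenRatio_pow ha
  have hfib : (Nat.fib m : ℝ) + Nat.fib l + 1 ≤ Real.goldenRatio ^ m := by
    obtain ⟨k, rfl⟩ : ∃ k, m = k + 3 := ⟨m - 3, by omega⟩
    have hl' : (Nat.fib l : ℝ) ≤ Nat.fib (k + 2) := by
      exact_mod_cast Nat.fib_mono (by omega)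
    have hsum : (Nat.fib (k + 4) : ℝ) = Nat.fib (k + 2) + Nat.fib (k + 3) := by
      exact_mod_cast Nat.fib_add_two (n := k + 2)
    linarith [fib_succ_add_one_le_goldenRatio_pow k]
  have key : |Real.goldenRatio ^ n / √5 - 2 ^ a| < 2 * (M * Real.goldenRatio ^ n) := by
    have hn := abs_lt.1 (abs_goldenRatio_pow_div_sqrt_five_sub_fib_lt_one n)
    have h' := abs_lt.1 h
    have hm₀ : (0 : ℝ) ≤ Nat.fib m := Nat.cast_nonneg _
    have hl₀ : (0 : ℝ) ≤ Nat.fib l := Nat.cast_nonneg _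
    rw [abs_lt]
    constructor <;> linarith
  have hfactor : 1 - 2 ^ a * Real.goldenRatio ^ (-(n : ℤ)) * √5 =
      (Real.goldenRatio ^ n / √5 - 2 ^ a) * (√5 / Real.goldenRatio ^ n) := by
    rw [zpow_neg, zpow_natCast]
    field_simp
  rw [hfactor, abs_mul, abs_of_pos (by positivity : 0 < √5 / Real.goldenRatio ^ n)]
  calc _ < 2 * (M * Real.goldenRatio ^ n) * (√5 / Real.goldenRatio ^ n) := by gcongr
    _ = 2 * √5 * M := by field_simp
end

section
/- Let τ be an irrational real number with continued fraction expansion [a_0; a_1, a_2, ...] and convergents p_0/q_0, p_1/q_1, p_2/q_2, .... Let M be a positive integer and let N be a non-negative integer such that q_N > M. Put a(M) := max{a_i : i = 0, 1, ..., N}. Then for all pairs (r, s) of positive integers with 0 < s < M, we have |τ - r/s| > 1/((a(M) + 2)·s²). -/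
open GenContFract (of)

namespace GenContFract

variable {K : Type*} [Field K] [LinearOrder K] [FloorRing K] {v : K} {n : ℕ}

theorem of_exists_int_contsAux (v : K) (n : ℕ) :
    (∃ a b : ℤ, (of v).contsAux n = ⟨a, b⟩) ∧ ∃ a b : ℤ, (of v).contsAux (n + 1) = ⟨a, b⟩ := by
  induction n with
  | zero => exact ⟨⟨1, 0, by simp⟩, ⟨⌊v⌋, 1, by simp⟩⟩
  | succ n ih =>
    refine ⟨ih.2, ?_⟩
    obtain ⟨⟨a, b, h⟩, a', b', h'⟩ := ih
    rcases hs : (of v).s.get? n with _ | gp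
    · exact ⟨a', b', by rw [contsAux_stable_step_of_terminated hs, h']⟩
    · obtain ⟨ha, z, hz⟩ := of_partNum_eq_one_and_exists_int_partDen_eq hs
      refine ⟨z * a' + a, z * b' + b, ?_⟩
      rw [contsAux_recurrence hs h h', ha, hz]
      simp

theorem of_exists_int_nums (v : K) (n : ℕ) : ∃ a : ℤ, (of v).nums n = a := by
  obtain ⟨a, b, h⟩ := (of_exists_int_contsAux v n).2
  exact ⟨a, by rw [num_eq_conts_a, nth_cont_eq_succ_nth_contAux, h]⟩

theorem of_exists_int_dens (v : K) (n : ℕ) : ∃ b : ℤ, (of v).dens n = b := by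
  obtain ⟨a, b, h⟩ := (of_exists_int_contsAux v n).2
  exact ⟨b, by rw [den_eq_conts_b, nth_cont_eq_succ_nth_contAux, h]⟩

variable [IsStrictOrderedRing K]

theorem of_dens_monotone (v : K) : Monotone (of v).dens :=
  monotone_nat_of_le_succ fun _ => of_den_mono

theorem of_dens_pos (v : K) (n : ℕ) : 0 < (of v).dens n :=
  zero_lt_one.trans_le <| by simpa using of_dens_monotone v n.zero_le

theorem of_contsAux_b_le_dens (v : K) (n : ℕ) : ((of v).contsAux n).b ≤ (of v).dens n := by
  cases n with
  | zero => simp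
  | succ n => exact of_den_mono

/-- A convergent is in lowest terms: any fraction equal to it has a denominator at least as
large. -/
theorem of_dens_le_of_convs_eq_div (h : ¬(of v).TerminatedAt n) {r s : ℤ} (hs : 0 < s)
    (hrs : (of v).convs n = r / s) : (of v).dens n ≤ s := by
  obtain ⟨a, ha⟩ := of_exists_int_nums v (n + 1)
  obtain ⟨b, hb⟩ := of_exists_int_dens v (n + 1)
  have hB := of_dens_pos v n
  have hsK : (0 : K) < s := by exact_mod_cast hs
  have hdet : (of v).nums n * (of v).dens (n + 1) - (of v).dens n * (of v).nums (n + 1)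
      = (-1) ^ (n + 1) := (SimpContFract.of v).determinant h
  rw [conv_eq_num_div_den, div_eq_div_iff hB.ne' hsK.ne'] at hrs
  have key : (s : K) * (-1) ^ (n + 1) = (of v).dens n * ((r * b - s * a : ℤ) : K) := by
    rw [← hdet, ha, hb]
    push_cast
    linear_combination (b : K) * hrs
  have habs : (s : K) = (of v).dens n * ((|r * b - s * a| : ℤ) : K) := by
    have := congrArg abs key
    simpa [abs_mul, abs_of_pos hB, abs_of_pos hsK] using this
  have hne : (1 : K) ≤ ((|r * b - s * a| : ℤ) : K) := by
    have : r * b - s * a ≠ 0 := by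
      intro h0
      rw [h0] at habs
      simp [hsK.ne'] at habs
    exact_mod_cast Int.one_le_abs this
  rw [habs]
  exact le_mul_of_one_le_right hB.le hne

theorem one_div_lt_abs_sub_convs {b : K} (hb : (of v).partDens.get? n = some b) :
    1 / ((b + 2) * (of v).dens n ^ 2) < |v - (of v).convs n| := by
  obtain ⟨gp, hgp, rfl⟩ := exists_s_b_of_partDen hb
  obtain ⟨ifp', hifp', hb'⟩ := IntFractPair.exists_succ_get?_stream_of_gcf_of_get?_eq_some hgp
  obtain ⟨ifp, hifp, hfr, rfl⟩ := IntFractPair.succ_nth_stream_eq_some_iff.1 hifp'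
  have hsub : v - (of v).convs n
      = (-1) ^ n / ((of v).dens n * (ifp.fr⁻¹ * (of v).dens n + ((of v).contsAux n).b)) := by
    simpa only [if_neg hfr] using! sub_convs_eq hifp
  have hB := of_dens_pos v n
  have hpB0 : 0 ≤ ((of v).contsAux n).b := zero_le_of_contsAux_b
  have hpB := of_contsAux_b_le_dens v n
  have hfr0 : 0 < ifp.fr⁻¹ :=
    inv_pos.2 ((IntFractPair.nth_stream_fr_nonneg hifp).lt_of_ne' hfr)
  have hlt : ifp.fr⁻¹ < gp.b + 1 := by
    rw [← hb']
    exact Int.lt_floor_add_one _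
  have hden : 0 < (of v).dens n * (ifp.fr⁻¹ * (of v).dens n + ((of v).contsAux n).b) := by
    positivity
  rw [hsub, abs_div, abs_pow, abs_neg, abs_one, one_pow, abs_of_pos hden]
  apply one_div_lt_one_div_of_lt hden
  calc _ < (of v).dens n * ((gp.b + 1) * (of v).dens n + (of v).dens n) :=
        mul_lt_mul_of_pos_left (add_lt_add_of_lt_of_le (by gcongr) hpB) hB
    _ = _ := by ring

end GenContFract

open GenContFract in
theorem legendre_criterion
    (τ : ℝ) (hτ : Irrational τ)
    (cf : ℕ → ℝ)
    (hcf0 : cf 0 = ((GenContFract.of τ).h : ℝ))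
    (hcf : ∀ i : ℕ, (GenContFract.of τ).partDens.get? i = some (cf (i + 1)))
    (M : ℕ) (hM : 0 < M)
    (N : ℕ) (hqN : (M : ℝ) < (GenContFract.of τ).dens N)
    (aM : ℝ) (haM : aM = (Finset.range (N + 1)).sup' (by simp) cf)
    (r s : ℕ) (hr : 0 < r) (hs : 0 < s) (hsM : s < M) :
    1 / ((aM + 2) * (s : ℝ) ^ 2) < |τ - (r : ℝ) / s| := by
  have hle : ∀ n < N, cf (n + 1) ≤ aM := fun n hn => by
    rw [haM]
    exact Finset.le_sup' cf (by simpa using hn)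
  have hone : ∀ n, 1 ≤ cf (n + 1) := fun n => of_one_le_get?_partDen (hcf n)
  have hsR : (0 : ℝ) < s := by exact_mod_cast hs
  have hsMR : (s : ℝ) < M := by exact_mod_cast hsM
  have hN : 0 < N := by
    rcases Nat.eq_zero_or_pos N with rfl | h
    · rw [zeroth_den_eq_one] at hqN
      have : M < 1 := by exact_mod_cast hqN
      omega
    · exact h
  have haM1 : 1 ≤ aM := (hone 0).trans (hle 0 hN)
  by_cases h : |τ - (r : ℝ) / s| < 1 / (2 * (s : ℝ) ^ 2)
  · have hq : ((r / s : ℚ) : ℝ) = (r : ℝ) / s := by push_cast; rfl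
    have hden : (((r / s : ℚ).den : ℕ) : ℝ) ≤ s := by
      have : (r / s : ℚ).den ∣ s := by
        simpa [Rat.divInt_eq_div, Int.natCast_dvd_natCast] using Rat.den_dvd r s
      exact_mod_cast Nat.le_of_dvd hs this
    have hdpos : (0 : ℝ) < ((r / s : ℚ).den : ℕ) := by exact_mod_cast (r / s : ℚ).den_pos
    obtain ⟨n, hn⟩ := Real.exists_convs_eq_rat (ξ := τ) (q := (r / s : ℚ)) (by
      rw [hq]
      exact h.trans_le (by gcongr))
    rw [hq] at hn
    have hterm : ¬(of τ).TerminatedAt n := by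
      rw [terminatedAt_iff_partDen_none, hcf n]
      simp
    have hds : (of τ).dens n ≤ s := by
      simpa using of_dens_le_of_convs_eq_div hterm (r := r) (s := s) (by exact_mod_cast hs)
        (by simpa using hn)
    have hnN : n < N := by
      by_contra! hNn
      linarith [of_dens_monotone τ hNn]
    have hdn := of_dens_pos τ n
    have hbn := hle n hnN
    have hb1 := hone n
    calc 1 / ((aM + 2) * (s : ℝ) ^ 2) ≤ 1 / ((cf (n + 1) + 2) * (of τ).dens n ^ 2) := by gcongr
      _ < |τ - (r : ℝ) / s| := hn ▸ one_div_lt_abs_sub_convs (hcf n)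
  · refine lt_of_lt_of_le ?_ (not_lt.1 h)
    gcongr
    linarith
end

section
/- Let M be a positive integer, let γ be an irrational real number and let p/q be a convergent of the continued fraction of γ such that q > 6M. Let A, B, μ be real numbers with A > 0 and B > 1, and put ε := ‖μq‖ - M·‖γq‖, where ‖·‖ denotes the distance to the nearest integer. If ε > 0, then there is no solution to 0 < |u·γ - v + μ| < A·B^(-w) in positive integers u, v, w with u ≤ M and w ≥ log(A·q/ε)/log B. -/
theorem dujella_petho_reduction
    (M : ℕ) (hM : 0 < M)
    (γ : ℝ) (hγ : Irrational γ)
    (i : ℕ) (p : ℤ) (q : ℕ) (hq0 : 0 < q)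
    (hconv : (GenContFract.of γ).convs i = (p : ℝ) / q)
    (hden : ((q : ℝ)) = (GenContFract.of γ).dens i)
    (hq6M : 6 * M < q)
    (A B μ : ℝ) (hA : 0 < A) (hB : 1 < B)
    (ε : ℝ) (hε : ε = |μ * q - round (μ * q)| - M * |γ * q - round (γ * q)|)
    (hεpos : 0 < ε) :
    ¬ ∃ u v w : ℕ, 0 < u ∧ 0 < v ∧ 0 < w ∧ u ≤ M ∧
        Real.log (A * q / ε) / Real.log B ≤ (w : ℝ) ∧
        0 < |(u : ℝ) * γ - v + μ| ∧
        |(u : ℝ) * γ - v + μ| < A * B ^ (-(w : ℝ)) := by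
  rintro ⟨u, v, w, -, -, -, huM, hw, -, hlt⟩
  have hq : (0 : ℝ) < q := by exact_mod_cast hq0
  have hB0 : 0 < B := by linarith
  have huM' : (u : ℝ) ≤ M := by exact_mod_cast huM
  have hsmall : A * q ≤ ε * B ^ (w : ℝ) := by
    rw [div_le_iff₀ (Real.log_pos hB), ← Real.log_rpow hB0,
      Real.log_le_log_iff (by positivity) (by positivity), div_le_iff₀ hεpos] at hw
    linarith
  have hupper : (q : ℝ) * |(u : ℝ) * γ - v + μ| < ε := by
    calc (q : ℝ) * |(u : ℝ) * γ - v + μ| < q * (A * B ^ (-(w : ℝ))) := by gcongr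
      _ = A * q / B ^ (w : ℝ) := by rw [Real.rpow_neg hB0.le]; ring
      _ ≤ ε := by rwa [div_le_iff₀ (by positivity)]
  have hround := round_le (μ * q) ((v : ℤ) * q - u * round (γ * q))
  push_cast at hround
  have htriangle : |μ * q - ((v : ℝ) * q - u * round (γ * q))| ≤
      q * |(u : ℝ) * γ - v + μ| + u * |γ * q - round (γ * q)| := by
    calc |μ * q - ((v : ℝ) * q - u * round (γ * q))|
        = |q * ((u : ℝ) * γ - v + μ) - u * (γ * q - round (γ * q))| := by ring_nf
      _ ≤ |q * ((u : ℝ) * γ - v + μ)| + |u * (γ * q - round (γ * q))| := abs_sub _ _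
      _ = _ := by rw [abs_mul, abs_mul, Nat.abs_cast, Nat.abs_cast]
  have hscale := mul_le_mul_of_nonneg_right huM' (abs_nonneg (γ * q - round (γ * q)))
  linarith
end
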